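/- Let 0 < s ≤ u ≤ 2 and define χ(s,u) = s(2+u−2s)/(2+2u−3s) if u > 2s−1, and χ(s,u) = 1 if u ≤ 2s−1. If A is a Borel subset of ℝ² with Hausdorff dimension at least s and packing dimension at most u, then the set of points y ∈ ℝ² for which the pinned distance set Δ_y(A) has Hausdorff dimension strictly less than χ(s,u) has Hausdorff dimension at most max(1, 2−s). -/

import Mathlib

open MeasureTheory Set Filter
open scoped ENNReal NNReal

/-- The covering number of `A` by balls of radius `r` (as an extended nonnegative real;
`⊤` if no finite cover exists). -/
noncomputable def coverNum {X : Type*} [PseudoMetricSpace X] (A : Set X) (r : ℝ) : ℝ≥0∞ :=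
  ⨅ (t : Finset X) (_ : A ⊆ ⋃ x ∈ t, Metric.ball x r), (t.card : ℝ≥0∞)

open Classical in
/-- The upper box-counting (Minkowski) dimension of a set, computed along the scales `2⁻ⁿ`. -/
noncomputable def ubDim {X : Type*} [PseudoMetricSpace X] (A : Set X) : ℝ≥0∞ :=
  if ∃ n : ℕ, coverNum A (1 / 2 ^ n) = ⊤ then ⊤
  else limsup (fun n : ℕ =>
    ENNReal.ofReal (Real.logb 2 ((coverNum A (1 / 2 ^ n)).toReal) / n)) atTop

/-- The packing dimension of a set, defined as the modified upper box-counting dimension. -/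
noncomputable def pDim {X : Type*} [PseudoMetricSpace X] (A : Set X) : ℝ≥0∞ :=
  ⨅ (F : ℕ → Set X) (_ : A ⊆ ⋃ n, F n), ⨆ n, ubDim (F n)

/-- `ScaleChain g κ a c`: the scale `a` can be reached with accumulated loss at most `c`. -/
inductive ScaleChain (g : ℕ → ℝ) (κ : ℝ) : ℕ → ℝ → Prop
  | start (a : ℕ) (c : ℝ) (ha : 1 ≤ a) (hc : a + κ ≤ c) : ScaleChain g κ a c
  | step (a b : ℕ) (c d c' : ℝ) (h : ScaleChain g κ a c) (hab : a < b) (hb : b ≤ 2 * a)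
      (hd : ∀ x, a ≤ x → x ≤ b → g a - g x ≤ d) (hc : c + d + κ ≤ c') : ScaleChain g κ b c'

theorem ScaleChain.mono {g : ℕ → ℝ} {κ : ℝ} {a : ℕ} {c c' : ℝ} (h : ScaleChain g κ a c)
    (hc : c ≤ c') : ScaleChain g κ a c' := by
  cases h with
  | start _ _ ha h => exact .start _ _ ha (h.trans hc)
  | step a b c d c' h hab hb hd h' => exact .step _ _ _ _ _ h hab hb hd (h'.trans hc)

theorem ScaleChain.free {g : ℕ → ℝ} {κ : ℝ} {a b : ℕ} {c : ℝ} (hκ : 0 ≤ κ)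
    (h : ScaleChain g κ a c) (hab : a ≤ b) (hb : b ≤ 2 * a)
    (hd : ∀ x, a ≤ x → x ≤ b → g a ≤ g x) : ScaleChain g κ b (c + κ) := by
  rcases hab.eq_or_lt with rfl | hlt
  · exact h.mono (by linarith)
  · exact .step _ _ _ 0 _ h hlt hb (fun x h1 h2 => by linarith [hd x h1 h2]) (by linarith)

/-- `DescReach g B k x`: the scale `x` is linked to `B` by `k` steps, at each of which `g` is
minimised at the upper end. -/
def DescReach (g : ℕ → ℝ) (B : ℕ) : ℕ → ℕ → Prop
  | 0, x => x = B
  | k + 1, x => ∃ z, DescReach g B k z ∧ x ≤ z ∧ z ≤ 2 * x ∧ ∀ w, x ≤ w → w ≤ z → g z ≤ g w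

theorem DescReach.le {g : ℕ → ℝ} {B : ℕ} : ∀ {k x : ℕ}, DescReach g B k x → x ≤ B
  | 0, _, h => le_of_eq h
  | _ + 1, _, ⟨_, hz, h1, _⟩ => h1.trans hz.le

theorem DescReach.chain {g : ℕ → ℝ} {B : ℕ} {κ : ℝ} (hκ : 0 ≤ κ) :
    ∀ {k x : ℕ} {c : ℝ}, DescReach g B k x → ScaleChain g κ x c →
      ScaleChain g κ B (c + (g x - g B) + κ * k)
  | 0, x, c, h, hc => by
    have : x = B := h
    subst this
    exact hc.mono (by simp)
  | k + 1, x, c, ⟨z, hz, h1, h2, h3⟩, hc => by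
    have hzc : ScaleChain g κ z (c + (g x - g z) + κ) := by
      rcases h1.eq_or_lt with rfl | hlt
      · exact hc.mono (by linarith)
      · exact .step _ _ _ (g x - g z) _ hc hlt h2
          (fun w h4 h5 => by linarith [h3 w h4 h5]) (by linarith)
    exact (DescReach.chain hκ hz hzc).mono (by push_cast; linarith)

theorem DescReach.sq_le {g : ℕ → ℝ} {B : ℕ} : ∀ {k x : ℕ}, DescReach g B k x →
    (∀ k' < k, ¬ DescReach g B k' x) → 2 ^ k * x ^ 2 ≤ 2 * B ^ 2
  | 0, x, h, _ => by
    have : x = B := h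
    subst this
    nlinarith [sq_nonneg x]
  | 1, x, h, _ => by
    have := Nat.pow_le_pow_left h.le 2
    omega
  | k + 2, x, ⟨z₁, ⟨z₂, hz, h1, h2, h3⟩, h4, h5, h6⟩, hmin => by
    have hlt : 2 * x ≤ z₂ := by
      by_contra hcon
      refine hmin (k + 1) (by omega) ⟨z₂, hz, by omega, by omega, fun w hw hw' => ?_⟩
      rcases le_total z₁ w with h | h
      · exact h3 w h hw'
      · exact (h3 z₁ le_rfl h1).trans (h6 w hw h)
    have := DescReach.sq_le hz (fun k' hk' hr =>
      hmin (k' + 2) (by omega) ⟨z₁, ⟨z₂, hr, h1, h2, h3⟩, h4, h5, h6⟩)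
    have h7 := Nat.pow_le_pow_left hlt 2
    calc 2 ^ (k + 2) * x ^ 2 = 2 ^ k * (2 * x) ^ 2 := by ring
      _ ≤ 2 ^ k * z₂ ^ 2 := by gcongr
      _ ≤ _ := this

theorem DescReach.exists_le_log {g : ℕ → ℝ} {B k x : ℕ} (hx : 1 ≤ x) (h : DescReach g B k x) :
    ∃ k', DescReach g B k' x ∧ (k' : ℝ) ≤ 1 + 2 * (Real.logb 2 B - Real.logb 2 x) := by
  classical
  have hex : ∃ k, DescReach g B k x := ⟨k, h⟩
  refine ⟨Nat.find hex, Nat.find_spec hex, ?_⟩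
  have h1 := (Nat.find_spec hex).sq_le (fun k' hk' => Nat.find_min hex hk')
  have hB : 1 ≤ B := hx.trans h.le
  have h2 : (2 : ℝ) ^ (Nat.find hex) * (x : ℝ) ^ 2 ≤ 2 * (B : ℝ) ^ 2 := by exact_mod_cast h1
  have hx' : (0 : ℝ) < x := by exact_mod_cast hx
  have hB' : (0 : ℝ) < B := by exact_mod_cast hB
  have h3 := Real.logb_le_logb_of_le (b := 2) (by norm_num) (by positivity) h2
  rw [Real.logb_mul (by positivity) (by positivity), Real.logb_mul (by positivity) (by positivity),
    Real.logb_pow, Real.logb_pow, Real.logb_pow, Real.logb_self_eq_one (by norm_num)] at h3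
  push_cast at h3
  linarith

/-- Leftmost minimiser of a real function on an interval of natural numbers. -/
theorem exists_leftmost_argmin (g : ℕ → ℝ) {p q : ℕ} (hpq : p ≤ q) :
    ∃ v, p ≤ v ∧ v ≤ q ∧ (∀ w, p ≤ w → w ≤ q → g v ≤ g w) ∧
      ∀ w, p ≤ w → w < v → g v < g w := by
  classical
  obtain ⟨v₀, hv₀, hmin⟩ := Finset.exists_min_image (Finset.Icc p q) g ⟨p, by simp [hpq]⟩
  have hex : ∃ v, p ≤ v ∧ v ≤ q ∧ ∀ w, p ≤ w → w ≤ q → g v ≤ g w :=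
    ⟨v₀, (Finset.mem_Icc.1 hv₀).1, (Finset.mem_Icc.1 hv₀).2,
      fun w h1 h2 => hmin w (Finset.mem_Icc.2 ⟨h1, h2⟩)⟩
  obtain ⟨h1, h2, h3⟩ := Nat.find_spec hex
  refine ⟨Nat.find hex, h1, h2, h3, fun w hw hwv => ?_⟩
  by_contra hcon
  exact Nat.find_min hex hwv ⟨hw, by omega, fun w' h4 h5 =>
    (not_lt.1 hcon).trans (h3 w' h4 h5)⟩

/-- The combinatorial heart of the argument: under Lipschitz and growth bounds on `g`, every scale
can be reached with loss `α (b - g b)` up to a logarithmic error. -/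
theorem scaleChain_of_growth {g : ℕ → ℝ} {κ e s u α : ℝ} {m : ℕ} (hκ : 0 ≤ κ) (he : 0 ≤ e)
    (hsu : s ≤ u) (hu : u ≤ 2) (hsu' : 2 * s ≤ u + 1)
    (hα : α * (2 * u + 2 - 3 * s) = u + 1 - 2 * s)
    (hL : ∀ i j, 1 ≤ i → i ≤ j → j ≤ m → |g j - g i| ≤ (j - i) + e)
    (hlow : ∀ j, 1 ≤ j → j ≤ m → (s - 1) * j - e ≤ g j)
    (hup : ∀ j, 1 ≤ j → j ≤ m → g j ≤ (u - 1) * j + e) :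
    ∀ b, 1 ≤ b → b ≤ m →
      ScaleChain g κ b (α * (b - g b) + (10 * κ + 20 * e + 20) * (Real.logb 2 b + 1)) := by
  set C := 10 * κ + 20 * e + 20 with hC
  have hden : 0 < u + 1 - s := by linarith
  have hden' : 0 < 2 * u + 2 - 3 * s := by linarith
  have hα0 : 0 ≤ α := by
    by_contra h
    have := mul_neg_of_neg_of_pos (not_le.1 h) hden'
    linarith
  have hα1 : α ≤ 1 := by
    by_contra h
    have : 1 * (2 * u + 2 - 3 * s) < α * (2 * u + 2 - 3 * s) :=
      mul_lt_mul_of_pos_right (not_le.1 h) hden'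
    linarith
  have hP : ∀ i j, 1 ≤ i → i ≤ j → j ≤ m → α * (i - g i) ≤ α * (j - g j) + e := by
    intro i j h1 h2 h3
    have h4 := (abs_le.1 (hL i j h1 h2 h3)).2
    have h5 : α * ((i - g i) - (j - g j)) ≤ α * e := mul_le_mul_of_nonneg_left (by linarith) hα0
    have h6 : α * e ≤ 1 * e := mul_le_mul_of_nonneg_right hα1 he
    linarith
  have hlog2 : ∀ a b : ℕ, 1 ≤ a → 2 * a ≤ b → Real.logb 2 a + 1 ≤ Real.logb 2 b := by
    intro a b h1 h2
    have ha : (0 : ℝ) < a := by exact_mod_cast h1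
    have hb : (2 : ℝ) * a ≤ b := by exact_mod_cast h2
    have h3 := Real.logb_le_logb_of_le (b := 2) (by norm_num) (by positivity) hb
    rw [Real.logb_mul (by positivity) (by positivity), Real.logb_self_eq_one (by norm_num)] at h3
    linarith
  have hlogm : ∀ a b : ℕ, 1 ≤ a → a ≤ b → Real.logb 2 a ≤ Real.logb 2 b := by
    intro a b h1 h2
    have ha : (0 : ℝ) < a := by exact_mod_cast h1
    exact Real.logb_le_logb_of_le (b := 2) (by norm_num) ha (by exact_mod_cast h2)
  intro b
  induction b using Nat.strong_induction_on with
  | _ b ih =>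
  intro hb1 hbm
  rcases hb1.eq_or_lt with rfl | hb2
  · refine .start _ _ le_rfl ?_
    have h1 := hup 1 le_rfl hbm
    have h2 : α * (1 - g 1) ≥ -e := by
      rcases le_total (g 1) 1 with h | h
      · have := mul_nonneg hα0 (sub_nonneg.2 h)
        linarith
      · have : α * (g 1 - 1) ≤ 1 * (g 1 - 1) := mul_le_mul_of_nonneg_right hα1 (by linarith)
        push_cast at h1
        linarith
    simp only [Nat.cast_one, Real.logb_one]
    linarith
  -- reduction to a scale `a` with `2 a ≤ b`
  have key : ∀ a : ℕ, ∀ l : ℝ, 1 ≤ a → 2 * a ≤ b →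
      (α * (a - g a) + l ≤ α * (b - g b) + C * (Real.logb 2 b - Real.logb 2 a)) →
      (∀ c, ScaleChain g κ a c → ScaleChain g κ b (c + l)) →
      ScaleChain g κ b (α * (b - g b) + C * (Real.logb 2 b + 1)) := by
    intro a l ha hab hl h
    exact (h _ (ih a (by omega) ha (by omega))).mono (by linarith)
  obtain ⟨a₁, h1, h2, h3, h4⟩ := exists_leftmost_argmin g (p := (b + 1) / 2) (q := b) (by omega)
  have hfin : ∀ c, ScaleChain g κ a₁ c → ScaleChain g κ b (c + κ) := fun c hc =>
    hc.free hκ h2 (by omega) (fun x hx hx' => h3 x (by omega) hx')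
  by_cases hA : 2 * a₁ ≤ b
  · refine key a₁ κ (by omega) hA ?_ hfin
    have := hP a₁ b (by omega) h2 hbm
    have h5 := hlog2 a₁ b (by omega) hA
    nlinarith
  by_cases hI : ∃ w, a₁ ≤ 2 * w ∧ w ≤ a₁ ∧ g w < g a₁
  · obtain ⟨w, hw1, hw2, hw3⟩ := hI
    obtain ⟨a₃, h5, h6, h7, h8⟩ :=
      exists_leftmost_argmin g (p := (a₁ + 1) / 2) (q := a₁) (by omega)
    have h9 : a₃ < (b + 1) / 2 := by
      by_contra hcon
      have := h3 a₃ (by omega) (by omega)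
      have := h7 w (by omega) hw2
      linarith
    refine key a₃ (κ + κ) (by omega) (by omega) ?_ (fun c hc => ?_)
    · have := hP a₃ b (by omega) (by omega) hbm
      have h5 := hlog2 a₃ b (by omega) (by omega)
      nlinarith
    · exact (hfin _ (hc.free hκ h6 (by omega) (fun x hx hx' => h7 x (by omega) hx'))).mono
        (by linarith)
  push Not at hI
  set B := a₁
  -- finishing from suitable scales `a ≤ z`
  have finish : ∀ a z k : ℕ, 1 ≤ a → 2 * a ≤ b → a ≤ z → z ≤ 2 * a → DescReach g B k z →
      (∀ w, a ≤ w → w ≤ z → g a ≤ g w) → g z ≤ g a + (2 + 2 * e) →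
      g z - g B ≤ B - 2 * a + (2 + 2 * e) →
      ScaleChain g κ b (α * (b - g b) + C * (Real.logb 2 b + 1)) := by
    intro a z k ha hab haz hza hR hfree hz1 hz2
    obtain ⟨k', hR', hk'⟩ := hR.exists_le_log (by omega)
    have hzB := hR'.le
    refine key a (κ + (g z - g B) + κ * k' + κ) ha hab ?_ (fun c hc => ?_)
    · have hl1 := hlog2 a b ha hab
      have hl2 := hlogm a z ha haz
      have hl3 := hlogm B b (by omega) h2
      have hPB := hP B b (by omega) h2 hbm
      have hBl := hlow B (by omega) (by omega)
      have hau := hup a ha (by omega)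
      set X := g z - g B with hX
      set D : ℝ := (B : ℝ) - a with hD
      have hX1 : (u + 1 - s) * X ≤ (u + 1 - 2 * s) * D + (u + 1 - s) * (2 + 4 * e) := by
        have e1 : (u - s) * X ≤ (u - s) * (B - 2 * a + (2 + 2 * e)) :=
          mul_le_mul_of_nonneg_left hz2 (by linarith)
        have e2 : X ≤ (u - 1) * a - (s - 1) * B + (2 + 4 * e) := by linarith
        have e3 : 0 ≤ (u - s) * e := mul_nonneg (by linarith) he
        rw [hD]
        nlinarith
      have hX2 : (1 - α) * X ≤ α * D + (2 + 4 * e) := by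
        have e1 : (1 - α) * (2 * u + 2 - 3 * s) = u + 1 - s := by linarith
        have e2 : (2 * u + 2 - 3 * s) * ((1 - α) * X) ≤
            (2 * u + 2 - 3 * s) * (α * D + (2 + 4 * e)) := by
          have e3 : (u + 1 - s) * (2 + 4 * e) ≤ (2 * u + 2 - 3 * s) * (2 + 4 * e) :=
            mul_le_mul_of_nonneg_right (by linarith) (by linarith)
          calc (2 * u + 2 - 3 * s) * ((1 - α) * X) = (u + 1 - s) * X := by rw [← e1]; ring
            _ ≤ (u + 1 - 2 * s) * D + (u + 1 - s) * (2 + 4 * e) := hX1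
            _ ≤ (u + 1 - 2 * s) * D + (2 * u + 2 - 3 * s) * (2 + 4 * e) := by linarith
            _ = _ := by rw [← hα]; ring
        exact le_of_mul_le_mul_left e2 hden'
      have hX3 : α * (a - g a) + X ≤ α * (B - g B) + (4 + 6 * e) := by
        have e1 : α * (g B - g a) ≤ α * (- X + (2 + 2 * e)) :=
          mul_le_mul_of_nonneg_left (by linarith) hα0
        have e2 : α * (2 + 2 * e) ≤ 1 * (2 + 2 * e) := mul_le_mul_of_nonneg_right hα1 (by linarith)
        have e3 : α * D = α * B - α * a := by rw [hD]; ring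
        linarith
      set Λ := Real.logb 2 (b : ℝ) - Real.logb 2 (a : ℝ) with hΛ
      have hΛ1 : 1 ≤ Λ := by linarith
      have hk2 : (k' : ℝ) ≤ 1 + 2 * Λ := by linarith
      have e1 : κ * k' ≤ κ * (1 + 2 * Λ) := mul_le_mul_of_nonneg_left hk2 hκ
      have e2 : κ * 1 ≤ κ * Λ := mul_le_mul_of_nonneg_left hΛ1 hκ
      have e3 : e * 1 ≤ e * Λ := mul_le_mul_of_nonneg_left hΛ1 he
      rw [hC]
      linarith
    · exact (hfin _ (hR'.chain hκ (hc.free hκ haz hza hfree))).mono (by linarith)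
  have hexY : ∃ y, (∃ k, DescReach g B k y) ∧ ∀ x, y ≤ 2 * x → x ≤ y → g y ≤ g x :=
    ⟨B, ⟨0, rfl⟩, hI⟩
  classical
  obtain ⟨⟨k, hk⟩, hy⟩ := Nat.find_spec hexY
  have hymin := fun y' (hy' : y' < Nat.find hexY) => Nat.find_min hexY hy'
  generalize Nat.find hexY = y at hk hy hymin
  have hyB := hk.le
  have hy1 : 1 ≤ y := by
    by_contra h0
    have hy0 : y = 0 := by omega
    subst hy0
    clear hymin hy
    have hpos : ∀ k x, DescReach g B k x → 1 ≤ x := by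
      intro k
      induction k with
      | zero => intro x h; have : x = B := h; omega
      | succ k ihk => rintro x ⟨z, hz, h1, h2, -⟩; have := ihk z hz; omega
    have := hpos k 0 hk
    omega
  rcases hy1.eq_or_lt with rfl | hy2
  · refine finish 1 1 k le_rfl (by omega) le_rfl (by omega) hk (fun w hw hw' => ?_) (by linarith) ?_
    · have : w = 1 := by omega
      rw [this]
    · have := (abs_le.1 (hL 1 B le_rfl hyB (by omega))).1
      push_cast at this ⊢
      linarith
  have hLy := (abs_le.1 (hL (y - 1) y (by omega) (by omega) (by omega))).1
  have hLB := (abs_le.1 (hL y B (by omega) hyB (by omega))).1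
  rw [Nat.cast_sub (by omega)] at hLy
  push_cast at hLy
  have hRy : ∀ x, y ≤ 2 * x → x ≤ y → DescReach g B (k + 1) x := fun x hx hx' =>
    ⟨y, hk, hx', hx, fun w hw hw' => hy w (by omega) hw'⟩
  obtain ⟨v, hv1, hv2, hv3, hv4⟩ := exists_leftmost_argmin g (p := y / 2) (q := y - 1) (by omega)
  by_cases hv : 2 * v = y - 1
  · have hvl := (abs_le.1 (hL v (v + 1) (by omega) (by omega) (by omega))).2
    have hv5 := hy (v + 1) (by omega) (by omega)
    have hyv : (y : ℝ) = 2 * v + 1 := by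
      have : y = 2 * v + 1 := by omega
      exact_mod_cast this
    push_cast at hvl
    refine finish v (y - 1) (k + 1) (by omega) (by omega) (by omega) (by omega)
      (hRy _ (by omega) (by omega)) (fun w hw hw' => hv3 w (by omega) hw') ?_ ?_
    · linarith
    · linarith
  · have hv5 : ∃ w, v ≤ 2 * w ∧ w ≤ v ∧ g w < g v := by
      by_contra hcon
      push Not at hcon
      exact hymin v (by omega) ⟨⟨k + 1, hRy v (by omega) (by omega)⟩, hcon⟩
    obtain ⟨w₀, hw₀⟩ := hv5
    obtain ⟨a, ha, hamax⟩ : ∃ a, (v ≤ 2 * a ∧ a ≤ v ∧ g a < g v) ∧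
        ∀ w, (v ≤ 2 * w ∧ w ≤ v ∧ g w < g v) → w ≤ a := by
      let S := (Finset.range (v + 1)).filter (fun w => v ≤ 2 * w ∧ w ≤ v ∧ g w < g v)
      have hS : S.Nonempty := ⟨w₀, Finset.mem_filter.2 ⟨Finset.mem_range.2 (by omega), hw₀⟩⟩
      refine ⟨S.max' hS, (Finset.mem_filter.1 (S.max'_mem hS)).2, fun w hw => S.le_max' w ?_⟩
      simp only [S, Finset.mem_filter, Finset.mem_range]
      exact ⟨by omega, hw⟩
    have hav : a < v := by
      rcases ha.2.1.eq_or_lt with h | h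
      · rw [h] at ha
        exact absurd ha.2.2 (lt_irrefl _)
      · exact h
    have hay : 2 * a < y - 1 := by
      by_contra hcon
      have := hv3 a (by omega) (by omega)
      linarith [ha.2.2]
    have hgt : ∀ w, a < w → w ≤ v → g v ≤ g w := by
      intro w hw hwv
      by_contra hcon
      have := hamax w ⟨by omega, hwv, not_le.1 hcon⟩
      omega
    have hyr : (2 : ℝ) * a + 2 ≤ y := by
      have : 2 * a + 2 ≤ y := by omega
      exact_mod_cast this
    have hal := (abs_le.1 (hL a (a + 1) (by omega) (by omega) (by omega))).2
    push_cast at hal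
    refine finish a v (k + 1) (by omega) (by omega) (by omega) (by omega)
      (hRy _ (by omega) (by omega)) (fun w hw hw' => ?_) ?_ ?_
    · rcases hw.eq_or_lt with rfl | h
      · exact le_rfl
      · exact ha.2.2.le.trans (hgt w h hw')
    · have := hgt (a + 1) (by omega) (by omega)
      linarith
    · have := hv3 (y - 1) (by omega) le_rfl
      linarith

/-- The tent function of half-width `A`. -/
noncomputable def tent (A a : ℝ) : ℝ := max 0 (A - |a|)

theorem tent_nonneg (A a : ℝ) : 0 ≤ tent A a := le_max_left _ _

theorem tent_le {A : ℝ} (hA : 0 ≤ A) (a : ℝ) : tent A a ≤ A :=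
  max_le hA (by linarith [abs_nonneg a])

theorem continuous_tent (A : ℝ) : Continuous (tent A) := by
  unfold tent; fun_prop

theorem tent_eq_zero {A a : ℝ} (h : A < |a|) : tent A a = 0 := max_eq_left (by linarith)

theorem abs_tent_sub_le (A a b : ℝ) : |tent A a - tent A b| ≤ |a - b| := by
  have h := abs_max_sub_max_le_abs (A - |a|) (A - |b|) 0
  rw [max_comm (A - |a|), max_comm (A - |b|)] at h
  refine h.trans ?_
  rw [sub_sub_sub_cancel_left, abs_sub_comm]
  exact abs_abs_sub_abs_le a b

/-- A bounded measurable function with bounded support is integrable. -/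
theorem integrable_of_bdd_support {E : Type*} [PseudoMetricSpace E] [ProperSpace E]
    [MeasurableSpace E] [OpensMeasurableSpace E] {μ : Measure E}
    [IsFiniteMeasureOnCompacts μ] {f : E → ℝ} (hf : Measurable f) {C : ℝ} (hC : ∀ x, |f x| ≤ C)
    {S : Set E} (hS : Bornology.IsBounded S) (hsupp : ∀ x, x ∉ S → f x = 0) :
    Integrable f μ := by
  have h1 : IntegrableOn f (closure S) μ := by
    refine Measure.integrableOn_of_bounded (M := C) ?_ hf.aestronglyMeasurable ?_
    · exact hS.isCompact_closure.measure_lt_top.ne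
    · exact Eventually.of_forall fun x => by simpa using hC x
  refine (integrableOn_iff_integrable_of_support_subset fun x hx => ?_).1 h1
  by_contra hcon
  exact hx (hsupp x fun h => hcon (subset_closure h))

structure IsBump (ψ : ℝ → ℝ) (b L : ℝ) : Prop where
  measurable : Measurable ψ
  bound : ∀ t, |ψ t| ≤ b
  supp : ∀ t, L < |t| → ψ t = 0

theorem IsBump.integrable {ψ : ℝ → ℝ} {b L : ℝ} (h : IsBump ψ b L) : Integrable ψ :=
  integrable_of_bdd_support h.measurable h.bound (Metric.isBounded_Icc (-L) L) fun t ht =>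
    h.supp t (by
      by_contra hcon
      exact ht (abs_le.1 (not_lt.1 hcon)))

theorem IsBump.comp_integrable {ψ : ℝ → ℝ} {b L : ℝ} (h : IsBump ψ b L) (k : ℝ) {Δ : ℝ}
    (hΔ : Δ ≠ 0) : Integrable fun a => ψ (k - a * Δ) :=
  (h.integrable.comp_sub_left k).comp_mul_right' hΔ

theorem IsBump.tent_integrable {ψ : ℝ → ℝ} {b L : ℝ} (h : IsBump ψ b L) {A : ℝ} (hA : 0 ≤ A)
    (k Δ : ℝ) : Integrable fun a => tent A a * ψ (k - a * Δ) := by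
  refine integrable_of_bdd_support (C := A * b) ?_ (fun a => ?_) (Metric.isBounded_Icc (-A) A) ?_
  · exact (continuous_tent A).measurable.mul (h.measurable.comp (by fun_prop))
  · rw [abs_mul, abs_of_nonneg (tent_nonneg _ _)]
    exact mul_le_mul (tent_le hA a) (h.bound _) (abs_nonneg _) hA
  · intro a ha
    rw [tent_eq_zero, zero_mul]
    by_contra hcon
    exact ha (abs_le.1 (not_lt.1 hcon))

theorem integrable_tent {A : ℝ} (hA : 0 ≤ A) : Integrable (tent A) := by
  refine integrable_of_bdd_support (C := A) (continuous_tent A).measurable (fun a => ?_)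
    (Metric.isBounded_Icc (-A) A) (fun a ha => ?_)
  · rw [abs_of_nonneg (tent_nonneg _ _)]
    exact tent_le hA a
  · apply tent_eq_zero
    by_contra hcon
    exact ha (abs_le.1 (not_lt.1 hcon))

theorem integral_tent_le {A : ℝ} (hA : 0 ≤ A) : ∫ a, tent A a ≤ 2 * A ^ 2 := by
  have h1 : ∫ a, tent A a ≤ ∫ a, (Icc (-A) A).indicator (fun _ => A) a := by
    refine integral_mono (integrable_tent hA) ?_ fun a => ?_
    · exact (integrable_indicator_iff measurableSet_Icc).2 (integrableOn_const (by simp))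
    · by_cases ha : a ∈ Icc (-A) A
      · simpa [ha] using tent_le hA a
      · rw [indicator_of_notMem ha, tent_eq_zero]
        by_contra hcon
        exact ha (abs_le.1 (not_lt.1 hcon))
  rw [integral_indicator measurableSet_Icc] at h1
  simp at h1
  rw [max_eq_left (by linarith)] at h1
  nlinarith

theorem integral_comp_affine (ψ : ℝ → ℝ) (k Δ : ℝ) :
    ∫ a, ψ (k - a * Δ) = |Δ⁻¹| * ∫ t, ψ t := by
  rw [Measure.integral_comp_mul_right (fun x => ψ (k - x)), integral_sub_left_eq_self ψ]
  rfl

/-- Trivial bound for the tent average of a bump. -/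
theorem IsBump.abs_integral_tent_le {ψ : ℝ → ℝ} {b L : ℝ} (h : IsBump ψ b L) {A : ℝ} (hA : 0 ≤ A)
    (k Δ : ℝ) : |∫ a, tent A a * ψ (k - a * Δ)| ≤ b * (2 * A ^ 2) := by
  have hb : 0 ≤ b := (abs_nonneg _).trans (h.bound 0)
  calc |∫ a, tent A a * ψ (k - a * Δ)| ≤ ∫ a, |tent A a * ψ (k - a * Δ)| :=
        abs_integral_le_integral_abs
    _ ≤ ∫ a, b * tent A a := by
        refine integral_mono (h.tent_integrable hA k Δ).abs ((integrable_tent hA).const_mul b) ?_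
        intro a
        simp only [abs_mul, abs_of_nonneg (tent_nonneg A a)]
        rw [mul_comm]
        exact mul_le_mul_of_nonneg_right (h.bound _) (tent_nonneg _ _)
    _ = b * ∫ a, tent A a := integral_const_mul _ _
    _ ≤ _ := mul_le_mul_of_nonneg_left (integral_tent_le hA) hb

/-- Transversal bound for the tent average of a bump. -/
theorem IsBump.abs_integral_tent_le_div {ψ : ℝ → ℝ} {b L : ℝ} (h : IsBump ψ b L) {A : ℝ}
    (hA : 0 ≤ A) (k : ℝ) {Δ : ℝ} (hΔ : Δ ≠ 0) :
    |∫ a, tent A a * ψ (k - a * Δ)| ≤ A * (∫ t, |ψ t|) / |Δ| := by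
  calc |∫ a, tent A a * ψ (k - a * Δ)| ≤ ∫ a, |tent A a * ψ (k - a * Δ)| :=
        abs_integral_le_integral_abs
    _ ≤ ∫ a, A * |ψ (k - a * Δ)| := by
        refine integral_mono (h.tent_integrable hA k Δ).abs
          ((h.comp_integrable k hΔ).abs.const_mul A) ?_
        intro a
        simp only [abs_mul, abs_of_nonneg (tent_nonneg A a)]
        exact mul_le_mul_of_nonneg_right (tent_le hA _) (abs_nonneg _)
    _ = _ := by
        rw [integral_const_mul, integral_comp_affine (fun t => |ψ t|), abs_inv]
        ring

/-- Cancellation bound for the tent average of a mean-zero bump. -/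
theorem IsBump.abs_integral_tent_le_sq {ψ : ℝ → ℝ} {b L : ℝ} (h : IsBump ψ b L)
    (hmean : ∫ t, ψ t = 0) {A : ℝ} (hA : 0 ≤ A) (k : ℝ) {Δ : ℝ} (hΔ : Δ ≠ 0) :
    |∫ a, tent A a * ψ (k - a * Δ)| ≤ L * (∫ t, |ψ t|) / Δ ^ 2 := by
  have hΔ' : 0 < |Δ| := abs_pos.2 hΔ
  have e1 : ∫ a, tent A a * ψ (k - a * Δ) =
      ∫ a, (tent A a - tent A (k / Δ)) * ψ (k - a * Δ) := by
    simp_rw [sub_mul]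
    rw [integral_sub (h.tent_integrable hA k Δ) ((h.comp_integrable k hΔ).const_mul _),
      integral_const_mul, integral_comp_affine ψ, hmean]
    simp
  have e2 : ∀ a, |(tent A a - tent A (k / Δ)) * ψ (k - a * Δ)| ≤ L / |Δ| * |ψ (k - a * Δ)| := by
    intro a
    rw [abs_mul]
    by_cases ha : L < |k - a * Δ|
    · rw [h.supp _ ha]; simp
    · refine mul_le_mul_of_nonneg_right ((abs_tent_sub_le _ _ _).trans ?_) (abs_nonneg _)
      rw [le_div_iff₀ hΔ', ← abs_mul, sub_mul, div_mul_cancel₀ _ hΔ, abs_sub_comm]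
      exact not_lt.1 ha
  have hi2 : Integrable fun a => L / |Δ| * |ψ (k - a * Δ)| :=
    (h.comp_integrable k hΔ).abs.const_mul _
  have hi1 : Integrable fun a => (tent A a - tent A (k / Δ)) * ψ (k - a * Δ) := by
    simp_rw [sub_mul]
    exact (h.tent_integrable hA k Δ).sub ((h.comp_integrable k hΔ).const_mul _)
  rw [e1]
  calc _ ≤ ∫ a, |(tent A a - tent A (k / Δ)) * ψ (k - a * Δ)| := abs_integral_le_integral_abs
    _ ≤ ∫ a, L / |Δ| * |ψ (k - a * Δ)| := integral_mono hi1.abs hi2 e2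
    _ = _ := by
      rw [integral_const_mul, integral_comp_affine (fun t => |ψ t|), abs_inv, ← sq_abs Δ]
      field_simp

theorem IsBump.pair_integrable {ψ₁ ψ₂ : ℝ → ℝ} {b₁ b₂ L₁ L₂ : ℝ} (h₁ : IsBump ψ₁ b₁ L₁)
    (h₂ : IsBump ψ₂ b₂ L₂) {A : ℝ} (hA : 0 ≤ A) (p q : ℝ × ℝ) :
    Integrable (fun z : ℝ × ℝ => tent A z.1 * (ψ₁ (p.2 - z.1 * p.1 - z.2) *
      ψ₂ (q.2 - z.1 * q.1 - z.2))) (volume.prod volume) := by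
  have hb₁ : 0 ≤ b₁ := (abs_nonneg _).trans (h₁.bound 0)
  refine integrable_of_bdd_support (C := A * (b₁ * b₂)) ?_ (fun z => ?_)
    ((Metric.isBounded_Icc (-A) A).prod
      (Metric.isBounded_Icc (-(|p.2| + A * |p.1| + L₁)) (|p.2| + A * |p.1| + L₁))) ?_
  · refine ((continuous_tent A).measurable.comp measurable_fst).mul
      ((h₁.measurable.comp ?_).mul (h₂.measurable.comp ?_)) <;> fun_prop
  · rw [abs_mul, abs_of_nonneg (tent_nonneg _ _), abs_mul]
    exact mul_le_mul (tent_le hA _) (mul_le_mul (h₁.bound _) (h₂.bound _) (abs_nonneg _) hb₁)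
      (by positivity) hA
  · intro z hz
    by_cases h1 : A < |z.1|
    · rw [tent_eq_zero h1, zero_mul]
    · rw [h₁.supp, zero_mul, mul_zero]
      by_contra h2
      refine hz ⟨abs_le.1 (not_lt.1 h1), abs_le.1 ?_⟩
      have h3 : |z.1 * p.1| ≤ A * |p.1| := by
        rw [abs_mul]
        exact mul_le_mul_of_nonneg_right (not_lt.1 h1) (abs_nonneg _)
      have h4 : z.2 = p.2 - z.1 * p.1 - (p.2 - z.1 * p.1 - z.2) := by ring
      rw [h4]
      refine (abs_sub _ _).trans (add_le_add ((abs_sub _ _).trans (add_le_add le_rfl h3))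
        (not_lt.1 h2))

theorem IsBump.pair_integral_eq {ψ₁ ψ₂ : ℝ → ℝ} {b₁ b₂ L₁ L₂ : ℝ} (h₁ : IsBump ψ₁ b₁ L₁)
    (h₂ : IsBump ψ₂ b₂ L₂) {A : ℝ} (hA : 0 ≤ A) (p q : ℝ × ℝ) :
    ∫ z : ℝ × ℝ, tent A z.1 * (ψ₁ (p.2 - z.1 * p.1 - z.2) * ψ₂ (q.2 - z.1 * q.1 - z.2)) =
      ∫ t, ψ₁ t * ∫ a, tent A a * ψ₂ (t + (q.2 - p.2) - a * (q.1 - p.1)) := by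
  have hb₁ : 0 ≤ b₁ := (abs_nonneg _).trans (h₁.bound 0)
  rw [Measure.volume_eq_prod, integral_prod _ (h₁.pair_integrable h₂ hA p q)]
  have e1 : ∀ a : ℝ, ∫ c, tent A a * (ψ₁ (p.2 - a * p.1 - c) * ψ₂ (q.2 - a * q.1 - c)) =
      ∫ t, ψ₁ t * (tent A a * ψ₂ (t + (q.2 - p.2) - a * (q.1 - p.1))) := by
    intro a
    rw [← integral_sub_left_eq_self (fun t => ψ₁ t * (tent A a *
      ψ₂ (t + (q.2 - p.2) - a * (q.1 - p.1)))) volume (p.2 - a * p.1)]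
    congr 1
    ext c
    rw [show p.2 - a * p.1 - c + (q.2 - p.2) - a * (q.1 - p.1) = q.2 - a * q.1 - c by ring]
    ring
  simp only [e1]
  rw [integral_integral_swap]
  · simp only [integral_const_mul]
  · refine integrable_of_bdd_support (C := b₁ * (A * b₂)) ?_ (fun z => ?_)
      ((Metric.isBounded_Icc (-A) A).prod (Metric.isBounded_Icc (-L₁) L₁)) ?_
    · refine (h₁.measurable.comp measurable_snd).mul
        (((continuous_tent A).measurable.comp measurable_fst).mul (h₂.measurable.comp ?_))
      fun_prop
    · simp only [Function.uncurry]
      rw [abs_mul, abs_mul, abs_of_nonneg (tent_nonneg _ _)]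
      exact mul_le_mul (h₁.bound _) (mul_le_mul (tent_le hA _) (h₂.bound _) (abs_nonneg _) hA)
        (mul_nonneg (tent_nonneg _ _) (abs_nonneg _)) hb₁
    · intro z hz
      simp only [Function.uncurry]
      by_cases h1 : A < |z.1|
      · rw [tent_eq_zero h1, zero_mul, mul_zero]
      · rw [h₁.supp, zero_mul]
        by_contra h2
        exact hz ⟨abs_le.1 (not_lt.1 h1), abs_le.1 (not_lt.1 h2)⟩

theorem IsBump.abs_pair_integral_le {ψ₁ ψ₂ : ℝ → ℝ} {b₁ b₂ L₁ L₂ : ℝ} (h₁ : IsBump ψ₁ b₁ L₁)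
    (h₂ : IsBump ψ₂ b₂ L₂) {A : ℝ} (hA : 0 ≤ A) (p q : ℝ × ℝ) {β : ℝ}
    (hβ : ∀ t, |t| ≤ L₁ → |∫ a, tent A a * ψ₂ (t + (q.2 - p.2) - a * (q.1 - p.1))| ≤ β) :
    |∫ z : ℝ × ℝ, tent A z.1 * (ψ₁ (p.2 - z.1 * p.1 - z.2) * ψ₂ (q.2 - z.1 * q.1 - z.2))| ≤
      β * ∫ t, |ψ₁ t| := by
  rw [h₁.pair_integral_eq h₂ hA, ← integral_const_mul]
  refine abs_integral_le_integral_abs.trans (integral_mono_of_nonneg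
    (Eventually.of_forall fun t => abs_nonneg _) (h₁.integrable.abs.const_mul β)
    (Eventually.of_forall fun t => ?_))
  simp only [abs_mul]
  by_cases ht : L₁ < |t|
  · simp [h₁.supp t ht]
  · rw [mul_comm]
    exact mul_le_mul_of_nonneg_right (hβ t (not_lt.1 ht)) (abs_nonneg _)

/-- The pair integral of compactly supported bumps vanishes for nearly vertical separation. -/
theorem IsBump.inner_eq_zero {ψ : ℝ → ℝ} {b L : ℝ} (h : IsBump ψ b L) {A : ℝ}
    {t Δ₁ Δ₂ : ℝ} (ht : |t| ≤ L) (h1 : 2 * A * |Δ₁| < |Δ₂|) (h2 : 4 * L < |Δ₂|) :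
    ∫ a, tent A a * ψ (t + Δ₂ - a * Δ₁) = 0 := by
  have : ∀ a, tent A a * ψ (t + Δ₂ - a * Δ₁) = 0 := by
    intro a
    by_cases ha : A < |a|
    · rw [tent_eq_zero ha, zero_mul]
    · rw [h.supp, mul_zero]
      have h3 : |a * Δ₁| ≤ A * |Δ₁| := by
        rw [abs_mul]
        exact mul_le_mul_of_nonneg_right (not_lt.1 ha) (abs_nonneg _)
      have h4 : |Δ₂| ≤ |t + Δ₂ - a * Δ₁| + |t| + |a * Δ₁| := by
        calc |Δ₂| = |(t + Δ₂ - a * Δ₁) - t + a * Δ₁| := by congr 1; ring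
          _ ≤ _ := (abs_add_le _ _).trans (add_le_add (abs_sub _ _) le_rfl)
      linarith
  simp [this]

/-- The indicator of `[-w, w]`. -/
noncomputable def box (w : ℝ) : ℝ → ℝ := (Icc (-w) w).indicator fun _ => 1

theorem box_of_le {w t : ℝ} (h : |t| ≤ w) : box w t = 1 :=
  indicator_of_mem (mem_Icc.2 (abs_le.1 h)) _

theorem box_of_lt {w t : ℝ} (h : w < |t|) : box w t = 0 :=
  indicator_of_notMem (fun hcon => absurd (abs_le.2 (mem_Icc.1 hcon)) (not_le.2 h)) _

theorem box_nonneg (w t : ℝ) : 0 ≤ box w t := indicator_nonneg (fun _ _ => zero_le_one) _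

theorem box_le_one (w t : ℝ) : box w t ≤ 1 := by
  rcases le_or_gt |t| w with h | h
  · rw [box_of_le h]
  · rw [box_of_lt h]; exact zero_le_one

theorem measurable_box (w : ℝ) : Measurable (box w) := measurable_const.indicator measurableSet_Icc

theorem isBump_box (w : ℝ) : IsBump (box w) 1 w where
  measurable := measurable_box w
  bound t := by rw [abs_of_nonneg (box_nonneg w t)]; exact box_le_one w t
  supp _ ht := box_of_lt ht

theorem integral_box {w : ℝ} (hw : 0 ≤ w) : ∫ t, box w t = 2 * w := by
  unfold box
  rw [integral_indicator measurableSet_Icc]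
  simp
  rw [max_eq_left (by linarith)]
  ring

/-- The mean-zero difference of normalised boxes at two scales. -/
noncomputable def diffBump (ρ ρ' t : ℝ) : ℝ := box (2 * ρ) t / (4 * ρ) - box (ρ' / 2) t / ρ'

theorem isBump_diffBump {ρ ρ' : ℝ} (hρ : 0 < ρ) (h : 4 * ρ ≤ ρ') :
    IsBump (diffBump ρ ρ') (1 / (4 * ρ)) (ρ' / 2) where
  measurable := ((measurable_box _).div_const _).sub ((measurable_box _).div_const _)
  bound t := by
    have h1 : 0 ≤ box (2 * ρ) t / (4 * ρ) := div_nonneg (box_nonneg _ _) (by linarith)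
    have h2 : 0 ≤ box (ρ' / 2) t / ρ' := div_nonneg (box_nonneg _ _) (by linarith)
    have h3 : box (2 * ρ) t / (4 * ρ) ≤ 1 / (4 * ρ) :=
      div_le_div_of_nonneg_right (box_le_one _ _) (by linarith)
    have h4 : box (ρ' / 2) t / ρ' ≤ 1 / (4 * ρ) :=
      div_le_div₀ zero_le_one (box_le_one _ _) (by linarith) h
    unfold diffBump
    exact abs_le.2 ⟨by linarith, by linarith⟩
  supp t ht := by
    unfold diffBump
    rw [box_of_lt ht, box_of_lt (by linarith)]
    simp

theorem integral_diffBump {ρ ρ' : ℝ} (hρ : 0 < ρ) (h : 4 * ρ ≤ ρ') :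
    ∫ t, diffBump ρ ρ' t = 0 := by
  unfold diffBump
  rw [integral_sub ((isBump_box _).integrable.div_const _) ((isBump_box _).integrable.div_const _),
    integral_div, integral_div, integral_box (by linarith), integral_box (by linarith)]
  have : ρ' ≠ 0 := by linarith
  field_simp
  ring

theorem integral_abs_diffBump_le {ρ ρ' : ℝ} (hρ : 0 < ρ) (h : 4 * ρ ≤ ρ') :
    ∫ t, |diffBump ρ ρ' t| ≤ 2 := by
  have h1 : ∫ t, |diffBump ρ ρ' t| ≤ ∫ t, (box (2 * ρ) t / (4 * ρ) + box (ρ' / 2) t / ρ') := by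
    refine integral_mono (isBump_diffBump hρ h).integrable.abs
      (((isBump_box _).integrable.div_const _).add ((isBump_box _).integrable.div_const _)) ?_
    intro t
    have h1 : 0 ≤ box (2 * ρ) t / (4 * ρ) := div_nonneg (box_nonneg _ _) (by linarith)
    have h2 : 0 ≤ box (ρ' / 2) t / ρ' := div_nonneg (box_nonneg _ _) (by linarith)
    exact abs_le.2 ⟨by unfold diffBump; linarith, by unfold diffBump; linarith⟩
  rw [integral_add ((isBump_box _).integrable.div_const _)
    ((isBump_box _).integrable.div_const _), integral_div, integral_div,
    integral_box (by linarith), integral_box (by linarith)] at h1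
  have : ρ' ≠ 0 := by linarith
  field_simp at h1
  linarith

/-- The pairing of two copies of a bump along the lines `p.2 = a p.1 + c`, weighted by the tent. -/
noncomputable def linePair (A : ℝ) (ψ : ℝ → ℝ) (p q : ℝ × ℝ) : ℝ :=
  ∫ z : ℝ × ℝ, tent A z.1 * (ψ (p.2 - z.1 * p.1 - z.2) * ψ (q.2 - z.1 * q.1 - z.2))

theorem IsBump.abs_linePair_le {ψ : ℝ → ℝ} {b L : ℝ} (h : IsBump ψ b L) {A : ℝ} (hA : 0 ≤ A)
    (p q : ℝ × ℝ) : |linePair A ψ p q| ≤ b * (2 * A ^ 2) * ∫ t, |ψ t| :=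
  h.abs_pair_integral_le h hA p q fun _ _ => h.abs_integral_tent_le hA _ _

/-- Outside a ball of radius `4 * L`, either the pairing vanishes or the horizontal separation is
comparable to the distance. -/
theorem IsBump.linePair_eq_zero_or {ψ : ℝ → ℝ} {b L : ℝ} (h : IsBump ψ b L) {A : ℝ} (hA : 1 ≤ A)
    {p q : ℝ × ℝ} (hpq : 4 * L < dist p q) :
    linePair A ψ p q = 0 ∨ dist p q ≤ 2 * A * |q.1 - p.1| := by
  by_cases h1 : 2 * A * |q.1 - p.1| < |q.2 - p.2|
  · left
    have h2 : dist p q = |q.2 - p.2| := by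
      rw [Prod.dist_eq, Real.dist_eq, Real.dist_eq, abs_sub_comm p.1, abs_sub_comm p.2]
      apply max_eq_right
      nlinarith [abs_nonneg (q.1 - p.1)]
    have := h.abs_pair_integral_le h (by linarith : 0 ≤ A) p q (β := 0) fun t ht => by
      rw [h.inner_eq_zero ht h1 (by rwa [← h2])]
      simp
    rw [zero_mul] at this
    exact abs_nonpos_iff.1 this
  · right
    rw [Prod.dist_eq, Real.dist_eq, Real.dist_eq, abs_sub_comm p.1, abs_sub_comm p.2]
    refine max_le ?_ (not_lt.1 h1)
    nlinarith [abs_nonneg (q.1 - p.1)]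

theorem linePair_box_le {A h : ℝ} (hA : 1 ≤ A) (hh : 0 < h) (p q : ℝ × ℝ) :
    linePair A (box h) p q ≤ 4 * A ^ 2 * h := by
  refine (le_abs_self _).trans (((isBump_box h).abs_linePair_le (by linarith) p q).trans ?_)
  simp_rw [abs_of_nonneg (box_nonneg _ _)]
  rw [integral_box hh.le]
  linarith

theorem linePair_box_le_div {A h : ℝ} (hA : 1 ≤ A) (hh : 0 < h) {p q : ℝ × ℝ}
    (hpq : 0 < dist p q) : linePair A (box h) p q ≤ 16 * A ^ 2 * h ^ 2 / dist p q := by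
  rcases le_or_gt (dist p q) (4 * h) with h1 | h1
  · refine (linePair_box_le hA hh p q).trans ?_
    rw [le_div_iff₀ hpq]
    have : 4 * A ^ 2 * h * dist p q ≤ 4 * A ^ 2 * h * (4 * h) :=
      mul_le_mul_of_nonneg_left h1 (by positivity)
    linarith
  rcases (isBump_box h).linePair_eq_zero_or hA h1 with h2 | h2
  · rw [h2]; positivity
  have hΔ : 0 < |q.1 - p.1| := by
    by_contra hcon
    have : |q.1 - p.1| = 0 := le_antisymm (not_lt.1 hcon) (abs_nonneg _)
    rw [this] at h2
    linarith
  have h3 := (isBump_box h).abs_pair_integral_le (isBump_box h) (by linarith : 0 ≤ A) p q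
    (fun t _ => (isBump_box h).abs_integral_tent_le_div (by linarith : 0 ≤ A) _ (abs_pos.1 hΔ))
  simp_rw [abs_of_nonneg (box_nonneg _ _)] at h3
  rw [integral_box hh.le] at h3
  refine (le_abs_self _).trans (h3.trans ?_)
  rw [div_mul_eq_mul_div, div_le_div_iff₀ hΔ hpq]
  have : A * (2 * h) * (2 * h) * dist p q ≤ A * (2 * h) * (2 * h) * (2 * A * |q.1 - p.1|) :=
    mul_le_mul_of_nonneg_left h2 (by positivity)
  nlinarith [show 0 ≤ A ^ 2 * h ^ 2 * |q.1 - p.1| by positivity]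

theorem linePair_diffBump_le {A ρ ρ' : ℝ} (hA : 1 ≤ A) (hρ : 0 < ρ) (h : 4 * ρ ≤ ρ')
    (p q : ℝ × ℝ) : |linePair A (diffBump ρ ρ') p q| ≤ A ^ 2 / ρ := by
  refine ((isBump_diffBump hρ h).abs_linePair_le (by linarith) p q).trans ?_
  calc _ ≤ 1 / (4 * ρ) * (2 * A ^ 2) * 2 :=
        mul_le_mul_of_nonneg_left (integral_abs_diffBump_le hρ h) (by positivity)
    _ = _ := by field_simp; norm_num

theorem linePair_diffBump_le_div {A ρ ρ' : ℝ} (hA : 1 ≤ A) (hρ : 0 < ρ) (h : 4 * ρ ≤ ρ')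
    {p q : ℝ × ℝ} (hpq : 0 < dist p q) :
    |linePair A (diffBump ρ ρ') p q| ≤ 4 * A ^ 2 * ρ' ^ 2 / ρ / dist p q ^ 2 := by
  have hb := isBump_diffBump hρ h
  have hρ' : 0 < ρ' := by linarith
  rcases le_or_gt (dist p q) (4 * (ρ' / 2)) with h1 | h1
  · refine (linePair_diffBump_le hA hρ h p q).trans ?_
    rw [le_div_iff₀ (by positivity), div_mul_eq_mul_div]
    refine div_le_div_of_nonneg_right ?_ hρ.le
    have : dist p q ^ 2 ≤ (4 * (ρ' / 2)) ^ 2 := pow_le_pow_left₀ hpq.le h1 2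
    nlinarith [mul_le_mul_of_nonneg_left this (sq_nonneg A)]
  rcases hb.linePair_eq_zero_or hA h1 with h2 | h2
  · rw [h2, abs_zero]; positivity
  have hΔ : 0 < |q.1 - p.1| := by
    by_contra hcon
    have : |q.1 - p.1| = 0 := le_antisymm (not_lt.1 hcon) (abs_nonneg _)
    rw [this] at h2
    linarith
  have h3 := hb.abs_pair_integral_le hb (by linarith : 0 ≤ A) p q
    (fun t _ => hb.abs_integral_tent_le_sq (integral_diffBump hρ h)
      (by linarith : 0 ≤ A) _ (abs_pos.1 hΔ))
  have hI := integral_abs_diffBump_le hρ h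
  have hI0 : 0 ≤ ∫ t, |diffBump ρ ρ' t| := integral_nonneg fun _ => abs_nonneg _
  refine h3.trans ?_
  rw [← sq_abs (q.1 - p.1)]
  have h4 : dist p q ^ 2 ≤ 4 * A ^ 2 * |q.1 - p.1| ^ 2 :=
    (pow_le_pow_left₀ hpq.le h2 2).trans_eq (by ring)
  calc ρ' / 2 * (∫ t, |diffBump ρ ρ' t|) / |q.1 - p.1| ^ 2 * ∫ t, |diffBump ρ ρ' t|
      ≤ ρ' / 2 * 2 / |q.1 - p.1| ^ 2 * 2 := by gcongr
    _ = 2 * ρ' / |q.1 - p.1| ^ 2 := by ring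
    _ ≤ 4 * A ^ 2 * (2 * ρ') / dist p q ^ 2 := by
        rw [div_le_div_iff₀ (by positivity) (by positivity)]
        nlinarith [mul_le_mul_of_nonneg_left h4 (by linarith : 0 ≤ 2 * ρ')]
    _ ≤ _ := by
        refine div_le_div_of_nonneg_right ?_ (by positivity)
        rw [mul_div_assoc]
        refine mul_le_mul_of_nonneg_left ?_ (by positivity)
        rw [le_div_iff₀ hρ]
        nlinarith

/-- Powers of two with real exponent. -/
noncomputable def exp2 (x : ℝ) : ℝ := (2 : ℝ) ^ x

theorem exp2_pos (x : ℝ) : 0 < exp2 x := Real.rpow_pos_of_pos two_pos x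

theorem exp2_add (x y : ℝ) : exp2 (x + y) = exp2 x * exp2 y := Real.rpow_add two_pos x y

theorem exp2_neg (x : ℝ) : exp2 (-x) = (exp2 x)⁻¹ := Real.rpow_neg two_pos.le x

@[simp] theorem exp2_zero : exp2 0 = 1 := Real.rpow_zero 2

theorem exp2_le {x y : ℝ} (h : x ≤ y) : exp2 x ≤ exp2 y :=
  Real.rpow_le_rpow_of_exponent_le one_le_two h

theorem exp2_lt {x y : ℝ} (h : x < y) : exp2 x < exp2 y :=
  Real.rpow_lt_rpow_of_exponent_lt one_lt_two h

theorem exp2_le_iff {x y : ℝ} : exp2 x ≤ exp2 y ↔ x ≤ y := Real.rpow_le_rpow_left_iff one_lt_two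

theorem exp2_natCast (n : ℕ) : exp2 n = 2 ^ n := Real.rpow_natCast 2 n

theorem exp2_mul_natCast (x : ℝ) (n : ℕ) : exp2 (x * n) = exp2 x ^ n := by
  unfold exp2
  rw [Real.rpow_mul two_pos.le, Real.rpow_natCast]

theorem exp2_le_one {x : ℝ} (h : x ≤ 0) : exp2 x ≤ 1 := by
  simpa using exp2_le h

theorem one_le_exp2 {x : ℝ} (h : 0 ≤ x) : 1 ≤ exp2 x := by
  simpa using exp2_le h

theorem shell_sum_le {Y : Finset (ℝ × ℝ)} {ν : ℝ × ℝ → ℝ} (hν : ∀ p, 0 ≤ ν p) {C σ T L : ℝ}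
    {J e : ℕ} (p : ℝ × ℝ) (hT : 0 ≤ T) (hL : 0 ≤ L) (hσ : σ ≤ e)
    (htot : ∑ q ∈ Y, ν q ≤ C)
    (hball : ∀ i ≤ J, ∑ q ∈ Y with dist p q ≤ exp2 (-(i * T)), ν q ≤ C * exp2 (-(i * T * σ)))
    {k : ℝ × ℝ → ℝ} (hk1 : ∀ q, k q ≤ L * exp2 (e * J * T))
    (hk2 : ∀ q, 0 < dist p q → k q ≤ L / dist p q ^ e) :
    ∑ q ∈ Y, ν q * k q ≤ L * exp2 (e * T) * (C * ((J + 2) * exp2 ((e - σ) * J * T))) := by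
  have hC : 0 ≤ C := (Finset.sum_nonneg fun q _ => hν q).trans htot
  have heT : 1 ≤ exp2 (e * T) := one_le_exp2 (by positivity)
  have hpt : ∀ q, k q ≤ L * exp2 (e * T) * (1 + ∑ i ∈ Finset.range (J + 1),
      if dist p q ≤ exp2 (-(i * T)) then exp2 (e * i * T) else 0) := by
    intro q
    have hterm : ∀ i ∈ Finset.range (J + 1),
        0 ≤ if dist p q ≤ exp2 (-(i * T)) then exp2 (e * i * T) else (0 : ℝ) := by
      intro i _
      split_ifs
      · exact (exp2_pos _).le
      · exact le_rfl
    have hone : ∀ i ≤ J, dist p q ≤ exp2 (-(i * T)) → k q ≤ L * exp2 (e * T) * exp2 (e * i * T) →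
        k q ≤ L * exp2 (e * T) * (1 + ∑ i ∈ Finset.range (J + 1),
          if dist p q ≤ exp2 (-(i * T)) then exp2 (e * i * T) else 0) := by
      intro i hi hd hk
      refine hk.trans (mul_le_mul_of_nonneg_left ?_ (mul_nonneg hL (exp2_pos _).le))
      have := Finset.single_le_sum hterm (Finset.mem_range.2 (Nat.lt_succ_of_le hi))
      rw [if_pos hd] at this
      linarith
    by_cases h0 : 1 < dist p q
    · refine (hk2 q (by linarith)).trans ?_
      have h1 : L / dist p q ^ e ≤ L := div_le_self hL (one_le_pow₀ h0.le)
      have h2 := Finset.sum_nonneg hterm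
      calc L / dist p q ^ e ≤ L * 1 * 1 := by linarith
        _ ≤ _ := by gcongr; linarith
    by_cases hJ : dist p q ≤ exp2 (-(J * T))
    · refine hone J le_rfl hJ ((hk1 q).trans ?_)
      rw [mul_assoc L]
      exact mul_le_mul_of_nonneg_left (le_mul_of_one_le_left (exp2_pos _).le heT) hL
    have hex : ∃ i : ℕ, exp2 (-(i * T)) < dist p q := ⟨J, not_le.1 hJ⟩
    classical
    have hi1 := Nat.find_spec hex
    have hi2 : Nat.find hex ≤ J := Nat.find_min' hex (not_le.1 hJ)
    have hi3 := fun k (hk : k < Nat.find hex) => Nat.find_min hex hk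
    generalize Nat.find hex = i at hi1 hi2 hi3
    cases i with
    | zero => simp at hi1; exact absurd hi1 h0
    | succ i =>
      refine hone i (by omega) (not_lt.1 (hi3 i (by omega))) ?_
      refine (hk2 q ((exp2_pos _).trans hi1)).trans ?_
      rw [mul_assoc, ← exp2_add, div_eq_mul_inv]
      refine mul_le_mul_of_nonneg_left ?_ hL
      have h1 : exp2 (-((i + 1 : ℕ) * T)) ^ e ≤ dist p q ^ e :=
        pow_le_pow_left₀ (exp2_pos _).le hi1.le e
      rw [← exp2_mul_natCast] at h1
      calc (dist p q ^ e)⁻¹ ≤ (exp2 (-((i + 1 : ℕ) * T) * e))⁻¹ := inv_anti₀ (exp2_pos _) h1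
        _ = _ := by rw [← exp2_neg]; congr 1; push_cast; ring
  have h1 : ∑ q ∈ Y, ν q * k q ≤ L * exp2 (e * T) * (∑ q ∈ Y, ν q +
      ∑ i ∈ Finset.range (J + 1), exp2 (e * i * T) *
        ∑ q ∈ Y with dist p q ≤ exp2 (-(i * T)), ν q) := by
    calc ∑ q ∈ Y, ν q * k q ≤ ∑ q ∈ Y, ν q * (L * exp2 (e * T) * (1 +
          ∑ i ∈ Finset.range (J + 1),
            if dist p q ≤ exp2 (-(i * T)) then exp2 (e * i * T) else 0)) :=
          Finset.sum_le_sum fun q _ => mul_le_mul_of_nonneg_left (hpt q) (hν q)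
      _ = _ := by
          have e1 : ∑ i ∈ Finset.range (J + 1), exp2 (e * i * T) *
              ∑ q ∈ Y with dist p q ≤ exp2 (-(i * T)), ν q = ∑ q ∈ Y, ν q *
                ∑ i ∈ Finset.range (J + 1),
                  if dist p q ≤ exp2 (-(i * T)) then exp2 (e * i * T) else 0 := by
            simp_rw [Finset.sum_filter, Finset.mul_sum]
            rw [Finset.sum_comm]
            refine Finset.sum_congr rfl fun q _ => Finset.sum_congr rfl fun i _ => ?_
            split_ifs <;> ring
          rw [e1, ← Finset.sum_add_distrib, Finset.mul_sum]
          refine Finset.sum_congr rfl fun q _ => ?_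
          ring
  refine h1.trans (mul_le_mul_of_nonneg_left ?_ (mul_nonneg hL (exp2_pos _).le))
  have hbig : 1 ≤ exp2 ((e - σ) * J * T) :=
    one_le_exp2 (mul_nonneg (mul_nonneg (by linarith) (Nat.cast_nonneg J)) hT)
  have h2 : ∀ i ∈ Finset.range (J + 1), exp2 (e * i * T) *
        ∑ q ∈ Y with dist p q ≤ exp2 (-(i * T)), ν q ≤ C * exp2 ((e - σ) * J * T) := by
    intro i hi
    have hiJ : i ≤ J := Nat.lt_succ_iff.1 (Finset.mem_range.1 hi)
    calc _ ≤ exp2 (e * i * T) * (C * exp2 (-(i * T * σ))) :=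
          mul_le_mul_of_nonneg_left (hball i hiJ) (exp2_pos _).le
      _ = C * exp2 ((e - σ) * i * T) := by
          rw [mul_left_comm, ← exp2_add]
          congr 2
          ring
      _ ≤ _ := by
          refine mul_le_mul_of_nonneg_left (exp2_le ?_) hC
          refine mul_le_mul_of_nonneg_right (mul_le_mul_of_nonneg_left ?_ (by linarith)) hT
          exact_mod_cast hiJ
  calc _ ≤ C * exp2 ((e - σ) * J * T) + ∑ _i ∈ Finset.range (J + 1), C * exp2 ((e - σ) * J * T) :=
        add_le_add (htot.trans (le_mul_of_one_le_right hC hbig)) (Finset.sum_le_sum h2)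
    _ = _ := by
        rw [Finset.sum_const, Finset.card_range, nsmul_eq_mul]
        push_cast
        ring

/-- The weighted sum of a bump over the points of `Y`, as a function on the space of lines. -/
noncomputable def lineSum (Y : Finset (ℝ × ℝ)) (ν : ℝ × ℝ → ℝ) (ψ : ℝ → ℝ) (z : ℝ × ℝ) : ℝ :=
  ∑ p ∈ Y, ν p * ψ (p.2 - z.1 * p.1 - z.2)

theorem tent_mul_lineSum_sq (Y : Finset (ℝ × ℝ)) (ν : ℝ × ℝ → ℝ) (ψ : ℝ → ℝ) (A : ℝ)
    (z : ℝ × ℝ) : tent A z.1 * lineSum Y ν ψ z ^ 2 = ∑ p ∈ Y, ∑ q ∈ Y, ν p * ν q *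
      (tent A z.1 * (ψ (p.2 - z.1 * p.1 - z.2) * ψ (q.2 - z.1 * q.1 - z.2))) := by
  rw [lineSum, sq, Finset.sum_mul_sum, Finset.mul_sum]
  refine Finset.sum_congr rfl fun p _ => ?_
  rw [Finset.mul_sum]
  refine Finset.sum_congr rfl fun q _ => ?_
  ring

theorem IsBump.integrable_lineSum {ψ : ℝ → ℝ} {b L : ℝ} (h : IsBump ψ b L) {A : ℝ} (hA : 0 ≤ A)
    (Y : Finset (ℝ × ℝ)) (ν : ℝ × ℝ → ℝ) :
    Integrable (fun z : ℝ × ℝ => tent A z.1 * lineSum Y ν ψ z ^ 2) := by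
  simp_rw [tent_mul_lineSum_sq]
  exact integrable_finsetSum _ fun p _ => integrable_finsetSum _ fun q _ =>
    (h.pair_integrable h hA p q).const_mul _

theorem IsBump.integral_lineSum {ψ : ℝ → ℝ} {b L : ℝ} (h : IsBump ψ b L) {A : ℝ} (hA : 0 ≤ A)
    (Y : Finset (ℝ × ℝ)) (ν : ℝ × ℝ → ℝ) :
    ∫ z : ℝ × ℝ, tent A z.1 * lineSum Y ν ψ z ^ 2 =
      ∑ p ∈ Y, ν p * ∑ q ∈ Y, ν q * linePair A ψ p q := by
  simp_rw [tent_mul_lineSum_sq]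
  rw [Measure.volume_eq_prod, integral_finsetSum _ fun p _ => integrable_finsetSum _ fun q _ =>
    (h.pair_integrable h hA p q).const_mul _]
  refine Finset.sum_congr rfl fun p _ => ?_
  rw [integral_finsetSum _ fun q _ => (h.pair_integrable h hA p q).const_mul _, Finset.mul_sum]
  refine Finset.sum_congr rfl fun q _ => ?_
  rw [integral_const_mul, mul_assoc]
  rfl

/-- The parallelogram of lines close to a given line through `x`. -/
noncomputable def nearLine (h a₀ : ℝ) (x z : ℝ × ℝ) : ℝ :=
  box h (z.1 - a₀) * box h (x.2 - z.1 * x.1 - z.2)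

theorem nearLine_nonneg (h a₀ : ℝ) (x z : ℝ × ℝ) : 0 ≤ nearLine h a₀ x z :=
  mul_nonneg (box_nonneg _ _) (box_nonneg _ _)

theorem nearLine_le (h a₀ : ℝ) (x z : ℝ × ℝ) :
    nearLine h a₀ x z ≤ box h (x.2 - z.1 * x.1 - z.2) :=
  mul_le_of_le_one_left (box_nonneg _ _) (box_le_one _ _)

theorem integrable_nearLine (h a₀ : ℝ) (x : ℝ × ℝ) :
    Integrable (nearLine h a₀ x) (volume.prod volume) := by
  refine integrable_of_bdd_support (C := 1) ?_ (fun z => ?_)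
    ((Metric.isBounded_Icc (-(|a₀| + h)) (|a₀| + h)).prod
      (Metric.isBounded_Icc (-(|x.2| + (|a₀| + h) * |x.1| + h))
        (|x.2| + (|a₀| + h) * |x.1| + h))) ?_
  · unfold nearLine
    refine ((measurable_box h).comp ?_).mul ((measurable_box h).comp ?_) <;> fun_prop
  · rw [abs_of_nonneg (nearLine_nonneg _ _ _ _)]
    exact (nearLine_le _ _ _ _).trans (box_le_one _ _)
  · intro z hz
    unfold nearLine
    by_cases h1 : h < |z.1 - a₀|
    · rw [box_of_lt h1, zero_mul]
    · rw [box_of_lt (w := h) (t := x.2 - z.1 * x.1 - z.2), mul_zero]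
      by_contra h2
      have h0 : |z.1| ≤ |a₀| + h := by
        calc |z.1| = |a₀ + (z.1 - a₀)| := by congr 1; ring
          _ ≤ _ := (abs_add_le _ _).trans (add_le_add le_rfl (not_lt.1 h1))
      refine hz ⟨abs_le.1 h0, abs_le.1 ?_⟩
      have h3 : |z.1 * x.1| ≤ (|a₀| + h) * |x.1| := by
        rw [abs_mul]
        exact mul_le_mul_of_nonneg_right h0 (abs_nonneg _)
      have h4 : z.2 = x.2 - z.1 * x.1 - (x.2 - z.1 * x.1 - z.2) := by ring
      rw [h4]
      exact (abs_sub _ _).trans (add_le_add ((abs_sub _ _).trans (add_le_add le_rfl h3))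
        (not_lt.1 h2))

theorem integral_nearLine {h : ℝ} (hh : 0 ≤ h) (a₀ : ℝ) (x : ℝ × ℝ) :
    ∫ z, nearLine h a₀ x z = 4 * h ^ 2 := by
  rw [Measure.volume_eq_prod, integral_prod _ (integrable_nearLine h a₀ x)]
  have e1 : ∀ a : ℝ, ∫ c, nearLine h a₀ x (a, c) = box h (a - a₀) * (2 * h) := by
    intro a
    simp only [nearLine]
    rw [integral_const_mul, integral_sub_left_eq_self (box h), integral_box hh]
  simp only [e1]
  rw [integral_mul_const, integral_sub_right_eq_self (box h), integral_box hh]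
  ring

/-- The slope of the line through two points of the plane. -/
noncomputable def lineSlope (x y : ℝ × ℝ) : ℝ := (y.2 - x.2) / (y.1 - x.1)

/-- The `ν`-mass of the (vertical) `w`-neighbourhood of the line through `x` and `y`. -/
noncomputable def tubeMass (Y : Finset (ℝ × ℝ)) (ν : ℝ × ℝ → ℝ) (w : ℝ) (x y : ℝ × ℝ) : ℝ :=
  ∑ p ∈ Y, ν p * box w (p.2 - x.2 - lineSlope x y * (p.1 - x.1))

theorem box_le_box {w w' t t' : ℝ} (h : |t| ≤ w → |t'| ≤ w') : box w t ≤ box w' t' := by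
  rcases le_or_gt |t| w with h1 | h1
  · rw [box_of_le h1, box_of_le (h h1)]
  · rw [box_of_lt h1]; exact box_nonneg _ _

theorem abs_le_of_nearLine_ne_zero {h a₀ : ℝ} {x z : ℝ × ℝ} (hz : nearLine h a₀ x z ≠ 0) :
    |z.1 - a₀| ≤ h ∧ |x.2 - z.1 * x.1 - z.2| ≤ h := by
  constructor
  · by_contra hcon
    exact hz (by rw [nearLine, box_of_lt (not_le.1 hcon), zero_mul])
  · by_contra hcon
    refine hz ?_
    rw [nearLine, box_of_lt (w := h) (t := x.2 - z.1 * x.1 - z.2) (not_le.1 hcon), mul_zero]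

theorem nearLine_pointwise {X Y : Finset (ℝ × ℝ)} {μ ν : ℝ × ℝ → ℝ} (hμ : ∀ p, 0 ≤ μ p)
    (hν : ∀ p, 0 ≤ ν p) {R A h ρ ρ' M l : ℝ} (hh : 0 < h) (hρ : 0 < ρ) (hρ' : 4 * ρ ≤ ρ')
    (hM : 0 < M) (hl : 0 < l) (hX : ∀ x ∈ X, |x.1| ≤ R) (hY : ∀ y ∈ Y, |y.1| ≤ R)
    (hRh : (2 * R + 1) * h ≤ ρ) {B : Finset ((ℝ × ℝ) × (ℝ × ℝ))} (hB : B ⊆ X ×ˢ Y)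
    (hne : ∀ b ∈ B, b.1.1 ≠ b.2.1) (hA : ∀ b ∈ B, |lineSlope b.1 b.2| + h + 1 ≤ A)
    (hbig : ∀ b ∈ B, ρ * M ≤ tubeMass Y ν ρ b.1 b.2)
    (hprev : ∀ b ∈ B, tubeMass Y ν ρ' b.1 b.2 ≤ ρ' * (M / 8)) (z : ℝ × ℝ) :
    ∑ b ∈ B, μ b.1 * ν b.2 * nearLine h (lineSlope b.1 b.2) b.1 z ≤
      ρ' / 2 * (l * (tent A z.1 * lineSum Y ν (diffBump ρ ρ') z ^ 2) +
        l⁻¹ * (tent A z.1 * lineSum X μ (box h) z ^ 2)) := by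
  have hρ'0 : 0 < ρ' := by linarith
  have ht := tent_nonneg A z.1
  by_cases hex : ∃ b ∈ B, nearLine h (lineSlope b.1 b.2) b.1 z ≠ 0
  swap
  · push Not at hex
    rw [Finset.sum_eq_zero fun b hb => by rw [hex b hb, mul_zero]]
    positivity
  have hclose : ∀ b ∈ B, nearLine h (lineSlope b.1 b.2) b.1 z ≠ 0 → ∀ p ∈ Y,
      |(p.2 - z.1 * p.1 - z.2) - (p.2 - b.1.2 - lineSlope b.1 b.2 * (p.1 - b.1.1))| ≤ ρ := by
    intro b hb hb0 p hp
    obtain ⟨h1, h2⟩ := abs_le_of_nearLine_ne_zero hb0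
    have hx := hX _ (Finset.mem_product.1 (hB hb)).1
    have hpx : |p.1 - b.1.1| ≤ 2 * R := by
      have := abs_sub p.1 b.1.1
      have := hY p hp
      linarith
    have e1 : (p.2 - z.1 * p.1 - z.2) - (p.2 - b.1.2 - lineSlope b.1 b.2 * (p.1 - b.1.1)) =
        (b.1.2 - z.1 * b.1.1 - z.2) - (z.1 - lineSlope b.1 b.2) * (p.1 - b.1.1) := by ring
    rw [e1]
    refine (abs_sub _ _).trans ?_
    rw [abs_mul]
    have := mul_le_mul h1 hpx (abs_nonneg _) hh.le
    linarith
  set S₁ := lineSum Y ν (box (ρ' / 2)) z with hS₁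
  set S₂ := lineSum Y ν (box (2 * ρ)) z with hS₂
  set U := lineSum X μ (box h) z with hU
  have hU0 : 0 ≤ U := Finset.sum_nonneg fun p _ => mul_nonneg (hμ p) (box_nonneg _ _)
  have hφ : lineSum Y ν (diffBump ρ ρ') z = S₂ / (4 * ρ) - S₁ / ρ' := by
    simp only [hS₁, hS₂, lineSum, diffBump, Finset.sum_div, ← Finset.sum_sub_distrib]
    exact Finset.sum_congr rfl fun p _ => by ring
  obtain ⟨b, hb, hb0⟩ := hex
  have h1 : ρ * M ≤ S₂ := by
    refine (hbig b hb).trans (Finset.sum_le_sum fun p hp => mul_le_mul_of_nonneg_left ?_ (hν p))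
    refine box_le_box fun h3 => ?_
    have h4 := hclose b hb hb0 p hp
    have := abs_sub_abs_le_abs_sub (p.2 - z.1 * p.1 - z.2)
      (p.2 - b.1.2 - lineSlope b.1 b.2 * (p.1 - b.1.1))
    linarith
  have h2 : S₁ ≤ ρ' * (M / 8) := by
    refine le_trans (Finset.sum_le_sum fun p hp => mul_le_mul_of_nonneg_left ?_ (hν p))
      (hprev b hb)
    refine box_le_box fun h3 => ?_
    have h4 := hclose b hb hb0 p hp
    rw [abs_sub_comm] at h4
    have := abs_sub_abs_le_abs_sub (p.2 - b.1.2 - lineSlope b.1 b.2 * (p.1 - b.1.1))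
      (p.2 - z.1 * p.1 - z.2)
    linarith
  have h3 : M / 8 ≤ S₂ / (4 * ρ) - S₁ / ρ' := by
    have e1 : M / 4 ≤ S₂ / (4 * ρ) := by
      rw [le_div_iff₀ (by positivity)]
      linarith
    have e2 : S₁ / ρ' ≤ M / 8 := by
      rw [div_le_iff₀ hρ'0]
      linarith
    linarith
  have h4 : 1 ≤ tent A z.1 := by
    refine le_max_of_le_right ?_
    have e1 := hA b hb
    have e2 := (abs_le_of_nearLine_ne_zero hb0).1
    have e3 := abs_sub_abs_le_abs_sub z.1 (lineSlope b.1 b.2)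
    linarith
  have h5 : ∑ b ∈ B, μ b.1 * ν b.2 * nearLine h (lineSlope b.1 b.2) b.1 z ≤ U * S₁ := by
    calc _ ≤ ∑ b ∈ B, μ b.1 * ν b.2 *
          (box h (b.1.2 - z.1 * b.1.1 - z.2) * box (ρ' / 2) (b.2.2 - z.1 * b.2.1 - z.2)) := by
          refine Finset.sum_le_sum fun b hb => mul_le_mul_of_nonneg_left ?_
            (mul_nonneg (hμ _) (hν _))
          by_cases h0 : nearLine h (lineSlope b.1 b.2) b.1 z = 0
          · rw [h0]
            exact mul_nonneg (box_nonneg _ _) (box_nonneg _ _)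
          · refine (nearLine_le _ _ _ _).trans (le_of_eq ?_)
            have e1 := hclose b hb h0 b.2 (Finset.mem_product.1 (hB hb)).2
            have e2 : lineSlope b.1 b.2 * (b.2.1 - b.1.1) = b.2.2 - b.1.2 :=
              div_mul_cancel₀ _ (sub_ne_zero.2 (hne b hb).symm)
            rw [e2, sub_self, sub_zero] at e1
            rw [box_of_le (w := ρ' / 2) (t := b.2.2 - z.1 * b.2.1 - z.2) (by linarith), mul_one]
      _ ≤ ∑ b ∈ X ×ˢ Y, μ b.1 * ν b.2 *
          (box h (b.1.2 - z.1 * b.1.1 - z.2) * box (ρ' / 2) (b.2.2 - z.1 * b.2.1 - z.2)) :=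
          Finset.sum_le_sum_of_subset_of_nonneg hB fun b _ _ =>
            mul_nonneg (mul_nonneg (hμ _) (hν _)) (mul_nonneg (box_nonneg _ _) (box_nonneg _ _))
      _ = U * S₁ := by
          rw [hU, hS₁, lineSum, lineSum, Finset.sum_mul_sum, Finset.sum_product]
          exact Finset.sum_congr rfl fun p _ => Finset.sum_congr rfl fun q _ => by ring
  rw [hφ]
  set φ := S₂ / (4 * ρ) - S₁ / ρ'
  have hφ0 : 0 < φ := by linarith
  have h6 : U * S₁ ≤ ρ' * (U * φ) := by
    have : S₁ ≤ ρ' * φ := h2.trans (mul_le_mul_of_nonneg_left h3 hρ'0.le)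
    calc U * S₁ ≤ U * (ρ' * φ) := mul_le_mul_of_nonneg_left this hU0
      _ = _ := by ring
  have h7 : U * φ ≤ 1 / 2 * (l * φ ^ 2 + l⁻¹ * U ^ 2) := by
    have e1 : l * φ ^ 2 + l⁻¹ * U ^ 2 - 2 * (U * φ) = l⁻¹ * (l * φ - U) ^ 2 := by
      field_simp
      ring
    have e2 : 0 ≤ l⁻¹ * (l * φ - U) ^ 2 := by positivity
    linarith
  have h8 : 0 ≤ l * φ ^ 2 + l⁻¹ * U ^ 2 := by positivity
  calc _ ≤ U * S₁ := h5
    _ ≤ ρ' * (U * φ) := h6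
    _ ≤ ρ' * (1 / 2 * (l * φ ^ 2 + l⁻¹ * U ^ 2)) := mul_le_mul_of_nonneg_left h7 hρ'0.le
    _ = ρ' / 2 * (1 * (l * φ ^ 2 + l⁻¹ * U ^ 2)) := by ring
    _ ≤ ρ' / 2 * (tent A z.1 * (l * φ ^ 2 + l⁻¹ * U ^ 2)) :=
        mul_le_mul_of_nonneg_left (mul_le_mul_of_nonneg_right h4 h8) (by positivity)
    _ = _ := by ring

theorem nearLine_integrated {X Y : Finset (ℝ × ℝ)} {μ ν : ℝ × ℝ → ℝ} (hμ : ∀ p, 0 ≤ μ p)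
    (hν : ∀ p, 0 ≤ ν p) {R A h ρ ρ' M l : ℝ} (hh : 0 < h) (hρ : 0 < ρ) (hρ' : 4 * ρ ≤ ρ')
    (hM : 0 < M) (hl : 0 < l) (hX : ∀ x ∈ X, |x.1| ≤ R) (hY : ∀ y ∈ Y, |y.1| ≤ R)
    (hRh : (2 * R + 1) * h ≤ ρ) (hA0 : 0 ≤ A)
    {B : Finset ((ℝ × ℝ) × (ℝ × ℝ))} (hB : B ⊆ X ×ˢ Y)
    (hne : ∀ b ∈ B, b.1.1 ≠ b.2.1) (hA : ∀ b ∈ B, |lineSlope b.1 b.2| + h + 1 ≤ A)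
    (hbig : ∀ b ∈ B, ρ * M ≤ tubeMass Y ν ρ b.1 b.2)
    (hprev : ∀ b ∈ B, tubeMass Y ν ρ' b.1 b.2 ≤ ρ' * (M / 8)) :
    (∑ b ∈ B, μ b.1 * ν b.2) * (4 * h ^ 2) ≤
      ρ' / 2 * (l * (∑ p ∈ Y, ν p * ∑ q ∈ Y, ν q * linePair A (diffBump ρ ρ') p q) +
        l⁻¹ * (∑ p ∈ X, μ p * ∑ q ∈ X, μ q * linePair A (box h) p q)) := by
  have hd := isBump_diffBump hρ hρ'
  have hintegral := integral_mono (μ := (volume : Measure (ℝ × ℝ)))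
    (integrable_finsetSum B fun b _ =>
      (integrable_nearLine h (lineSlope b.1 b.2) b.1).const_mul (μ b.1 * ν b.2))
    ((((hd.integrable_lineSum hA0 Y ν).const_mul l).add
      (((isBump_box h).integrable_lineSum hA0 X μ).const_mul l⁻¹)).const_mul (ρ' / 2))
    (nearLine_pointwise hμ hν hh hρ hρ' hM hl hX hY hRh hB hne hA hbig hprev)
  have e1 : ∫ z : ℝ × ℝ, ∑ b ∈ B, μ b.1 * ν b.2 * nearLine h (lineSlope b.1 b.2) b.1 z =
      (∑ b ∈ B, μ b.1 * ν b.2) * (4 * h ^ 2) := by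
    rw [integral_finsetSum _ fun b _ =>
      (integrable_nearLine h (lineSlope b.1 b.2) b.1).const_mul (μ b.1 * ν b.2), Finset.sum_mul]
    refine Finset.sum_congr rfl fun b _ => ?_
    rw [integral_const_mul, integral_nearLine hh.le]
  rw [e1] at hintegral
  refine hintegral.trans (le_of_eq ?_)
  simp only [Pi.add_apply]
  rw [integral_const_mul, integral_add ((hd.integrable_lineSum hA0 Y ν).const_mul l)
      (((isBump_box h).integrable_lineSum hA0 X μ).const_mul l⁻¹), integral_const_mul,
      integral_const_mul, hd.integral_lineSum hA0, (isBump_box h).integral_lineSum hA0]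

theorem sum_biUnion_le_of_nonneg {ι κ : Type*} [DecidableEq ι] (S : Finset κ) (B : κ → Finset ι)
    {f : ι → ℝ} (hf : ∀ b, 0 ≤ f b) : ∑ b ∈ S.biUnion B, f b ≤ ∑ i ∈ S, ∑ b ∈ B i, f b := by
  classical
  induction S using Finset.induction_on with
  | empty => simp
  | insert a S ha ih =>
    rw [Finset.biUnion_insert, Finset.sum_insert ha]
    have := Finset.sum_union_inter (s₁ := B a) (s₂ := S.biUnion B) (f := f)
    have h0 : 0 ≤ ∑ b ∈ B a ∩ S.biUnion B, f b := Finset.sum_nonneg fun b _ => hf b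
    linarith

theorem sum_filter_exists_le {ι κ : Type*} (S : Finset ι) (I : Finset κ) (p : κ → ι → Prop)
    [∀ i, DecidablePred (p i)] [DecidablePred fun b => ∃ i ∈ I, p i b]
    {f : ι → ℝ} (hf : ∀ b, 0 ≤ f b) :
    ∑ b ∈ S with ∃ i ∈ I, p i b, f b ≤ ∑ i ∈ I, ∑ b ∈ S with p i b, f b := by
  classical
  refine le_trans (Finset.sum_le_sum_of_subset_of_nonneg (t := I.biUnion fun i => S.filter (p i))
    ?_ fun b _ _ => hf b) (sum_biUnion_le_of_nonneg I _ hf)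
  intro b hb
  obtain ⟨h1, i, hi, h2⟩ := Finset.mem_filter.1 hb
  exact Finset.mem_biUnion.2 ⟨i, hi, Finset.mem_filter.2 ⟨h1, h2⟩⟩

theorem exists_le_exp2 (K : ℝ) : ∃ T₀ : ℝ, ∀ T ≥ T₀, K ≤ exp2 T := by
  obtain ⟨n, hn⟩ := pow_unbounded_of_one_lt K one_lt_two
  refine ⟨n, fun T hT => hn.le.trans ?_⟩
  rw [← exp2_natCast]
  exact exp2_le hT

/-- Frostman-type condition at the scales `2 ^ (-i T)`, `i ≤ n`. -/
structure IsFrostman (Y : Finset (ℝ × ℝ)) (ν : ℝ × ℝ → ℝ) (C σ T : ℝ) (n : ℕ) : Prop where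
  nonneg : ∀ p, 0 ≤ ν p
  total : ∑ q ∈ Y, ν q ≤ C
  ball : ∀ p ∈ Y, ∀ i ≤ n, ∑ q ∈ Y with dist p q ≤ exp2 (-(i * T)), ν q ≤ C * exp2 (-(i * T * σ))

theorem IsFrostman.mono {Y : Finset (ℝ × ℝ)} {ν : ℝ × ℝ → ℝ} {C σ T : ℝ} {n k : ℕ}
    (h : IsFrostman Y ν C σ T n) (hk : k ≤ n) : IsFrostman Y ν C σ T k :=
  ⟨h.nonneg, h.total, fun p hp i hi => h.ball p hp i (hi.trans hk)⟩

theorem IsFrostman.energy_le {Y : Finset (ℝ × ℝ)} {ν : ℝ × ℝ → ℝ} {C σ T L : ℝ} {J e : ℕ}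
    (h : IsFrostman Y ν C σ T J) (hT : 0 ≤ T) (hL : 0 ≤ L) (hσ : σ ≤ e)
    {k : ℝ × ℝ → ℝ × ℝ → ℝ} (hk1 : ∀ p q, k p q ≤ L * exp2 (e * J * T))
    (hk2 : ∀ p q, 0 < dist p q → k p q ≤ L / dist p q ^ e) :
    ∑ p ∈ Y, ν p * ∑ q ∈ Y, ν q * k p q ≤
      C * (L * exp2 (e * T) * (C * ((J + 2) * exp2 ((e - σ) * J * T)))) := by
  have hC : 0 ≤ C := (Finset.sum_nonneg fun q _ => h.nonneg q).trans h.total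
  have h0 : 0 ≤ L * exp2 (e * T) * (C * ((J + 2) * exp2 ((e - σ) * J * T))) :=
    mul_nonneg (mul_nonneg hL (exp2_pos _).le)
      (mul_nonneg hC (mul_nonneg (by positivity) (exp2_pos _).le))
  calc _ ≤ ∑ p ∈ Y, ν p * (L * exp2 (e * T) * (C * ((J + 2) * exp2 ((e - σ) * J * T)))) :=
        Finset.sum_le_sum fun p hp => mul_le_mul_of_nonneg_left
          (shell_sum_le h.nonneg p hT hL hσ h.total (h.ball p hp) (hk1 p) (hk2 p)) (h.nonneg p)
    _ = (∑ p ∈ Y, ν p) * (L * exp2 (e * T) * (C * ((J + 2) * exp2 ((e - σ) * J * T)))) := by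
        rw [Finset.sum_mul]
    _ ≤ _ := mul_le_mul_of_nonneg_right h.total h0

set_option maxHeartbeats 1000000 in
theorem level_bad_le {X Y : Finset (ℝ × ℝ)} {μ ν : ℝ × ℝ → ℝ} {C s t T R A M : ℝ} {i : ℕ}
    (hμ : IsFrostman X μ C s T (i + 1)) (hν : IsFrostman Y ν C t T i) (hs : s ≤ 1) (ht : t ≤ 2)
    (hT : 2 ≤ T) (hR : 0 ≤ R) (hM : 0 < M) (hA1 : 1 ≤ A)
    (hX : ∀ x ∈ X, |x.1| ≤ R) (hY : ∀ y ∈ Y, |y.1| ≤ R)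
    {B : Finset ((ℝ × ℝ) × (ℝ × ℝ))} (hB : B ⊆ X ×ˢ Y)
    (hne : ∀ b ∈ B, b.1.1 ≠ b.2.1) (hA : ∀ b ∈ B, |lineSlope b.1 b.2| + 2 ≤ A)
    (hbig : ∀ b ∈ B, exp2 (-((i + 1) * T)) * M ≤ tubeMass Y ν (exp2 (-((i + 1) * T))) b.1 b.2)
    (hprev : ∀ b ∈ B, tubeMass Y ν (exp2 (-(i * T))) b.1 b.2 ≤ exp2 (-(i * T)) * (M / 8)) :
    ∑ b ∈ B, μ b.1 * ν b.2 ≤ 3 * (i + 3) * (A * C * (2 * R + 1)) ^ 2 *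
      exp2 (T * (5 - (i + 1) * ((s + t) / 2 - 1))) := by
  have hC : 0 ≤ C := (Finset.sum_nonneg fun q _ => hμ.nonneg q).trans hμ.total
  set ρ := exp2 (-((i + 1) * T)) with hρdef
  set ρ' := exp2 (-(i * T)) with hρ'def
  have hρ : 0 < ρ := exp2_pos _
  have hρ'0 : 0 < ρ' := exp2_pos _
  have hD : 0 < 2 * R + 1 := by linarith
  set h := ρ / (2 * R + 1) with hh
  have hh0 : 0 < h := by positivity
  have hρ1 : ρ ≤ 1 := exp2_le_one (by
    have : 0 ≤ (i + 1) * T := by positivity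
    linarith)
  have hh1 : h ≤ 1 := (div_le_self hρ.le (by linarith)).trans hρ1
  have hhD : (2 * R + 1) * h = ρ := mul_div_cancel₀ _ hD.ne'
  have h4 : 4 * ρ ≤ ρ' := by
    have e1 : ρ' = exp2 T * ρ := by
      rw [hρdef, hρ'def, ← exp2_add]
      congr 1
      ring
    have e2 : exp2 2 ≤ exp2 T := exp2_le hT
    have e3 : exp2 2 = 4 := by
      have := exp2_natCast 2
      norm_num at this
      exact this
    rw [e1]
    rw [e3] at e2
    exact mul_le_mul_of_nonneg_right e2 hρ.le
  set f := exp2 ((i + 1) * T * ((t - s) / 2)) with hf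
  have hf0 : 0 < f := exp2_pos _
  have hmain := nearLine_integrated (A := A) (M := M) hμ.nonneg hν.nonneg (l := h * f) hh0 hρ h4 hM
    (mul_pos hh0 hf0) hX hY hhD.le (by linarith) hB hne
    (fun b hb => by linarith [hA b hb]) hbig hprev
  have hΦ := hν.energy_le (k := linePair A (diffBump ρ ρ')) (L := 4 * A ^ 2 * ρ' ^ 2 / ρ) (e := 2)
    (by linarith) (by positivity) (by exact_mod_cast ht)
    (fun p q => (le_abs_self _).trans ((linePair_diffBump_le hA1 hρ h4 p q).trans (by
      have e1 : exp2 ((2 : ℕ) * i * T) = (ρ' ^ 2)⁻¹ := by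
        rw [hρ'def, ← exp2_mul_natCast, ← exp2_neg]
        congr 1
        push_cast
        ring
      rw [e1, div_mul_eq_mul_div, mul_inv_cancel_right₀ (by positivity)]
      exact div_le_div_of_nonneg_right (by nlinarith [sq_nonneg A]) hρ.le)))
    (fun p q hpq => (le_abs_self _).trans (linePair_diffBump_le_div hA1 hρ h4 hpq))
  have hMu := hμ.energy_le (k := linePair A (box h)) (L := 16 * A ^ 2 * h ^ 2 * (2 * R + 1))
    (e := 1) (by linarith) (by positivity) (by exact_mod_cast hs)
    (fun p q => (linePair_box_le hA1 hh0 p q).trans (by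
      have e1 : exp2 ((1 : ℕ) * (i + 1 : ℕ) * T) = ρ⁻¹ := by
        rw [hρdef, ← exp2_neg]
        congr 1
        push_cast
        ring
      rw [e1, ← hhD]
      have : 16 * A ^ 2 * h ^ 2 * (2 * R + 1) * ((2 * R + 1) * h)⁻¹ = 16 * A ^ 2 * h := by
        field_simp
      rw [this]
      nlinarith [mul_nonneg (sq_nonneg A) hh0.le]))
    (fun p q hpq => (linePair_box_le_div hA1 hh0 hpq).trans (by
      rw [pow_one]
      refine div_le_div_of_nonneg_right ?_ hpq.le
      exact le_mul_of_one_le_right (by positivity) (by linarith)))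
  set c := exp2 ((2 : ℕ) * T) with hc
  set d := exp2 (((2 : ℕ) - t) * i * T) with hd
  set c' := exp2 ((1 : ℕ) * T) with hc'
  set d' := exp2 (((1 : ℕ) - s) * (i + 1 : ℕ) * T) with hd'
  set E := exp2 (T * (5 - (i + 1) * ((s + t) / 2 - 1))) with hE
  have hE0 : 0 < E := exp2_pos _
  have hE1 : ρ' ^ 3 * f * c * d ≤ ρ ^ 2 * E := by
    rw [hρdef, hρ'def, hf, hc, hd, hE, ← exp2_mul_natCast, ← exp2_mul_natCast, ← exp2_add,
      ← exp2_add, ← exp2_add, ← exp2_add]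
    apply exp2_le
    push_cast
    nlinarith
  have hE2 : ρ' * c' * d' ≤ ρ * f * E := by
    rw [hρdef, hρ'def, hf, hc', hd', hE, ← exp2_add, ← exp2_add, ← exp2_add, ← exp2_add]
    apply exp2_le
    push_cast
    nlinarith
  have hP : 0 < 4 * h ^ 2 := by positivity
  refine le_of_mul_le_mul_right (hmain.trans ?_) hP
  have hl : 0 < h * f := mul_pos hh0 hf0
  have key1 : ρ' / 2 * (h * f * (C * (4 * A ^ 2 * ρ' ^ 2 / ρ * c * (C * ((i + 2) * d))))) ≤
      2 * (i + 2) * (A * C) ^ 2 * h * ρ * E := by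
    calc _ = 2 * (i + 2) * (A * C) ^ 2 * h / ρ * (ρ' ^ 3 * f * c * d) := by
          field_simp
          ring
      _ ≤ 2 * (i + 2) * (A * C) ^ 2 * h / ρ * (ρ ^ 2 * E) :=
          mul_le_mul_of_nonneg_left hE1 (by positivity)
      _ = _ := by field_simp
  have key2 : ρ' / 2 * ((h * f)⁻¹ * (C * (16 * A ^ 2 * h ^ 2 * (2 * R + 1) * c' *
      (C * (((i + 1 : ℕ) + 2) * d'))))) ≤ 8 * (i + 3) * (A * C) ^ 2 * h * (2 * R + 1) * ρ * E := by
    calc _ = 8 * (i + 3) * (A * C) ^ 2 * h * (2 * R + 1) / f * (ρ' * c' * d') := by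
          push_cast
          field_simp
          ring
      _ ≤ 8 * (i + 3) * (A * C) ^ 2 * h * (2 * R + 1) / f * (ρ * f * E) :=
          mul_le_mul_of_nonneg_left hE2 (by positivity)
      _ = _ := by field_simp
  have e1 := mul_le_mul_of_nonneg_left hΦ hl.le
  have e2 := mul_le_mul_of_nonneg_left hMu (inv_nonneg.2 hl.le)
  have e3 := mul_le_mul_of_nonneg_left (add_le_add e1 e2) (by positivity : 0 ≤ ρ' / 2)
  refine e3.trans ?_
  rw [mul_add]
  refine (add_le_add key1 key2).trans ?_
  have e4 : 3 * (i + 3) * (A * C * (2 * R + 1)) ^ 2 * E * (4 * h ^ 2) =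
      12 * (i + 3) * (A * C) ^ 2 * h * (2 * R + 1) * ρ * E := by
    rw [← hhD]
    ring
  rw [e4]
  have e5 : 0 ≤ (A * C) ^ 2 * h * ρ * E := by positivity
  have e6 : 2 * ((i : ℝ) + 2) ≤ 4 * (i + 3) * (2 * R + 1) := by nlinarith
  have e7 := mul_le_mul_of_nonneg_right e6 e5
  calc _ = 2 * ((i : ℝ) + 2) * ((A * C) ^ 2 * h * ρ * E) +
        8 * (i + 3) * (2 * R + 1) * ((A * C) ^ 2 * h * ρ * E) := by ring
    _ ≤ 4 * ((i : ℝ) + 3) * (2 * R + 1) * ((A * C) ^ 2 * h * ρ * E) +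
        8 * (i + 3) * (2 * R + 1) * ((A * C) ^ 2 * h * ρ * E) := by linarith
    _ = _ := by ring

/-- The radial estimate: with high probability all tubes through a `μ`-point and a `ν`-point have
`ν`-mass comparable to their width. -/
theorem radial_bound {s t : ℝ} (hs : s ≤ 1) (ht : t ≤ 2) (hst : 2 < s + t) {C R c₀ : ℝ}
    (hR : 0 ≤ R) (hc₀ : 0 < c₀) {m : ℕ} (hm : 1 ≤ m) :
    ∃ T₀ : ℝ, ∀ T ≥ T₀, ∀ (X Y : Finset (ℝ × ℝ)) (μ ν : ℝ × ℝ → ℝ),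
      IsFrostman X μ C s T m → IsFrostman Y ν C t T m →
      (∀ x ∈ X, |x.1| ≤ R ∧ |x.2| ≤ R) → (∀ y ∈ Y, |y.1| ≤ R ∧ |y.2| ≤ R) →
      (∀ x ∈ X, ∀ y ∈ Y, c₀ ≤ |x.1 - y.1|) →
      ∑ b ∈ X ×ˢ Y with ∃ j ≤ m, exp2 (-(T * (j - (16 / (s + t - 2) + 2)))) <
        tubeMass Y ν (exp2 (-(j * T))) b.1 b.2, μ b.1 * ν b.2 ≤ exp2 (-T) := by
  set η := (s + t) / 2 - 1 with hη
  have hη0 : 0 < η := by linarith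
  have hη8 : 16 / (s + t - 2) = 8 / η := by
    rw [hη]
    field_simp
    ring
  set A := 2 * R / c₀ + 2 with hAdef
  have hA1 : 1 ≤ A := by
    have : 0 ≤ 2 * R / c₀ := by positivity
    linarith
  obtain ⟨T₁, hT₁⟩ := exists_le_exp2 (m * (3 * (m + 3) * (A * C * (2 * R + 1)) ^ 2))
  obtain ⟨T₂, hT₂⟩ := exists_le_exp2 C
  refine ⟨max (max T₁ T₂) (3 * m), fun T hT X Y μ ν hμ hν hX hY hsep => ?_⟩
  rw [ge_iff_le, max_le_iff, max_le_iff] at hT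
  obtain ⟨⟨hTT₁, hTT₂⟩, hTm⟩ := hT
  have hm' : (1 : ℝ) ≤ m := by exact_mod_cast hm
  have hT2 : 2 ≤ T := by linarith
  have hC : 0 ≤ C := (Finset.sum_nonneg fun q _ => hμ.nonneg q).trans hμ.total
  set M : ℕ → ℝ := fun j => exp2 (T * (8 / η + 1 + j / m)) with hM
  set B : ℕ → Finset ((ℝ × ℝ) × (ℝ × ℝ)) := fun i => {b ∈ X ×ˢ Y |
    exp2 (-((i + 1) * T)) * M (i + 1) ≤ tubeMass Y ν (exp2 (-((i + 1) * T))) b.1 b.2 ∧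
    tubeMass Y ν (exp2 (-(i * T))) b.1 b.2 ≤ exp2 (-(i * T)) * M i} with hB
  have hslope : ∀ x ∈ X, ∀ y ∈ Y, |lineSlope x y| + 2 ≤ A := by
    intro x hx y hy
    have h1 : |y.2 - x.2| ≤ 2 * R := by
      have := abs_sub y.2 x.2
      linarith [(hX x hx).2, (hY y hy).2]
    have h2 := hsep x hx y hy
    rw [abs_sub_comm] at h2
    rw [hAdef, lineSlope, abs_div]
    have := div_le_div₀ (by positivity : 0 ≤ 2 * R) h1 hc₀ h2
    linarith
  have hne : ∀ x ∈ X, ∀ y ∈ Y, x.1 ≠ y.1 := by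
    intro x hx y hy h
    have h2 := hsep x hx y hy
    rw [h, sub_self, abs_zero] at h2
    linarith
  have hMstep : ∀ i, M i ≤ M (i + 1) / 8 := by
    intro i
    have e1 : exp2 3 = 8 := by
      have := exp2_natCast 3
      norm_num at this
      exact this
    rw [le_div_iff₀ (by norm_num), ← e1, hM]
    simp only
    rw [← exp2_add]
    apply exp2_le
    push_cast
    have : 3 ≤ T * (1 / m) := by
      rw [mul_one_div, le_div_iff₀ (by linarith)]
      exact hTm
    have e2 : T * (8 / η + 1 + (i + 1) / m) = T * (8 / η + 1 + i / m) + T * (1 / m) := by ring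
    linarith
  have hBle : ∀ i, i + 1 ≤ m → 8 ≤ (i + 1) * η → ∑ b ∈ B i, μ b.1 * ν b.2 ≤
      3 * (m + 3) * (A * C * (2 * R + 1)) ^ 2 * exp2 (-3 * T) := by
    intro i him hi8
    have hsub : B i ⊆ X ×ˢ Y := Finset.filter_subset _ _
    have := level_bad_le (M := M (i + 1)) (A := A) (B := B i) (hμ.mono him)
      (hν.mono (by omega)) hs ht hT2 hR (exp2_pos _) hA1 (fun x hx => (hX x hx).1)
      (fun y hy => (hY y hy).1) hsub
      (fun b hb => hne _ (Finset.mem_product.1 (hsub hb)).1 _ (Finset.mem_product.1 (hsub hb)).2)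
      (fun b hb => hslope _ (Finset.mem_product.1 (hsub hb)).1 _
        (Finset.mem_product.1 (hsub hb)).2)
      (fun b hb => (Finset.mem_filter.1 hb).2.1)
      (fun b hb => (Finset.mem_filter.1 hb).2.2.trans
        (mul_le_mul_of_nonneg_left (hMstep i) (exp2_pos _).le))
    refine this.trans (mul_le_mul ?_ (exp2_le ?_) (exp2_pos _).le (by positivity))
    · refine mul_le_mul_of_nonneg_right ?_ (sq_nonneg _)
      have : (i : ℝ) + 1 ≤ m := by exact_mod_cast him
      linarith
    · rw [← hη]
      have := mul_le_mul_of_nonneg_left hi8 (by linarith : 0 ≤ T)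
      linarith
  set S := (Finset.range m).filter fun i : ℕ => 8 ≤ (i + 1) * η with hS
  have hcover : {b ∈ X ×ˢ Y | ∃ j ≤ m, exp2 (-(T * (j - (16 / (s + t - 2) + 2)))) <
      tubeMass Y ν (exp2 (-(j * T))) b.1 b.2} ⊆ S.biUnion B := by
    intro b hb
    obtain ⟨hbXY, j, hjm, hj⟩ := Finset.mem_filter.1 hb
    have hex : ∃ j : ℕ, exp2 (-(j * T)) * M j < tubeMass Y ν (exp2 (-(j * T))) b.1 b.2 := by
      refine ⟨j, lt_of_le_of_lt ?_ hj⟩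
      rw [hM, ← exp2_add, hη8]
      apply exp2_le
      have : (j : ℝ) / m ≤ 1 := div_le_one_of_le₀ (by exact_mod_cast hjm) (by linarith)
      nlinarith
    classical
    have h1 := Nat.find_spec hex
    have h2 : Nat.find hex ≤ j := by
      refine Nat.find_min' hex (lt_of_le_of_lt ?_ hj)
      rw [hM, ← exp2_add, hη8]
      apply exp2_le
      have : (j : ℝ) / m ≤ 1 := div_le_one_of_le₀ (by exact_mod_cast hjm) (by linarith)
      nlinarith
    have h3 := fun k (hk : k < Nat.find hex) => Nat.find_min hex hk
    generalize Nat.find hex = n at h1 h2 h3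
    have hn8 : 8 ≤ n * η := by
      by_contra hcon
      have hlt : (n : ℝ) < 8 / η := by
        rw [lt_div_iff₀ hη0]
        exact not_le.1 hcon
      have e1 : tubeMass Y ν (exp2 (-(n * T))) b.1 b.2 ≤ C := by
        refine le_trans (Finset.sum_le_sum fun p _ => ?_) hν.total
        exact mul_le_of_le_one_right (hν.nonneg p) (box_le_one _ _)
      have e2 : exp2 T ≤ exp2 (-(n * T)) * M n := by
        rw [hM, ← exp2_add]
        apply exp2_le
        have : 0 ≤ (n : ℝ) / m := by positivity
        nlinarith
      linarith [hT₂ T hTT₂]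
    cases n with
    | zero => simp at hn8; linarith
    | succ i =>
      rw [Finset.mem_biUnion]
      push_cast at hn8 h1
      refine ⟨i, Finset.mem_filter.2 ⟨Finset.mem_range.2 (by omega), hn8⟩,
        Finset.mem_filter.2 ⟨hbXY, h1.le, not_lt.1 (h3 i (by omega))⟩⟩
  have hnn : ∀ b : (ℝ × ℝ) × (ℝ × ℝ), 0 ≤ μ b.1 * ν b.2 := fun b =>
    mul_nonneg (hμ.nonneg _) (hν.nonneg _)
  calc _ ≤ ∑ b ∈ S.biUnion B, μ b.1 * ν b.2 :=
        Finset.sum_le_sum_of_subset_of_nonneg hcover fun b _ _ => hnn b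
    _ ≤ ∑ i ∈ S, ∑ b ∈ B i, μ b.1 * ν b.2 := sum_biUnion_le_of_nonneg _ _ hnn
    _ ≤ ∑ _i ∈ S, 3 * (m + 3) * (A * C * (2 * R + 1)) ^ 2 * exp2 (-3 * T) :=
        Finset.sum_le_sum fun i hi => by
          obtain ⟨hi1, hi2⟩ := Finset.mem_filter.1 hi
          exact hBle i (Finset.mem_range.1 hi1) hi2
    _ ≤ m * (3 * (m + 3) * (A * C * (2 * R + 1)) ^ 2 * exp2 (-3 * T)) := by
        rw [Finset.sum_const, nsmul_eq_mul]
        refine mul_le_mul_of_nonneg_right ?_ (mul_nonneg (by positivity) (exp2_pos _).le)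
        exact_mod_cast (Finset.card_filter_le _ _).trans (Finset.card_range m).le
    _ ≤ exp2 T * exp2 (-3 * T) := by
        rw [← mul_assoc]
        exact mul_le_mul_of_nonneg_right (hT₁ T hTT₁) (exp2_pos _).le
    _ ≤ exp2 (-T) := by
        rw [← exp2_add]
        apply exp2_le
        linarith

/-- The Euclidean distance on `ℝ × ℝ`. -/
noncomputable def planeDist (x y : ℝ × ℝ) : ℝ := √((x.1 - y.1) ^ 2 + (x.2 - y.2) ^ 2)

theorem planeDist_eq_norm (x y : ℝ × ℝ) :
    planeDist x y = ‖(⟨x.1 - y.1, x.2 - y.2⟩ : ℂ)‖ := by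
  rw [Complex.norm_eq_sqrt_sq_add_sq, planeDist]

theorem planeDist_nonneg (x y : ℝ × ℝ) : 0 ≤ planeDist x y := Real.sqrt_nonneg _

theorem planeDist_sq (x y : ℝ × ℝ) :
    planeDist x y ^ 2 = (x.1 - y.1) ^ 2 + (x.2 - y.2) ^ 2 :=
  Real.sq_sqrt (by positivity)

theorem planeDist_le {x y : ℝ × ℝ} {R : ℝ} (hx : |x.1| ≤ R ∧ |x.2| ≤ R)
    (hy : |y.1| ≤ R ∧ |y.2| ≤ R) : planeDist x y ≤ 4 * R := by
  rw [planeDist_eq_norm]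
  refine (Complex.norm_le_abs_re_add_abs_im _).trans ?_
  have h1 := abs_sub x.1 y.1
  have h2 := abs_sub x.2 y.2
  simp only
  linarith [hx.1, hx.2, hy.1, hy.2]

theorem abs_fst_sub_le_dist (x y : ℝ × ℝ) : |x.1 - y.1| ≤ dist x y := by
  rw [Prod.dist_eq, ← Real.dist_eq]
  exact le_max_left _ _

theorem abs_snd_sub_le_dist (x y : ℝ × ℝ) : |x.2 - y.2| ≤ dist x y := by
  rw [Prod.dist_eq, ← Real.dist_eq x.2]
  exact le_max_right _ _

theorem abs_planeDist_sub_le (x x' y : ℝ × ℝ) :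
    |planeDist x y - planeDist x' y| ≤ 2 * dist x x' := by
  rw [planeDist_eq_norm, planeDist_eq_norm]
  refine (abs_norm_sub_norm_le _ _).trans ((Complex.norm_le_abs_re_add_abs_im _).trans ?_)
  simp only [Complex.sub_re, Complex.sub_im, sub_sub_sub_cancel_right]
  linarith [abs_fst_sub_le_dist x x', abs_snd_sub_le_dist x x']

/-- If `x, x'` are nearly equidistant from `y`, then `y - x` is nearly orthogonal to `x' - x`. -/
theorem abs_inner_le_of_planeDist {x x' y : ℝ × ℝ} {R ρ : ℝ} (hx : |x.1| ≤ R ∧ |x.2| ≤ R)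
    (hx' : |x'.1| ≤ R ∧ |x'.2| ≤ R) (hy : |y.1| ≤ R ∧ |y.2| ≤ R)
    (hd : dist x x' ^ 2 ≤ 16 * ρ) (h : |planeDist x y - planeDist x' y| ≤ 4 * ρ) :
    |(y.1 - x.1) * (x'.1 - x.1) + (y.2 - x.2) * (x'.2 - x.2)| ≤ 16 * (1 + R) * ρ := by
  have e1 := planeDist_sq x y
  have e2 := planeDist_sq x' y
  have h1 := sq_le_sq' (by linarith [abs_nonneg (x.1 - x'.1), @dist_nonneg _ _ x x'])
    (abs_fst_sub_le_dist x x')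
  have h2 := sq_le_sq' (by linarith [abs_nonneg (x.2 - x'.2), @dist_nonneg _ _ x x'])
    (abs_snd_sub_le_dist x x')
  rw [sq_abs] at h1 h2
  have b1 := planeDist_le hx hy
  have b2 := planeDist_le hx' hy
  have n1 := planeDist_nonneg x y
  have n2 := planeDist_nonneg x' y
  have h3 : |(planeDist x y - planeDist x' y) * (planeDist x y + planeDist x' y)| ≤
      4 * ρ * (8 * R) := by
    rw [abs_mul]
    refine mul_le_mul h ?_ (abs_nonneg _) ((abs_nonneg _).trans h)
    rw [abs_of_nonneg (by linarith)]
    linarith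
  have e3 : (y.1 - x.1) * (x'.1 - x.1) + (y.2 - x.2) * (x'.2 - x.2) =
      (((x.1 - x'.1) ^ 2 + (x.2 - x'.2) ^ 2) +
        (planeDist x y - planeDist x' y) * (planeDist x y + planeDist x' y)) / 2 := by
    have : (planeDist x y - planeDist x' y) * (planeDist x y + planeDist x' y) =
      planeDist x y ^ 2 - planeDist x' y ^ 2 := by ring
    rw [this, e1, e2]
    ring
  rw [abs_le] at h3
  rw [e3, abs_le]
  have := sq_nonneg (x.1 - x'.1)
  have := sq_nonneg (x.2 - x'.2)
  constructor <;> linarith [h3.1, h3.2]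

/-- All `y` nearly equidistant from `x` and `x'` lie in a thin tube through `x`. -/
theorem abs_sub_lineSlope_le {x x' y y₀ : ℝ × ℝ} {R ρ c₀ : ℝ} (hc₀ : 0 < c₀)
    (hx : |x.1| ≤ R ∧ |x.2| ≤ R)
    (hx' : |x'.1| ≤ R ∧ |x'.2| ≤ R) (hy : |y.1| ≤ R ∧ |y.2| ≤ R) (hy₀ : |y₀.1| ≤ R ∧ |y₀.2| ≤ R)
    (hsep : c₀ ≤ |x.1 - y₀.1|) (hd : dist x x' ^ 2 ≤ 16 * ρ)
    (h : |planeDist x y - planeDist x' y| ≤ 4 * ρ)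
    (h₀ : |planeDist x y₀ - planeDist x' y₀| ≤ 4 * ρ) :
    dist x x' * |y.2 - x.2 - lineSlope x y₀ * (y.1 - x.1)| ≤ 64 * R * (1 + R) / c₀ * ρ := by
  have hR : 0 ≤ R := (abs_nonneg _).trans hx.1
  have i1 := abs_inner_le_of_planeDist hx hx' hy hd h
  have i2 := abs_inner_le_of_planeDist hx hx' hy₀ hd h₀
  set ε := 16 * (1 + R) * ρ with hε
  set p1 := y.1 - x.1 with hp1
  set p2 := y.2 - x.2 with hp2
  set q1 := y₀.1 - x.1 with hq1
  set q2 := y₀.2 - x.2 with hq2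
  set v1 := x'.1 - x.1 with hv1
  set v2 := x'.2 - x.2 with hv2
  have hε0 : 0 ≤ ε := (abs_nonneg _).trans i1
  have B : ∀ a b : ℝ, |a| ≤ R → |b| ≤ R → |a - b| ≤ 2 * R := fun a b ha hb =>
    (abs_sub a b).trans (by linarith)
  have hp1R : |p1| ≤ 2 * R := B _ _ hy.1 hx.1
  have hp2R : |p2| ≤ 2 * R := B _ _ hy.2 hx.2
  have hq1R : |q1| ≤ 2 * R := B _ _ hy₀.1 hx.1
  have hq2R : |q2| ≤ 2 * R := B _ _ hy₀.2 hx.2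
  have hq1c : c₀ ≤ |q1| := by rwa [hq1, abs_sub_comm]
  have hq10 : q1 ≠ 0 := fun h => by rw [h, abs_zero] at hq1c; linarith
  have M : ∀ a b : ℝ, |a| ≤ 2 * R → |b| ≤ ε → |a * b| ≤ 2 * R * ε := fun a b ha hb => by
    rw [abs_mul]
    exact mul_le_mul ha hb (abs_nonneg _) (by linarith)
  have d2 : |(p2 * q1 - q2 * p1) * v2| ≤ 4 * R * ε := by
    have : (p2 * q1 - q2 * p1) * v2 = q1 * (p1 * v1 + p2 * v2) - p1 * (q1 * v1 + q2 * v2) := by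
      ring
    rw [this]
    refine (abs_sub _ _).trans ?_
    linarith [M _ _ hq1R i1, M _ _ hp1R i2]
  have d1 : |(p2 * q1 - q2 * p1) * v1| ≤ 4 * R * ε := by
    have : (p2 * q1 - q2 * p1) * v1 = p2 * (q1 * v1 + q2 * v2) - q2 * (p1 * v1 + p2 * v2) := by
      ring
    rw [this]
    refine (abs_sub _ _).trans ?_
    linarith [M _ _ hp2R i2, M _ _ hq2R i1]
  have d : dist x x' * |p2 * q1 - q2 * p1| ≤ 4 * R * ε := by
    rw [abs_mul] at d1 d2
    rw [Prod.dist_eq, Real.dist_eq, Real.dist_eq, abs_sub_comm x.1, abs_sub_comm x.2, mul_comm]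
    rcases max_choice |x'.1 - x.1| |x'.2 - x.2| with h | h <;> rw [h]
    · exact d1
    · exact d2
  have e : p2 - lineSlope x y₀ * p1 = (p2 * q1 - q2 * p1) / q1 := by
    rw [lineSlope, ← hq1, ← hq2]
    field_simp
  rw [e, abs_div, ← mul_div_assoc]
  refine (div_le_div₀ (by positivity) d hc₀ hq1c).trans (le_of_eq ?_)
  rw [hε]
  ring

/-- The `μ`-mass of the closed ball of radius `2 ^ (-j T)`. -/
noncomputable def ballMass (X : Finset (ℝ × ℝ)) (μ : ℝ × ℝ → ℝ) (T : ℝ) (x : ℝ × ℝ) (j : ℕ) : ℝ :=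
  ∑ q ∈ X with dist x q ≤ exp2 (-(j * T)), μ q

/-- The `μ`-mass of the part of an annulus centred at `y` which is close to `x`. -/
noncomputable def arcMass (X : Finset (ℝ × ℝ)) (μ : ℝ × ℝ → ℝ) (T : ℝ) (x y : ℝ × ℝ)
    (a b : ℕ) : ℝ :=
  ∑ q ∈ X with dist x q ≤ 4 * exp2 (-(a * T)) ∧
    |planeDist x y - planeDist q y| ≤ 4 * exp2 (-(b * T)), μ q

/-- A weighted sum of the ball masses at the scales between `a - 1` and `b`. -/
noncomputable def scaleMass (X : Finset (ℝ × ℝ)) (μ : ℝ × ℝ → ℝ) (T : ℝ) (x : ℝ × ℝ)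
    (a b : ℕ) : ℝ :=
  ∑ j ∈ Finset.Icc (a - 1) b, ballMass X μ T x j * exp2 (-((b - j) * T))

theorem ballMass_nonneg {X : Finset (ℝ × ℝ)} {μ : ℝ × ℝ → ℝ} (hμ : ∀ p, 0 ≤ μ p) (T : ℝ)
    (x : ℝ × ℝ) (j : ℕ) : 0 ≤ ballMass X μ T x j :=
  Finset.sum_nonneg fun q _ => hμ q

theorem le_ballMass {X : Finset (ℝ × ℝ)} {μ : ℝ × ℝ → ℝ} (hμ : ∀ p, 0 ≤ μ p) (T : ℝ)
    {x : ℝ × ℝ} (hx : x ∈ X) (j : ℕ) : μ x ≤ ballMass X μ T x j :=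
  Finset.single_le_sum (f := μ) (fun q _ => hμ q)
    (Finset.mem_filter.2 ⟨hx, by rw [dist_self]; exact (exp2_pos _).le⟩)

theorem ballMass_anti {X : Finset (ℝ × ℝ)} {μ : ℝ × ℝ → ℝ} (hμ : ∀ p, 0 ≤ μ p) {T : ℝ}
    (hT : 0 ≤ T) (x : ℝ × ℝ) {j k : ℕ} (hjk : j ≤ k) :
    ballMass X μ T x k ≤ ballMass X μ T x j := by
  refine Finset.sum_le_sum_of_subset_of_nonneg (fun q hq => ?_) fun q _ _ => hμ q
  obtain ⟨h1, h2⟩ := Finset.mem_filter.1 hq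
  refine Finset.mem_filter.2 ⟨h1, h2.trans (exp2_le ?_)⟩
  have : (j : ℝ) * T ≤ k * T := mul_le_mul_of_nonneg_right (by exact_mod_cast hjk) hT
  linarith

/-- For a fixed pair `x, x'`, few `y` are nearly equidistant from both. -/
theorem sum_equidistant_le {Y : Finset (ℝ × ℝ)} {ν : ℝ × ℝ → ℝ} (hν : ∀ p, 0 ≤ ν p)
    {C R c₀ T A : ℝ} (hT : 2 ≤ T) (hA : 0 ≤ A) (hc₀ : 0 < c₀) (hC : ∑ y ∈ Y, ν y ≤ C)
    (hCT : C ≤ exp2 T) (hKT : 64 * R * (1 + R) / c₀ ≤ exp2 T)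
    {x x' : ℝ × ℝ} (hx : |x.1| ≤ R ∧ |x.2| ≤ R) (hx' : |x'.1| ≤ R ∧ |x'.2| ≤ R)
    (hY : ∀ y ∈ Y, |y.1| ≤ R ∧ |y.2| ≤ R) (hsep : ∀ y ∈ Y, c₀ ≤ |x.1 - y.1|)
    {m a b : ℕ} (ha : 1 ≤ a) (hab : a < b) (hba : b ≤ 2 * a) (hbm : b ≤ m)
    (hd : dist x x' ≤ 4 * exp2 (-(a * T))) {S : Finset (ℝ × ℝ)} (hSY : S ⊆ Y)
    (hS : ∀ y ∈ S, ∀ j ≤ m, tubeMass Y ν (exp2 (-(j * T))) x y ≤ exp2 (-(T * (j - A))))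
    (hSd : ∀ y ∈ S, |planeDist x y - planeDist x' y| ≤ 4 * exp2 (-(b * T))) :
    ∑ y ∈ S, ν y ≤ exp2 (T * (A + 3)) * ∑ j ∈ Finset.Icc (a - 1) b,
      (if dist x x' ≤ exp2 (-(j * T)) then exp2 (-((b - j) * T)) else 0) := by
  have h4 : 4 ≤ exp2 T := by
    have e3 : exp2 2 = 4 := by
      have := exp2_natCast 2
      norm_num at this
      exact this
    rw [← e3]
    exact exp2_le hT
  have hex : ∃ j ∈ Finset.Icc (a - 1) b, dist x x' ≤ exp2 (-(j * T)) ∧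
      ∀ k ∈ Finset.Icc (a - 1) b, dist x x' ≤ exp2 (-(k * T)) → k ≤ j := by
    have hne : ((Finset.Icc (a - 1) b).filter
        fun j : ℕ => dist x x' ≤ exp2 (-(j * T))).Nonempty := by
      refine ⟨a - 1, Finset.mem_filter.2 ⟨Finset.mem_Icc.2 ⟨le_rfl, by omega⟩, hd.trans ?_⟩⟩
      refine (mul_le_mul_of_nonneg_right h4 (exp2_pos _).le).trans ?_
      rw [← exp2_add]
      apply exp2_le
      push_cast [Nat.cast_sub ha]
      linarith
    obtain ⟨j, hj, hmax⟩ := Finset.exists_max_image _ id hne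
    exact ⟨j, (Finset.mem_filter.1 hj).1, (Finset.mem_filter.1 hj).2,
      fun k hk hkd => hmax k (Finset.mem_filter.2 ⟨hk, hkd⟩)⟩
  obtain ⟨j, hj, hjd, hmax⟩ := hex
  have hjab := Finset.mem_Icc.1 hj
  have hle : exp2 (-((b - j) * T)) ≤ ∑ j ∈ Finset.Icc (a - 1) b,
      (if dist x x' ≤ exp2 (-(j * T)) then exp2 (-((b - j) * T)) else 0) := by
    refine le_trans (le_of_eq ?_) (Finset.single_le_sum
      (f := fun j : ℕ => if dist x x' ≤ exp2 (-(j * T)) then exp2 (-((b - j) * T)) else 0)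
      (fun i _ => ?_) hj)
    · simp only [if_pos hjd]
    · split_ifs
      · exact (exp2_pos _).le
      · exact le_rfl
  refine le_trans ?_ (mul_le_mul_of_nonneg_left hle (exp2_pos _).le)
  rw [← exp2_add]
  rcases le_or_gt b (j + 2) with hbj | hbj
  · have h1 : ∑ y ∈ S, ν y ≤ exp2 T :=
      ((Finset.sum_le_sum_of_subset_of_nonneg hSY fun q _ _ => hν q).trans hC).trans hCT
    refine h1.trans (exp2_le ?_)
    have : (b : ℝ) ≤ j + 2 := by exact_mod_cast hbj
    nlinarith
  · rcases S.eq_empty_or_nonempty with rfl | ⟨y₀, hy₀⟩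
    · rw [Finset.sum_empty]
      exact (exp2_pos _).le
    have hfar : exp2 (-((j + 1 : ℕ) * T)) < dist x x' := by
      by_contra hcon
      have := hmax (j + 1) (Finset.mem_Icc.2 ⟨by omega, by omega⟩) (not_lt.1 hcon)
      omega
    have htube := hS y₀ hy₀ (b - j - 2) (by omega)
    have hcast : ((b - j - 2 : ℕ) : ℝ) = b - j - 2 := by
      rw [Nat.cast_sub (by omega), Nat.cast_sub (by omega)]
      norm_num
    rw [hcast] at htube
    have hsq : dist x x' ^ 2 ≤ 16 * exp2 (-(b * T)) := by
      have e1 := pow_le_pow_left₀ dist_nonneg hd 2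
      rw [mul_pow, ← exp2_mul_natCast] at e1
      refine e1.trans ?_
      have e2 : exp2 (-(a * T) * (2 : ℕ)) ≤ exp2 (-(b * T)) := by
        apply exp2_le
        have : (b : ℝ) ≤ 2 * a := by exact_mod_cast hba
        push_cast
        nlinarith
      linarith
    refine le_trans ?_ (htube.trans (exp2_le ?_))
    · calc ∑ y ∈ S, ν y
          ≤ ∑ y ∈ S, ν y * box (exp2 (-((b - j - 2) * T)))
              (y.2 - x.2 - lineSlope x y₀ * (y.1 - x.1)) := by
            refine Finset.sum_le_sum fun y hy => ?_
            rw [box_of_le, mul_one]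
            have h1 := abs_sub_lineSlope_le hc₀ hx hx' (hY y (hSY hy)) (hY y₀ (hSY hy₀))
              (hsep y₀ (hSY hy₀)) hsq (hSd y hy) (hSd y₀ hy₀)
            have h2 : exp2 (-((j + 1 : ℕ) * T)) *
                |y.2 - x.2 - lineSlope x y₀ * (y.1 - x.1)| ≤ exp2 T * exp2 (-(b * T)) :=
              ((mul_le_mul_of_nonneg_right hfar.le (abs_nonneg _)).trans h1).trans
                (mul_le_mul_of_nonneg_right hKT (exp2_pos _).le)
            refine le_of_mul_le_mul_left (h2.trans (le_of_eq ?_)) (exp2_pos (-((j + 1 : ℕ) * T)))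
            rw [← exp2_add, ← exp2_add]
            congr 1
            push_cast
            ring
        _ ≤ _ := Finset.sum_le_sum_of_subset_of_nonneg hSY fun p _ _ =>
            mul_nonneg (hν p) (box_nonneg _ _)
    · nlinarith

/-- The index of the half-open square of side `r` containing a point. -/
noncomputable def cell (r : ℝ) (x : ℝ × ℝ) : ℤ × ℤ := (⌊x.1 / r⌋, ⌊x.2 / r⌋)

theorem abs_sub_le_of_floor_div_eq {r a b : ℝ} (hr : 0 < r) (h : ⌊a / r⌋ = ⌊b / r⌋) :
    |a - b| ≤ r := by
  have := (Int.abs_sub_lt_one_of_floor_eq_floor h).le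
  rwa [← sub_div, abs_div, abs_of_pos hr, div_le_one hr] at this

theorem dist_le_of_cell_eq {r : ℝ} (hr : 0 < r) {x y : ℝ × ℝ} (h : cell r x = cell r y) :
    dist x y ≤ r := by
  rw [cell, cell, Prod.mk.injEq] at h
  rw [Prod.dist_eq]
  exact max_le (abs_sub_le_of_floor_div_eq hr h.1) (abs_sub_le_of_floor_div_eq hr h.2)

theorem exists_cell_reps {r : ℝ} (hr : 0 < r) (S : Finset (ℝ × ℝ)) :
    ∃ W ⊆ S, Set.InjOn (cell r) W ∧ ∀ (X : Finset (ℝ × ℝ)) (μ : ℝ × ℝ → ℝ), (∀ p, 0 ≤ μ p) →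
      S ⊆ X → ∑ x ∈ S, μ x ≤ ∑ w ∈ W, ∑ q ∈ X with dist w q ≤ r, μ q := by
  classical
  obtain ⟨W, hWS, hW1, hW2⟩ : ∃ W ⊆ S, Set.InjOn (cell r) W ∧ W.image (cell r) =
      S.image (cell r) := by
    have h := (Set.surjOn_image (cell r) (S : Set (ℝ × ℝ))).exists_bijOn_subset
    obtain ⟨W, hW, hb⟩ := h
    have hfin : W.Finite := S.finite_toSet.subset hW
    refine ⟨hfin.toFinset, fun x hx => hW (hfin.mem_toFinset.1 hx), ?_, ?_⟩
    · rw [hfin.coe_toFinset]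
      exact hb.injOn
    · apply Finset.coe_injective
      rw [Finset.coe_image, Finset.coe_image, hfin.coe_toFinset]
      exact hb.image_eq
  refine ⟨W, hWS, hW1, fun X μ hμ hSX => ?_⟩
  refine le_trans (Finset.sum_le_sum_of_subset_of_nonneg
    (t := W.biUnion fun w => X.filter fun q => dist w q ≤ r) ?_ fun q _ _ => hμ q)
    (sum_biUnion_le_of_nonneg W _ hμ)
  intro x hx
  have : cell r x ∈ W.image (cell r) := hW2 ▸ Finset.mem_image_of_mem _ hx
  obtain ⟨w, hw, hwx⟩ := Finset.mem_image.1 this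
  exact Finset.mem_biUnion.2 ⟨w, hw, Finset.mem_filter.2 ⟨hSX hx, dist_le_of_cell_eq hr hwx⟩⟩

theorem card_Icc_floor_le {r ρ a : ℝ} (hr : 0 < r) (hρ : r ≤ ρ) :
    ((Finset.Icc ⌊(a - ρ) / r⌋ ⌊(a + ρ) / r⌋).card : ℝ) ≤ 4 * (ρ / r) := by
  have h1 : 1 ≤ ρ / r := (one_le_div hr).2 hρ
  have e : (a + ρ) / r - (a - ρ) / r = 2 * (ρ / r) := by ring
  rw [Int.card_Icc]
  have h2 := Int.floor_le ((a + ρ) / r)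
  have h3 := Int.lt_floor_add_one ((a - ρ) / r)
  rcases le_or_gt 0 (⌊(a + ρ) / r⌋ + 1 - ⌊(a - ρ) / r⌋) with h | h
  · have : (((⌊(a + ρ) / r⌋ + 1 - ⌊(a - ρ) / r⌋).toNat : ℤ) : ℝ) =
        ((⌊(a + ρ) / r⌋ + 1 - ⌊(a - ρ) / r⌋ : ℤ) : ℝ) := by rw [Int.toNat_of_nonneg h]
    rw [Int.cast_natCast] at this
    rw [this]
    push_cast
    linarith
  · rw [Int.toNat_of_nonpos h.le]
    simp only [Nat.cast_zero]
    linarith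

theorem mem_Icc_floor {r ρ a b : ℝ} (hr : 0 < r) (h : |a - b| ≤ ρ) :
    ⌊a / r⌋ ∈ Finset.Icc ⌊(b - ρ) / r⌋ ⌊(b + ρ) / r⌋ := by
  rw [abs_le] at h
  exact Finset.mem_Icc.2 ⟨Int.floor_le_floor (div_le_div_of_nonneg_right (by linarith) hr.le),
    Int.floor_le_floor (div_le_div_of_nonneg_right (by linarith) hr.le)⟩

theorem card_image_cell_le {r ρ : ℝ} (hr : 0 < r) (hρ : r ≤ ρ) (x' : ℝ × ℝ) {W : Finset (ℝ × ℝ)}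
    (hd : ∀ w ∈ W, dist w x' ≤ ρ) : ((W.image (cell r)).card : ℝ) ≤ 16 * (ρ / r) ^ 2 := by
  have hsub : W.image (cell r) ⊆ Finset.Icc ⌊(x'.1 - ρ) / r⌋ ⌊(x'.1 + ρ) / r⌋ ×ˢ
      Finset.Icc ⌊(x'.2 - ρ) / r⌋ ⌊(x'.2 + ρ) / r⌋ := by
    intro q hq
    obtain ⟨w, hw, rfl⟩ := Finset.mem_image.1 hq
    exact Finset.mem_product.2 ⟨mem_Icc_floor hr ((abs_fst_sub_le_dist w x').trans (hd w hw)),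
      mem_Icc_floor hr ((abs_snd_sub_le_dist w x').trans (hd w hw))⟩
  have h1 := Finset.card_le_card hsub
  rw [Finset.card_product] at h1
  have h2 : ((W.image (cell r)).card : ℝ) ≤
      (Finset.Icc ⌊(x'.1 - ρ) / r⌋ ⌊(x'.1 + ρ) / r⌋).card *
        (Finset.Icc ⌊(x'.2 - ρ) / r⌋ ⌊(x'.2 + ρ) / r⌋).card := by exact_mod_cast h1
  refine h2.trans ((mul_le_mul (card_Icc_floor_le hr hρ) (card_Icc_floor_le hr hρ)
    (Nat.cast_nonneg _) ((Nat.cast_nonneg _).trans (card_Icc_floor_le (a := x'.1) hr hρ))).trans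
    (le_of_eq (by ring)))

theorem card_cell_le {r ρ : ℝ} (hr : 0 < r) (hρ : r ≤ ρ) (x' : ℝ × ℝ) {W : Finset (ℝ × ℝ)}
    (hW : Set.InjOn (cell r) W) (hd : ∀ w ∈ W, dist w x' ≤ ρ) :
    (W.card : ℝ) ≤ 16 * (ρ / r) ^ 2 := by
  rw [← Finset.card_image_of_injOn hW]
  exact card_image_cell_le hr hρ x' hd

theorem sum_lightBall_le {X : Finset (ℝ × ℝ)} {μ : ℝ × ℝ → ℝ} (hμ : ∀ p, 0 ≤ μ p) {T u C : ℝ}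
    {j : ℕ}
    (hcell : ((X.image (cell (exp2 (-(j * T))))).card : ℝ) ≤ C * exp2 (u * j * T)) :
    ∑ x ∈ X with ballMass X μ T x j < exp2 (-(T * (u * j + 1))), μ x ≤ C * exp2 (-T) := by
  obtain ⟨W, hWS, hinj, hsum⟩ := exists_cell_reps (exp2_pos (-(j * T)))
    (X.filter fun x => ballMass X μ T x j < exp2 (-(T * (u * j + 1))))
  refine (hsum X μ hμ (Finset.filter_subset _ _)).trans ?_
  have hcard : (W.card : ℝ) ≤ C * exp2 (u * j * T) := by
    refine le_trans ?_ hcell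
    rw [← Finset.card_image_of_injOn hinj]
    exact_mod_cast Finset.card_le_card
      (Finset.image_subset_image (hWS.trans (Finset.filter_subset _ _)))
  calc _ ≤ ∑ w ∈ W, exp2 (-(T * (u * j + 1))) :=
        Finset.sum_le_sum fun w hw => (Finset.mem_filter.1 (hWS hw)).2.le
    _ = W.card * exp2 (-(T * (u * j + 1))) := by rw [Finset.sum_const, nsmul_eq_mul]
    _ ≤ C * exp2 (u * j * T) * exp2 (-(T * (u * j + 1))) :=
        mul_le_mul_of_nonneg_right hcard (exp2_pos _).le
    _ = C * exp2 (-T) := by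
        rw [mul_assoc, ← exp2_add]
        congr 2
        ring

theorem sum_thinBall_le {X : Finset (ℝ × ℝ)} {μ : ℝ × ℝ → ℝ} (hμ : ∀ p, 0 ≤ μ p) {T C : ℝ}
    (hT : 0 ≤ T) (hC : ∑ x ∈ X, μ x ≤ C) {j k : ℕ} (hjk : j ≤ k) :
    ∑ x ∈ X with ballMass X μ T x k < exp2 (-(T * (2 * (k - j) + 1))) * ballMass X μ T x j, μ x ≤
      16 * C * exp2 (-T) := by
  set θ := exp2 (-(T * (2 * (k - j) + 1))) with hθ
  have hθ0 : 0 < θ := exp2_pos _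
  obtain ⟨W, hWS, hinj, hsum⟩ := exists_cell_reps (exp2_pos (-(k * T)))
    (X.filter fun x => ballMass X μ T x k < θ * ballMass X μ T x j)
  refine (hsum X μ hμ (Finset.filter_subset _ _)).trans ?_
  have hle : exp2 (-(k * T)) ≤ exp2 (-(j * T)) := by
    apply exp2_le
    have : (j : ℝ) * T ≤ k * T := mul_le_mul_of_nonneg_right (by exact_mod_cast hjk) hT
    linarith
  calc _ ≤ ∑ w ∈ W, θ * ballMass X μ T w j :=
        Finset.sum_le_sum fun w hw => (Finset.mem_filter.1 (hWS hw)).2.le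
    _ = θ * ∑ q ∈ X, μ q * ((W.filter fun w => dist w q ≤ exp2 (-(j * T))).card : ℝ) := by
        rw [← Finset.mul_sum]
        congr 1
        simp only [ballMass, Finset.sum_filter, Finset.card_filter, Nat.cast_sum, Finset.mul_sum]
        rw [Finset.sum_comm]
        refine Finset.sum_congr rfl fun q _ => Finset.sum_congr rfl fun w _ => ?_
        split_ifs <;> simp
    _ ≤ θ * ∑ q ∈ X, μ q * (16 * (exp2 (-(j * T)) / exp2 (-(k * T))) ^ 2) := by
        refine mul_le_mul_of_nonneg_left (Finset.sum_le_sum fun q _ =>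
          mul_le_mul_of_nonneg_left ?_ (hμ q)) hθ0.le
        exact card_cell_le (exp2_pos _) hle q
          (hinj.mono (by exact_mod_cast Finset.filter_subset _ _))
          fun w hw => (Finset.mem_filter.1 hw).2
    _ = θ * (exp2 (-(j * T)) / exp2 (-(k * T))) ^ 2 * 16 * ∑ q ∈ X, μ q := by
        rw [← Finset.sum_mul]
        ring
    _ ≤ exp2 (-T) * 16 * C := by
        refine mul_le_mul (le_of_eq ?_) hC (Finset.sum_nonneg fun q _ => hμ q)
          (by have := exp2_pos (-T); positivity)
        congr 1
        rw [div_eq_mul_inv, ← exp2_neg, ← exp2_add, ← exp2_mul_natCast, ← exp2_add]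
        congr 1
        push_cast
        ring
    _ = _ := by ring

/-- The Markov-inequality step: for fixed `x`, only few `y` in the complement of the exceptional
set of the radial estimate see too much mass in an arc through `x`. -/
theorem sum_heavyArc_le {X Y : Finset (ℝ × ℝ)} {μ ν : ℝ × ℝ → ℝ} (hμ : ∀ p, 0 ≤ μ p)
    (hν : ∀ p, 0 ≤ ν p)
    {C R c₀ T A : ℝ} (hT : 2 ≤ T) (hA : 0 ≤ A) (hc₀ : 0 < c₀) (hC : ∑ y ∈ Y, ν y ≤ C)
    (hCT : C ≤ exp2 T) (hKT : 64 * R * (1 + R) / c₀ ≤ exp2 T)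
    (hX : ∀ x ∈ X, |x.1| ≤ R ∧ |x.2| ≤ R)
    (hY : ∀ y ∈ Y, |y.1| ≤ R ∧ |y.2| ≤ R) (hsep : ∀ x ∈ X, ∀ y ∈ Y, c₀ ≤ |x.1 - y.1|)
    {m a b : ℕ} (ha : 1 ≤ a) (hab : a < b) (hba : b ≤ 2 * a) (hbm : b ≤ m)
    {x : ℝ × ℝ} (hx : x ∈ X) {S : Finset (ℝ × ℝ)} (hSY : S ⊆ Y)
    (hS : ∀ y ∈ S, ∀ j ≤ m, tubeMass Y ν (exp2 (-(j * T))) x y ≤ exp2 (-(T * (j - A))))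
    (hbig : ∀ y ∈ S, exp2 (T * (A + 4)) * scaleMass X μ T x a b < arcMass X μ T x y a b) :
    μ x * ∑ y ∈ S, ν y ≤ μ x * exp2 (-T) := by
  have h1 : ∑ y ∈ S, ν y * arcMass X μ T x y a b ≤ exp2 (T * (A + 3)) * scaleMass X μ T x a b := by
    calc ∑ y ∈ S, ν y * arcMass X μ T x y a b
        = ∑ q ∈ X with dist x q ≤ 4 * exp2 (-(a * T)), μ q * ∑ y ∈ S with
            |planeDist x y - planeDist q y| ≤ 4 * exp2 (-(b * T)), ν y := by
          simp only [arcMass, Finset.mul_sum, Finset.sum_filter]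
          rw [Finset.sum_comm]
          refine Finset.sum_congr rfl fun q _ => ?_
          split_ifs with h
          · refine Finset.sum_congr rfl fun y _ => ?_
            simp only [h, true_and]
            split_ifs
            · ring
            · simp
          · simp [h]
      _ ≤ ∑ q ∈ X with dist x q ≤ 4 * exp2 (-(a * T)), μ q * (exp2 (T * (A + 3)) *
            ∑ j ∈ Finset.Icc (a - 1) b,
              (if dist x q ≤ exp2 (-(j * T)) then exp2 (-((b - j) * T)) else 0)) := by
          refine Finset.sum_le_sum fun q hq => mul_le_mul_of_nonneg_left ?_ (hμ q)
          obtain ⟨hqX, hqd⟩ := Finset.mem_filter.1 hq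
          exact sum_equidistant_le hν hT hA hc₀ hC hCT hKT (hX x hx) (hX q hqX) hY (hsep x hx)
            ha hab hba hbm hqd ((Finset.filter_subset _ _).trans hSY)
            (fun y hy => hS y (Finset.mem_filter.1 hy).1) fun y hy => (Finset.mem_filter.1 hy).2
      _ ≤ ∑ q ∈ X, μ q * (exp2 (T * (A + 3)) *
            ∑ j ∈ Finset.Icc (a - 1) b,
              (if dist x q ≤ exp2 (-(j * T)) then exp2 (-((b - j) * T)) else 0)) := by
          refine Finset.sum_le_sum_of_subset_of_nonneg (Finset.filter_subset _ _) fun q _ _ => ?_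
          refine mul_nonneg (hμ q) (mul_nonneg (exp2_pos _).le (Finset.sum_nonneg fun j _ => ?_))
          split_ifs
          · exact (exp2_pos _).le
          · exact le_rfl
      _ = _ := by
          simp only [scaleMass, ballMass, Finset.sum_filter, Finset.mul_sum, Finset.sum_mul]
          rw [Finset.sum_comm]
          refine Finset.sum_congr rfl fun j _ => Finset.sum_congr rfl fun q _ => ?_
          split_ifs
          · ring
          · simp
  have h2 : (∑ y ∈ S, ν y) * (exp2 (T * (A + 4)) * scaleMass X μ T x a b) ≤
      ∑ y ∈ S, ν y * arcMass X μ T x y a b := by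
    rw [Finset.sum_mul]
    exact Finset.sum_le_sum fun y hy => mul_le_mul_of_nonneg_left (hbig y hy).le (hν y)
  have h3 := h2.trans h1
  have e : exp2 (T * (A + 4)) = exp2 (T * (A + 3)) * exp2 T := by
    rw [← exp2_add]
    congr 1
    ring
  have hle : μ x ≤ scaleMass X μ T x a b := by
    refine (le_ballMass hμ T hx b).trans ?_
    refine le_trans (le_of_eq ?_) (Finset.single_le_sum
      (f := fun j : ℕ => ballMass X μ T x j * exp2 (-((b - j) * T)))
      (fun i _ => mul_nonneg (ballMass_nonneg hμ T x i) (exp2_pos _).le)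
      (Finset.mem_Icc.2 ⟨by omega, le_rfl⟩))
    simp
  have hS0 : 0 ≤ ∑ y ∈ S, ν y := Finset.sum_nonneg fun y _ => hν y
  rcases (hμ x).eq_or_lt with h0 | h0
  · rw [← h0, zero_mul, zero_mul]
  · refine mul_le_mul_of_nonneg_left ?_ h0.le
    have hH : 0 < scaleMass X μ T x a b := h0.trans_le hle
    have h4 : (∑ y ∈ S, ν y) * exp2 T ≤ 1 := by
      have hP : 0 < exp2 (T * (A + 3)) * scaleMass X μ T x a b := mul_pos (exp2_pos _) hH
      refine le_of_mul_le_mul_right ?_ hP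
      rw [e] at h3
      linarith
    rw [exp2_neg, ← one_div, le_div_iff₀ (exp2_pos _)]
    exact h4

/-- The regularity conditions satisfied by typical pairs of points. -/
def IsGoodPair (X : Finset (ℝ × ℝ)) (μ : ℝ × ℝ → ℝ) (T u A : ℝ) (m : ℕ) (x y : ℝ × ℝ) : Prop :=
  (∀ j ≤ m, exp2 (-(T * (u * j + 1))) ≤ ballMass X μ T x j) ∧
  (∀ j k : ℕ, j ≤ k → k ≤ m →
    exp2 (-(T * (2 * (k - j) + 1))) * ballMass X μ T x j ≤ ballMass X μ T x k) ∧
  ∀ a b : ℕ, 1 ≤ a → a < b → b ≤ 2 * a → b ≤ m →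
    arcMass X μ T x y a b ≤ exp2 (T * A) * scaleMass X μ T x a b

theorem IsFrostman.of_le {X : Finset (ℝ × ℝ)} {μ : ℝ × ℝ → ℝ} {C s s' T : ℝ} {n : ℕ}
    (h : IsFrostman X μ C s T n) (hT : 0 ≤ T) (hs : s' ≤ s) : IsFrostman X μ C s' T n := by
  refine ⟨h.nonneg, h.total, fun p hp i hi => (h.ball p hp i hi).trans
    (mul_le_mul_of_nonneg_left (exp2_le ?_)
      ((Finset.sum_nonneg fun q _ => h.nonneg q).trans h.total))⟩
  have : (i : ℝ) * T * s' ≤ i * T * s := mul_le_mul_of_nonneg_left hs (by positivity)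
  linarith

theorem sum_filter_le_add {ι : Type*} {S : Finset ι} {p q r : ι → Prop} [DecidablePred p]
    [DecidablePred q] [DecidablePred r] {f : ι → ℝ}
    (hf : ∀ b, 0 ≤ f b) (h : ∀ b ∈ S, p b → q b ∨ r b) :
    ∑ b ∈ S with p b, f b ≤ ∑ b ∈ S with q b, f b + ∑ b ∈ S with r b, f b := by
  classical
  rw [← Finset.sum_union_inter]
  refine le_trans (Finset.sum_le_sum_of_subset_of_nonneg (fun b hb => ?_) fun b _ _ => hf b)
    (le_add_of_nonneg_right (Finset.sum_nonneg fun b _ => hf b))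
  obtain ⟨h1, h2⟩ := Finset.mem_filter.1 hb
  rcases h b h1 h2 with h3 | h3
  · exact Finset.mem_union_left _ (Finset.mem_filter.2 ⟨h1, h3⟩)
  · exact Finset.mem_union_right _ (Finset.mem_filter.2 ⟨h1, h3⟩)

theorem sum_product_filter_fst_le {X Y : Finset (ℝ × ℝ)} {μ ν : ℝ × ℝ → ℝ} (hμ : ∀ p, 0 ≤ μ p)
    {C a : ℝ} (hC : ∑ y ∈ Y, ν y ≤ C) (hC0 : 0 ≤ C) (P : ℝ × ℝ → Prop)
    [DecidablePred P]     (h : ∑ x ∈ X with P x, μ x ≤ a) :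
    ∑ b ∈ X ×ˢ Y with P b.1, μ b.1 * ν b.2 ≤ a * C := by
  have : ∑ b ∈ X ×ˢ Y with P b.1, μ b.1 * ν b.2 = (∑ x ∈ X with P x, μ x) * ∑ y ∈ Y, ν y := by
    rw [Finset.sum_filter, Finset.sum_product, Finset.sum_filter, Finset.sum_mul]
    refine Finset.sum_congr rfl fun x _ => ?_
    split_ifs
    · rw [Finset.mul_sum]
    · simp
  rw [this]
  refine (mul_le_mul_of_nonneg_left hC (Finset.sum_nonneg fun x _ => hμ x)).trans
    (mul_le_mul_of_nonneg_right h hC0)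

open Classical in
theorem sum_not_isGoodPair_le {s t u : ℝ} (ht : t ≤ 2) (hst : 2 < min s 1 + t)
    {C R c₀ : ℝ} (hR : 0 ≤ R) (hc₀ : 0 < c₀) {m : ℕ} (hm : 1 ≤ m) :
    ∃ T₀ : ℝ, ∀ T ≥ T₀, ∀ (X Y : Finset (ℝ × ℝ)) (μ ν : ℝ × ℝ → ℝ),
      IsFrostman X μ C s T m → IsFrostman Y ν C t T m →
      (∀ x ∈ X, |x.1| ≤ R ∧ |x.2| ≤ R) → (∀ y ∈ Y, |y.1| ≤ R ∧ |y.2| ≤ R) →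
      (∀ x ∈ X, ∀ y ∈ Y, c₀ ≤ |x.1 - y.1|) →
      (∀ j ≤ m, ((X.image (cell (exp2 (-(j * T))))).card : ℝ) ≤ C * exp2 (u * j * T)) →
      ∑ b ∈ X ×ˢ Y with ¬ IsGoodPair X μ T u (16 / (min s 1 + t - 2) + 6) m b.1 b.2,
        μ b.1 * ν b.2 ≤ exp2 (-(3 / 4 * T)) := by
  obtain ⟨T₁, hT₁⟩ := radial_bound (C := C) (min_le_right s 1) ht hst hR hc₀ hm
  obtain ⟨T₂, hT₂⟩ := exists_le_exp2 C
  obtain ⟨T₃, hT₃⟩ := exists_le_exp2 (64 * R * (1 + R) / c₀)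
  obtain ⟨T₄, hT₄⟩ := exists_le_exp2 (1 + (m + 1) * (C * C) + (m + 1) ^ 2 * (16 * C * C) +
    (m + 1) ^ 2 * C)
  refine ⟨max (max T₁ T₂) (max (max T₃ (4 * T₄)) 2), fun T hT X Y μ ν hμ hν hX hY hsep hcell => ?_⟩
  simp only [ge_iff_le, max_le_iff] at hT
  obtain ⟨⟨hTT₁, hTT₂⟩, ⟨hTT₃, hTT₄⟩, hT2⟩ := hT
  have hC : 0 ≤ C := (Finset.sum_nonneg fun q _ => hμ.nonneg q).trans hμ.total
  have hrad := hT₁ T hTT₁ X Y μ ν (hμ.of_le (by linarith) (min_le_left _ _)) hν hX hY hsep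
  set A := 16 / (min s 1 + t - 2) + 2 with hA
  have hA0 : 0 ≤ A := by
    have : 0 < min s 1 + t - 2 := by linarith
    positivity
  have hA' : 16 / (min s 1 + t - 2) + 6 = A + 4 := by rw [hA]; ring
  rw [hA']
  set Rad : (ℝ × ℝ) × (ℝ × ℝ) → Prop := fun b => ∃ j ≤ m, exp2 (-(T * (j - A))) <
    tubeMass Y ν (exp2 (-(j * T))) b.1 b.2 with hRad
  set I := Finset.range (m + 1) with hI
  have hIcard : (I.card : ℝ) = m + 1 := by rw [hI, Finset.card_range]; push_cast; ring
  set P1 : ℕ → (ℝ × ℝ) × (ℝ × ℝ) → Prop := fun j b =>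
    ballMass X μ T b.1 j < exp2 (-(T * (u * j + 1))) with hP1
  set P2 : ℕ × ℕ → (ℝ × ℝ) × (ℝ × ℝ) → Prop := fun i b => i.1 ≤ i.2 ∧
    ballMass X μ T b.1 i.2 < exp2 (-(T * (2 * (i.2 - i.1) + 1))) * ballMass X μ T b.1 i.1 with hP2
  set P3 : ℕ × ℕ → (ℝ × ℝ) × (ℝ × ℝ) → Prop := fun i b => (1 ≤ i.1 ∧ i.1 < i.2 ∧ i.2 ≤ 2 * i.1) ∧
    ¬ Rad b ∧ exp2 (T * (A + 4)) * scaleMass X μ T b.1 i.1 i.2 < arcMass X μ T b.1 b.2 i.1 i.2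
    with hP3
  have hnn : ∀ b : (ℝ × ℝ) × (ℝ × ℝ), 0 ≤ μ b.1 * ν b.2 := fun b =>
    mul_nonneg (hμ.nonneg _) (hν.nonneg _)
  have k1 : ∀ j ∈ I, ∑ b ∈ X ×ˢ Y with P1 j b, μ b.1 * ν b.2 ≤ C * C * exp2 (-T) := by
    intro j hj
    refine (sum_product_filter_fst_le hμ.nonneg hν.total hC
      (fun x => ballMass X μ T x j < exp2 (-(T * (u * j + 1)))) (sum_lightBall_le hμ.nonneg
        (hcell j (by rw [hI, Finset.mem_range] at hj; omega)))).trans (le_of_eq (by ring))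
  have k2 : ∀ i ∈ I ×ˢ I, ∑ b ∈ X ×ˢ Y with P2 i b, μ b.1 * ν b.2 ≤ 16 * C * C * exp2 (-T) := by
    intro i hi
    by_cases hle : i.1 ≤ i.2
    · refine (sum_product_filter_fst_le (X := X) (a := 16 * C * exp2 (-T)) hμ.nonneg hν.total hC
        (fun x => i.1 ≤ i.2 ∧ ballMass X μ T x i.2 < exp2 (-(T * (2 * (i.2 - i.1) + 1))) *
          ballMass X μ T x i.1) ?_).trans (le_of_eq ?_)
      · simp only [hle, true_and]
        exact sum_thinBall_le hμ.nonneg (by linarith) hμ.total hle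
      · ring
    · simp only [hP2, hle, false_and, Finset.filter_false, Finset.sum_empty]
      exact mul_nonneg (by positivity) (exp2_pos _).le
  have k3 : ∀ i ∈ I ×ˢ I, ∑ b ∈ X ×ˢ Y with P3 i b, μ b.1 * ν b.2 ≤ C * exp2 (-T) := by
    intro i hi
    have him : i.2 ≤ m := by
      have := (Finset.mem_product.1 hi).2
      rw [hI, Finset.mem_range] at this
      omega
    by_cases hle : 1 ≤ i.1 ∧ i.1 < i.2 ∧ i.2 ≤ 2 * i.1
    · calc _ = ∑ x ∈ X, μ x * ∑ y ∈ Y with P3 i (x, y), ν y := by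
            rw [Finset.sum_filter, Finset.sum_product]
            refine Finset.sum_congr rfl fun x _ => ?_
            rw [Finset.sum_filter, Finset.mul_sum]
            refine Finset.sum_congr rfl fun y _ => ?_
            split_ifs
            · rfl
            · simp
        _ ≤ ∑ x ∈ X, μ x * exp2 (-T) := Finset.sum_le_sum fun x hx => by
            refine sum_heavyArc_le hμ.nonneg hν.nonneg hT2 hA0 hc₀ hν.total (hT₂ T hTT₂)
              (hT₃ T hTT₃) hX hY hsep hle.1 hle.2.1 hle.2.2 him hx (Finset.filter_subset _ _)
              (fun y hy j hj => ?_) fun y hy => (Finset.mem_filter.1 hy).2.2.2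
            by_contra hcon
            exact (Finset.mem_filter.1 hy).2.2.1 ⟨j, hj, not_le.1 hcon⟩
        _ ≤ _ := by
            rw [← Finset.sum_mul]
            exact mul_le_mul_of_nonneg_right hμ.total (exp2_pos _).le
    · simp only [hP3, hle, false_and, Finset.filter_false, Finset.sum_empty]
      exact mul_nonneg hC (exp2_pos _).le
  have step : ∀ b ∈ X ×ˢ Y, ¬ IsGoodPair X μ T u (A + 4) m b.1 b.2 →
      Rad b ∨ ((∃ j ∈ I, P1 j b) ∨ ((∃ i ∈ I ×ˢ I, P2 i b) ∨ ∃ i ∈ I ×ˢ I, P3 i b)) := by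
    intro b _ hb
    by_contra hcon
    push Not at hcon
    obtain ⟨c0, c1, c2, c3⟩ := hcon
    have mem : ∀ j ≤ m, j ∈ I := fun j hj => Finset.mem_range.2 (by omega)
    refine hb ⟨fun j hj => not_lt.1 (c1 j (mem j hj)), fun j k hjk hk => ?_,
      fun a b' ha hab hba hbm => ?_⟩
    · exact not_lt.1 fun h => c2 (j, k) (Finset.mem_product.2 ⟨mem j (hjk.trans hk), mem k hk⟩)
        ⟨hjk, h⟩
    · exact not_lt.1 fun h => c3 (a, b') (Finset.mem_product.2 ⟨mem a (by omega), mem b' hbm⟩)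
        ⟨⟨ha, hab, hba⟩, c0, h⟩
  have c1 := sum_filter_exists_le (X ×ˢ Y) I P1 hnn
  have c2 := sum_filter_exists_le (X ×ˢ Y) (I ×ˢ I) P2 hnn
  have c3 := sum_filter_exists_le (X ×ˢ Y) (I ×ˢ I) P3 hnn
  have d1 := c1.trans (Finset.sum_le_sum k1)
  have d2 := c2.trans (Finset.sum_le_sum k2)
  have d3 := c3.trans (Finset.sum_le_sum k3)
  rw [Finset.sum_const, nsmul_eq_mul] at d1 d2 d3
  rw [Finset.card_product, Nat.cast_mul] at d2 d3
  rw [hIcard] at d1 d2 d3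
  have f1 := sum_filter_le_add hnn step
  have f2 := sum_filter_le_add (S := X ×ˢ Y) (p := fun b => (∃ j ∈ I, P1 j b) ∨
    ((∃ i ∈ I ×ˢ I, P2 i b) ∨ ∃ i ∈ I ×ˢ I, P3 i b)) hnn (fun _ _ h => h)
  have f3 := sum_filter_le_add (S := X ×ˢ Y) (p := fun b => (∃ i ∈ I ×ˢ I, P2 i b) ∨
    ∃ i ∈ I ×ˢ I, P3 i b) hnn (fun _ _ h => h)
  have hrad' : ∑ b ∈ X ×ˢ Y with Rad b, μ b.1 * ν b.2 ≤ exp2 (-T) := hrad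
  have tot : ∑ b ∈ X ×ˢ Y with ¬ IsGoodPair X μ T u (A + 4) m b.1 b.2, μ b.1 * ν b.2 ≤
      (1 + (m + 1) * (C * C) + (m + 1) ^ 2 * (16 * C * C) + (m + 1) ^ 2 * C) * exp2 (-T) := by
    refine f1.trans ?_
    linarith
  refine tot.trans ((mul_le_mul_of_nonneg_right (hT₄ (T / 4) (by linarith))
    (exp2_pos _).le).trans (le_of_eq ?_))
  rw [← exp2_add]
  congr 1
  ring

theorem exists_separated_net {α : Type*} [PseudoMetricSpace α] (Z : Finset α) {ρ : ℝ}
    (hρ : 0 ≤ ρ) :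
    ∃ W ⊆ Z, (∀ z ∈ W, ∀ z' ∈ W, z ≠ z' → ρ < dist z z') ∧ ∀ z ∈ Z, ∃ w ∈ W, dist z w ≤ ρ := by
  classical
  induction Z using Finset.induction_on with
  | empty => exact ⟨∅, subset_rfl, by simp, by simp⟩
  | insert a Z ha ih =>
    obtain ⟨W, hWZ, h1, h2⟩ := ih
    by_cases h : ∃ w ∈ W, dist a w ≤ ρ
    · refine ⟨W, hWZ.trans (Finset.subset_insert _ _), h1, fun z hz => ?_⟩
      rcases Finset.mem_insert.1 hz with rfl | hz
      · exact h
      · exact h2 z hz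
    · push Not at h
      refine ⟨insert a W, Finset.insert_subset_insert _ hWZ, fun z hz z' hz' hne => ?_,
        fun z hz => ?_⟩
      · rcases Finset.mem_insert.1 hz with rfl | hzW <;>
          rcases Finset.mem_insert.1 hz' with rfl | hzW'
        · exact absurd rfl hne
        · exact h z' hzW'
        · rw [dist_comm]
          exact h z hzW
        · exact h1 z hzW z' hzW' hne
      · rcases Finset.mem_insert.1 hz with rfl | hz
        · exact ⟨z, Finset.mem_insert_self _ _, by rwa [dist_self]⟩
        · obtain ⟨w, hw, hwd⟩ := h2 z hz
          exact ⟨w, Finset.mem_insert_of_mem hw, hwd⟩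

theorem card_mul_le_of_separated {X Z S : Finset (ℝ × ℝ)} {μ : ℝ × ℝ → ℝ} (hμ : ∀ p, 0 ≤ μ p)
    {r θ : ℝ} (hsep : ∀ z ∈ Z, ∀ z' ∈ Z, z ≠ z' → 2 * r < dist z z')
    (hθ : ∀ z ∈ Z, θ ≤ ∑ q ∈ X with dist z q ≤ r, μ q)
    (hS : ∀ z ∈ Z, ∀ q ∈ X, dist z q ≤ r → q ∈ S) : Z.card * θ ≤ ∑ q ∈ S, μ q := by
  classical
  calc (Z.card : ℝ) * θ = ∑ _z ∈ Z, θ := by rw [Finset.sum_const, nsmul_eq_mul]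
    _ ≤ ∑ z ∈ Z, ∑ q ∈ X with dist z q ≤ r, μ q := Finset.sum_le_sum hθ
    _ = ∑ q ∈ Z.biUnion fun z => X.filter fun q => dist z q ≤ r, μ q := by
        rw [Finset.sum_biUnion]
        intro z hz z' hz' hne
        rw [Function.onFun, Finset.disjoint_left]
        intro q hq hq'
        have h1 := (Finset.mem_filter.1 hq).2
        have h2 := (Finset.mem_filter.1 hq').2
        have h3 := dist_triangle_right z z' q
        linarith [hsep z hz z' hz' hne]
    _ ≤ _ := by
        refine Finset.sum_le_sum_of_subset_of_nonneg (fun q hq => ?_) fun q _ _ => hμ q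
        obtain ⟨z, hz, hq⟩ := Finset.mem_biUnion.1 hq
        exact hS z hz q (Finset.mem_filter.1 hq).1 (Finset.mem_filter.1 hq).2

/-- Multiscale counting of separated points in a thin annulus. -/
theorem card_le_of_scaleChain {X G : Finset (ℝ × ℝ)} {μ : ℝ × ℝ → ℝ} (hμ : ∀ p, 0 ≤ μ p)
    {T A κ : ℝ} (hT : 2 ≤ T) {m : ℕ} (hm : (m : ℝ) + 1 ≤ exp2 T) (hC : ∑ x ∈ X, μ x ≤ exp2 T)
    {f : ℕ → ℤ} {y : ℝ × ℝ}
    (hlow : ∀ x ∈ G, ∀ j ≤ m, exp2 (-(T * (f j + 1))) ≤ ballMass X μ T x j)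
    (hup : ∀ x ∈ G, ∀ j ≤ m, ballMass X μ T x j ≤ exp2 (-(T * f j)))
    (harc : ∀ x ∈ G, ∀ a b : ℕ, 1 ≤ a → a < b → b ≤ 2 * a → b ≤ m →
      arcMass X μ T x y a b ≤ exp2 (T * A) * scaleMass X μ T x a b)
    (hf : ∀ j, j + 1 ≤ m → f (j + 1) ≤ f j + 5) (hA : 0 ≤ A) (hκ : A + 8 ≤ κ) {b : ℕ} {c : ℝ}
    (h : ScaleChain (fun j => (f j : ℝ) - j) κ b c) (hbm : b ≤ m) :
    ∀ Z ⊆ G, (∀ z ∈ Z, ∀ z' ∈ Z, z ≠ z' → 2 * exp2 (-(b * T)) < dist z z') →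
      (∀ z ∈ Z, ∀ z' ∈ Z, |planeDist z y - planeDist z' y| ≤ 2 * exp2 (-(b * T))) →
      (Z.card : ℝ) ≤ exp2 (T * (f b - b + c)) := by
  classical
  induction h with
  | start a c ha hc =>
    intro Z hZ hsep _
    have h1 := card_mul_le_of_separated hμ hsep (θ := exp2 (-(T * (f a + 1))))
      (fun z hz => hlow z (hZ hz) a hbm) fun _ _ q hq _ => hq
    refine le_of_mul_le_mul_right (h1.trans (hC.trans ?_)) (exp2_pos (-(T * (f a + 1))))
    rw [← exp2_add]
    apply exp2_le
    nlinarith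
  | step a b c d c' h hab hb hd hc ih =>
    intro Z hZ hsep hdiam
    have ha1 : 1 ≤ a := by omega
    have hTab : (a + 1 : ℝ) * T ≤ b * T :=
      mul_le_mul_of_nonneg_right (by exact_mod_cast hab) (by linarith)
    have hrb : 0 < exp2 (-(b * T)) := exp2_pos _
    have hra : 0 < exp2 (-(a * T)) := exp2_pos _
    have hba : exp2 (-(b * T)) ≤ exp2 (-(a * T)) := exp2_le (by linarith)
    obtain ⟨W, hWZ, hW1, hW2⟩ := exists_separated_net Z (by linarith : 0 ≤ 2 * exp2 (-(a * T)))
    have hW := ih (by omega) W (hWZ.trans hZ) hW1 fun z hz z' hz' =>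
      (hdiam z (hWZ hz) z' (hWZ hz')).trans (by linarith)
    have hloc : ∀ w ∈ W, ((Z.filter fun z => dist z w ≤ 2 * exp2 (-(a * T))).card : ℝ) ≤
        exp2 (T * (A + 7 + f b - b - (f a - a - d))) := by
      intro w hw
      have h1 := card_mul_le_of_separated (X := X) (r := exp2 (-(b * T)))
        (Z := Z.filter fun z => dist z w ≤ 2 * exp2 (-(a * T)))
        (S := X.filter fun q => dist w q ≤ 4 * exp2 (-(a * T)) ∧
          |planeDist w y - planeDist q y| ≤ 4 * exp2 (-(b * T))) hμ
        (fun z hz z' hz' => hsep z (Finset.mem_filter.1 hz).1 z' (Finset.mem_filter.1 hz').1)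
        (θ := exp2 (-(T * (f b + 1))))
        (fun z hz => hlow z (hZ (Finset.mem_filter.1 hz).1) b hbm) (fun z hz q hq hzq => by
          obtain ⟨hzZ, hzw⟩ := Finset.mem_filter.1 hz
          refine Finset.mem_filter.2 ⟨hq, ?_, ?_⟩
          · have := dist_triangle w z q
            rw [dist_comm w z] at this
            linarith
          · have h2 := hdiam w (hWZ hw) z hzZ
            have h3 := abs_planeDist_sub_le z q y
            have h4 := abs_sub_le (planeDist w y) (planeDist z y) (planeDist q y)
            linarith)
      have h2 := harc w (hZ (hWZ hw)) a b ha1 hab hb hbm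
      have h3 : scaleMass X μ T w a b ≤ exp2 T * exp2 (-(T * (b + (f a - a - d - 4)))) := by
        calc scaleMass X μ T w a b
            ≤ ∑ _j ∈ Finset.Icc (a - 1) b, exp2 (-(T * (b + (f a - a - d - 4)))) := by
              refine Finset.sum_le_sum fun j hj => ?_
              obtain ⟨hj1, hj2⟩ := Finset.mem_Icc.1 hj
              refine (mul_le_mul_of_nonneg_right (hup w (hZ (hWZ hw)) j (by omega))
                (exp2_pos _).le).trans ?_
              rw [← exp2_add]
              apply exp2_le
              have h5 : (f a : ℝ) - a - d - 4 ≤ f j - j := by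
                rcases Nat.lt_or_ge j a with hja | hja
                · have e : j + 1 = a := by omega
                  have h6 := hf j (by omega)
                  rw [e] at h6
                  have h7 : (f a : ℝ) ≤ f j + 5 := by exact_mod_cast h6
                  have h8 : (j : ℝ) + 1 = a := by exact_mod_cast e
                  have h9 := hd a le_rfl (by omega)
                  linarith
                · have := hd j hja hj2
                  linarith
              have := mul_le_mul_of_nonneg_left h5 (by linarith : 0 ≤ T)
              linarith
          _ = (Finset.Icc (a - 1) b).card * exp2 (-(T * (b + (f a - a - d - 4)))) := by
              rw [Finset.sum_const, nsmul_eq_mul]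
          _ ≤ _ := by
              refine mul_le_mul_of_nonneg_right (le_trans ?_ hm) (exp2_pos _).le
              rw [Nat.card_Icc]
              have : b + 1 - (a - 1) ≤ m + 1 := by omega
              exact_mod_cast this
      have h4 := h1.trans (h2.trans (mul_le_mul_of_nonneg_left h3 (exp2_pos _).le))
      refine le_of_mul_le_mul_right (h4.trans ?_) (exp2_pos (-(T * (f b + 1))))
      rw [← exp2_add, ← exp2_add, ← exp2_add]
      apply exp2_le
      linarith
    have hcov : Z ⊆ W.biUnion fun w => Z.filter fun z => dist z w ≤ 2 * exp2 (-(a * T)) := by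
      intro z hz
      obtain ⟨w, hw, hwd⟩ := hW2 z hz
      exact Finset.mem_biUnion.2 ⟨w, hw, Finset.mem_filter.2 ⟨hz, hwd⟩⟩
    calc (Z.card : ℝ)
        ≤ ∑ w ∈ W, ((Z.filter fun z => dist z w ≤ 2 * exp2 (-(a * T))).card : ℝ) := by
          exact_mod_cast (Finset.card_le_card hcov).trans Finset.card_biUnion_le
      _ ≤ ∑ _w ∈ W, exp2 (T * (A + 7 + f b - b - (f a - a - d))) := Finset.sum_le_sum hloc
      _ = W.card * exp2 (T * (A + 7 + f b - b - (f a - a - d))) := by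
          rw [Finset.sum_const, nsmul_eq_mul]
      _ ≤ exp2 (T * (f a - a + c)) * exp2 (T * (A + 7 + f b - b - (f a - a - d))) :=
          mul_le_mul_of_nonneg_right hW (exp2_pos _).le
      _ ≤ _ := by
          rw [← exp2_add]
          apply exp2_le
          have := mul_le_mul_of_nonneg_left (by linarith : A + 7 + c + d ≤ c') (by linarith : 0 ≤ T)
          linarith

/-- The (integer part of the) exponent of a positive number in base `2 ^ (-T)`. -/
noncomputable def expFloor (T N : ℝ) : ℤ := ⌊-Real.logb 2 N / T⌋

theorem exp2_logb {N : ℝ} (hN : 0 < N) : exp2 (Real.logb 2 N) = N :=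
  Real.rpow_logb (by norm_num) (by norm_num) hN

theorem le_exp2_expFloor {T N : ℝ} (hT : 0 < T) (hN : 0 < N) :
    N ≤ exp2 (-(T * expFloor T N)) := by
  have h := Int.floor_le (-Real.logb 2 N / T)
  rw [le_div_iff₀ hT] at h
  nth_rewrite 1 [← exp2_logb hN]
  apply exp2_le
  rw [expFloor]
  linarith

theorem exp2_expFloor_le {T N : ℝ} (hT : 0 < T) (hN : 0 < N) :
    exp2 (-(T * (expFloor T N + 1))) ≤ N := by
  have h := (Int.lt_floor_add_one (-Real.logb 2 N / T)).le
  rw [div_le_iff₀ hT] at h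
  nth_rewrite 2 [← exp2_logb hN]
  apply exp2_le
  rw [expFloor]
  linarith

theorem exists_nat_log_lt (a K : ℝ) {δ : ℝ} (hδ : 0 < δ) :
    ∃ m : ℕ, 1 ≤ m ∧ a + K * (Real.logb 2 m + 1) < m * δ := by
  have h1 : Tendsto (fun m : ℕ => Real.log m / m) atTop (nhds 0) := by
    have := Real.isLittleO_log_id_atTop.tendsto_div_nhds_zero.comp tendsto_natCast_atTop_atTop
    exact this
  have h2 : Tendsto (fun m : ℕ => (a + K) / m + K / Real.log 2 * (Real.log m / m)) atTop
      (nhds (0 + K / Real.log 2 * 0)) :=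
    (tendsto_const_div_atTop_nhds_zero_nat _).add (h1.const_mul _)
  rw [mul_zero, add_zero] at h2
  obtain ⟨m, hm1, hm2⟩ := ((h2.eventually_lt_const hδ).and (eventually_ge_atTop 1)).exists
  refine ⟨m, hm2, ?_⟩
  have hm0 : (0 : ℝ) < m := by exact_mod_cast hm2
  have e : (a + K) / m + K / Real.log 2 * (Real.log m / m) =
      (a + K * (Real.logb 2 m + 1)) / m := by
    rw [Real.logb]
    field_simp
    ring
  rw [e, div_lt_iff₀ hm0] at hm1
  linarith

/-- The mass of a set of good points, seen from `y` through few distances, is small. -/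
theorem le_of_scaleChain {X G : Finset (ℝ × ℝ)} {μ : ℝ × ℝ → ℝ} (hμ : ∀ p, 0 ≤ μ p)
    {T A κ τ : ℝ} (hT : 2 ≤ T) {m : ℕ} (hm1 : 1 ≤ m) (hm : (m : ℝ) + 1 ≤ exp2 T)
    (hC : ∑ x ∈ X, μ x ≤ exp2 T)
    {f : ℕ → ℤ} {y : ℝ × ℝ} (hGX : G ⊆ X)
    (hlow : ∀ x ∈ G, ∀ j ≤ m, exp2 (-(T * (f j + 1))) ≤ ballMass X μ T x j)
    (hup : ∀ x ∈ G, ∀ j ≤ m, ballMass X μ T x j ≤ exp2 (-(T * f j)))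
    (harc : ∀ x ∈ G, ∀ a b : ℕ, 1 ≤ a → a < b → b ≤ 2 * a → b ≤ m →
      arcMass X μ T x y a b ≤ exp2 (T * A) * scaleMass X μ T x a b)
    (hf : ∀ j, j + 1 ≤ m → f (j + 1) ≤ f j + 5) (hA : 0 ≤ A) (hκ : A + 8 ≤ κ) {c : ℝ}
    (h : ScaleChain (fun j => (f j : ℝ) - j) κ m c) {I : Finset ℝ}
    (hI : (I.card : ℝ) ≤ exp2 (τ * m * T))
    (hGI : ∀ x ∈ G, ∃ z ∈ I, |planeDist x y - z| ≤ exp2 (-(m * T)))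
    (hG : exp2 (-(2 * T)) ≤ ∑ x ∈ G, μ x) :
    m - c ≤ τ * m + 7 := by
  classical
  have hloc : ∀ z ∈ I, ∑ x ∈ G with |planeDist x y - z| ≤ exp2 (-(m * T)), μ x ≤
      exp2 (T * (f m - m + c)) * exp2 (-(T * (f m - 5))) := by
    intro z hz
    obtain ⟨W, hWZ, hW1, hW2⟩ := exists_separated_net
      (G.filter fun x => |planeDist x y - z| ≤ exp2 (-(m * T)))
      (by linarith [exp2_pos (-(m * T))] : 0 ≤ 2 * exp2 (-(m * T)))
    have hWG : W ⊆ G := hWZ.trans (Finset.filter_subset _ _)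
    have hcard := card_le_of_scaleChain hμ hT hm hC hlow hup harc hf hA hκ h le_rfl W hWG hW1
      fun z₁ h₁ z₂ h₂ => by
        have e1 := (Finset.mem_filter.1 (hWZ h₁)).2
        have e2 := (Finset.mem_filter.1 (hWZ h₂)).2
        rw [abs_sub_comm] at e2
        have := abs_sub_le (planeDist z₁ y) z (planeDist z₂ y)
        linarith
    calc _ ≤ ∑ x ∈ W.biUnion fun w => X.filter fun q => dist w q ≤ exp2 (-((m - 1 : ℕ) * T)),
            μ x := by
          refine Finset.sum_le_sum_of_subset_of_nonneg (fun x hx => ?_) fun x _ _ => hμ x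
          obtain ⟨w, hw, hwd⟩ := hW2 x hx
          refine Finset.mem_biUnion.2 ⟨w, hw, Finset.mem_filter.2
            ⟨hGX (Finset.mem_filter.1 hx).1, ?_⟩⟩
          rw [dist_comm]
          refine hwd.trans ?_
          have e2 : exp2 1 = 2 := by
            have := exp2_natCast 1
            norm_num at this
            exact this
          rw [← e2, ← exp2_add]
          apply exp2_le
          rw [Nat.cast_sub hm1]
          push_cast
          linarith
      _ ≤ ∑ w ∈ W, ballMass X μ T w (m - 1) := sum_biUnion_le_of_nonneg _ _ hμ
      _ ≤ ∑ _w ∈ W, exp2 (-(T * (f m - 5))) := by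
          refine Finset.sum_le_sum fun w hw => (hup w (hWG hw) (m - 1) (by omega)).trans ?_
          apply exp2_le
          have e1 := hf (m - 1) (by omega)
          rw [Nat.sub_add_cancel hm1] at e1
          have e2 : (f m : ℝ) ≤ f (m - 1) + 5 := by exact_mod_cast e1
          nlinarith
      _ = W.card * exp2 (-(T * (f m - 5))) := by rw [Finset.sum_const, nsmul_eq_mul]
      _ ≤ _ := mul_le_mul_of_nonneg_right hcard (exp2_pos _).le
  have hle : exp2 (-(2 * T)) ≤ exp2 (T * (τ * m - m + c + 5)) := by
    calc exp2 (-(2 * T)) ≤ ∑ x ∈ G, μ x := hG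
      _ ≤ ∑ x ∈ I.biUnion fun z => G.filter fun x => |planeDist x y - z| ≤ exp2 (-(m * T)),
            μ x := by
          refine Finset.sum_le_sum_of_subset_of_nonneg (fun x hx => ?_) fun x _ _ => hμ x
          obtain ⟨z, hz, hxz⟩ := hGI x hx
          exact Finset.mem_biUnion.2 ⟨z, hz, Finset.mem_filter.2 ⟨hx, hxz⟩⟩
      _ ≤ ∑ z ∈ I, ∑ x ∈ G with |planeDist x y - z| ≤ exp2 (-(m * T)), μ x :=
          sum_biUnion_le_of_nonneg _ _ hμ
      _ ≤ I.card * (exp2 (T * (f m - m + c)) * exp2 (-(T * (f m - 5)))) := by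
          refine (Finset.sum_le_sum hloc).trans (le_of_eq ?_)
          rw [Finset.sum_const, nsmul_eq_mul]
      _ ≤ exp2 (τ * m * T) * (exp2 (T * (f m - m + c)) * exp2 (-(T * (f m - 5)))) :=
          mul_le_mul_of_nonneg_right hI (mul_nonneg (exp2_pos _).le (exp2_pos _).le)
      _ = _ := by
          rw [← exp2_add, ← exp2_add]
          congr 1
          ring
  rw [exp2_le_iff] at hle
  have : T * (-2) ≤ T * (τ * m - m + c + 5) := by linarith
  have := le_of_mul_le_mul_left this (by linarith)
  linarith

theorem exists_good_pin {X Y : Finset (ℝ × ℝ)} {μ ν : ℝ × ℝ → ℝ} (hμ : ∀ p, 0 ≤ μ p)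
    (hν : ∀ p, 0 ≤ ν p) {C T : ℝ} (hC : ∑ y ∈ Y, ν y ≤ C) (hT : 8 < T)
    (hCT : C ≤ exp2 (T / 8)) (P Q : ℝ × ℝ → ℝ × ℝ → Prop)
    [∀ y, DecidablePred (P · y)] [∀ y, DecidablePred (Q · y)]
    [DecidablePred fun b : (ℝ × ℝ) × (ℝ × ℝ) => ¬ Q b.1 b.2]
    (hQ : ∑ b ∈ X ×ˢ Y with ¬ Q b.1 b.2, μ b.1 * ν b.2 ≤ exp2 (-(3 / 4 * T)))
    (hP : ∀ y ∈ Y, exp2 (-(T / 4)) ≤ ∑ x ∈ X with P x y, μ x)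
    (hY : exp2 (-(T / 4)) ≤ ∑ y ∈ Y, ν y) :
    ∃ y ∈ Y, exp2 (-T) ≤ ∑ x ∈ X with P x y ∧ Q x y, μ x := by
  by_contra hcon
  push Not at hcon
  have h1 : exp2 (-(T / 4)) * exp2 (-(T / 4)) ≤ ∑ y ∈ Y, ν y * ∑ x ∈ X with P x y, μ x := by
    calc _ ≤ (∑ y ∈ Y, ν y) * exp2 (-(T / 4)) :=
          mul_le_mul_of_nonneg_right hY (exp2_pos _).le
      _ ≤ _ := by
          rw [Finset.sum_mul]
          exact Finset.sum_le_sum fun y hy => mul_le_mul_of_nonneg_left (hP y hy) (hν y)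
  have h2 : ∑ y ∈ Y, ν y * ∑ x ∈ X with P x y, μ x ≤
      ∑ y ∈ Y, ν y * ∑ x ∈ X with P x y ∧ Q x y, μ x +
        ∑ b ∈ X ×ˢ Y with ¬ Q b.1 b.2, μ b.1 * ν b.2 := by
    have e : ∑ b ∈ X ×ˢ Y with ¬ Q b.1 b.2, μ b.1 * ν b.2 =
        ∑ y ∈ Y, ν y * ∑ x ∈ X with ¬ Q x y, μ x := by
      rw [Finset.sum_filter, Finset.sum_product_right]
      refine Finset.sum_congr rfl fun y _ => ?_
      rw [Finset.sum_filter, Finset.mul_sum]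
      refine Finset.sum_congr rfl fun x _ => ?_
      by_cases h : Q x y <;> simp [h, mul_comm]
    rw [e, ← Finset.sum_add_distrib]
    refine Finset.sum_le_sum fun y _ => ?_
    rw [← mul_add]
    refine mul_le_mul_of_nonneg_left (sum_filter_le_add hμ fun x _ hx => ?_) (hν y)
    by_cases h : Q x y
    · exact Or.inl ⟨hx, h⟩
    · exact Or.inr h
  have h3 : ∑ y ∈ Y, ν y * ∑ x ∈ X with P x y ∧ Q x y, μ x ≤ exp2 (T / 8) * exp2 (-T) := by
    calc _ ≤ ∑ y ∈ Y, ν y * exp2 (-T) :=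
          Finset.sum_le_sum fun y hy => mul_le_mul_of_nonneg_left (hcon y hy).le (hν y)
      _ ≤ _ := by
          rw [← Finset.sum_mul]
          exact mul_le_mul_of_nonneg_right (hC.trans hCT) (exp2_pos _).le
  have h4 : exp2 (T / 8) * exp2 (-T) ≤ exp2 (-(3 / 4 * T)) := by
    rw [← exp2_add]
    apply exp2_le
    linarith
  have h5 : 2 * exp2 (-(3 / 4 * T)) < exp2 (-(T / 4)) * exp2 (-(T / 4)) := by
    have e2 : exp2 1 = 2 := by
      have := exp2_natCast 1
      norm_num at this
      exact this
    rw [← e2, ← exp2_add, ← exp2_add]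
    apply exp2_lt
    linarith
  linarith

theorem exists_fiber_sum_ge {ι κ : Type*} [DecidableEq κ] {G : Finset ι} {μ : ι → ℝ}
    {F : ι → κ} {I : Finset κ} (hF : ∀ x ∈ G, F x ∈ I) {a K : ℝ} (ha : 0 < a)
    (hI : (I.card : ℝ) ≤ K) (hG : a * K ≤ ∑ x ∈ G, μ x) (hG0 : 0 < ∑ x ∈ G, μ x) :
    ∃ k, a ≤ ∑ x ∈ G with F x = k, μ x := by
  by_contra hcon
  push Not at hcon
  rw [← Finset.sum_fiberwise_of_maps_to hF] at hG hG0
  have hne : I.Nonempty := by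
    by_contra h
    rw [Finset.not_nonempty_iff_eq_empty.1 h, Finset.sum_empty] at hG0
    exact lt_irrefl _ hG0
  have h1 := Finset.sum_lt_sum_of_nonempty hne fun k _ => hcon k
  rw [Finset.sum_const, nsmul_eq_mul] at h1
  have h2 := mul_le_mul_of_nonneg_right hI ha.le
  linarith

/-- The exponent profile of a good point. -/
structure IsProfile (X : Finset (ℝ × ℝ)) (μ : ℝ × ℝ → ℝ) (T s u : ℝ) (m : ℕ) (x : ℝ × ℝ)
    (f : ℕ → ℤ) : Prop where
  low : ∀ j ≤ m, exp2 (-(T * (f j + 1))) ≤ ballMass X μ T x j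
  up : ∀ j ≤ m, ballMass X μ T x j ≤ exp2 (-(T * f j))
  lower : ∀ j ≤ m, s * j - 2 ≤ f j
  upper : ∀ j ≤ m, (f j : ℝ) ≤ u * j + 1
  anti : ∀ i j, i ≤ j → j ≤ m → (f i : ℝ) ≤ f j + 1
  growth : ∀ i j, i ≤ j → j ≤ m → (f j : ℝ) ≤ f i + 2 * (j - i) + 2

theorem isProfile_expFloor {X : Finset (ℝ × ℝ)} {μ : ℝ × ℝ → ℝ} {T s u A C : ℝ} {m : ℕ}
    (hμ : IsFrostman X μ C s T m) (hT : 0 < T) (hC : C ≤ exp2 T) {x y : ℝ × ℝ} (hx : x ∈ X)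
    (h : IsGoodPair X μ T u A m x y) :
    IsProfile X μ T s u m x fun j => expFloor T (ballMass X μ T x j) := by
  have hpos : ∀ j ≤ m, 0 < ballMass X μ T x j := fun j hj => (exp2_pos _).trans_le (h.1 j hj)
  have low : ∀ j ≤ m, exp2 (-(T * (expFloor T (ballMass X μ T x j) + 1))) ≤ ballMass X μ T x j :=
    fun j hj => exp2_expFloor_le hT (hpos j hj)
  have up : ∀ j ≤ m, ballMass X μ T x j ≤ exp2 (-(T * expFloor T (ballMass X μ T x j))) :=
    fun j hj => le_exp2_expFloor hT (hpos j hj)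
  have key : ∀ {a b : ℝ}, exp2 (-(T * a)) ≤ exp2 (-(T * b)) → b ≤ a := fun hab => by
    rw [exp2_le_iff] at hab
    exact le_of_mul_le_mul_left (by linarith) hT
  refine ⟨low, up, fun j hj => ?_, fun j hj => ?_, fun i j hij hj => ?_, fun i j hij hj => ?_⟩
  · have h1 : exp2 (-(T * (expFloor T (ballMass X μ T x j) + 1))) ≤ exp2 (-(T * (s * j - 1))) := by
      refine (low j hj).trans ((hμ.ball x hx j hj).trans
        ((mul_le_mul_of_nonneg_right hC (exp2_pos _).le).trans ?_))
      rw [← exp2_add]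
      apply exp2_le
      linarith
    linarith [key h1]
  · exact key ((h.1 j hj).trans (up j hj))
  · exact key ((low j hj).trans ((ballMass_anti hμ.nonneg hT.le x hij).trans
      (up i (hij.trans hj))))
  · have h1 := (mul_le_mul_of_nonneg_left (low i (hij.trans hj)) (exp2_pos _).le).trans
      ((h.2.1 i j hij hj).trans (up j hj))
    rw [← exp2_add] at h1
    have h2 : exp2 (-(T * (2 * (j - i) + 1 + (expFloor T (ballMass X μ T x i) + 1)))) ≤
        exp2 (-(T * expFloor T (ballMass X μ T x j))) := by
      refine le_trans (le_of_eq ?_) h1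
      congr 1
      ring
    linarith [key h2]

open Classical in
/-- Finitary pinned distance estimate: there cannot be many pins seeing a large part of a
Frostman weight through few distances. -/
theorem sum_pins_lt {s u t τ α : ℝ} (hs : 0 < s) (hsu : s ≤ u) (hu : u ≤ 2) (hsu' : 2 * s ≤ u + 1)
    (ht : t ≤ 2) (hst : 2 < min s 1 + t) (hα : α * (2 * u + 2 - 3 * s) = u + 1 - 2 * s)
    (hτ : τ < 1 - α * (2 - s)) :
    ∃ m : ℕ, 1 ≤ m ∧ ∀ C R c₀ : ℝ, 0 ≤ R → 0 < c₀ → ∃ T₀ : ℝ, ∀ T ≥ T₀,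
      ∀ (X Y : Finset (ℝ × ℝ)) (μ ν : ℝ × ℝ → ℝ),
      IsFrostman X μ C s T m → IsFrostman Y ν C t T m →
      (∀ x ∈ X, |x.1| ≤ R ∧ |x.2| ≤ R) → (∀ y ∈ Y, |y.1| ≤ R ∧ |y.2| ≤ R) →
      (∀ x ∈ X, ∀ y ∈ Y, c₀ ≤ |x.1 - y.1|) →
      (∀ j ≤ m, ((X.image (cell (exp2 (-(j * T))))).card : ℝ) ≤ C * exp2 (u * j * T)) →
      (∀ y ∈ Y, ∃ I : Finset ℝ, (I.card : ℝ) ≤ exp2 (τ * m * T) ∧ exp2 (-(T / 4)) ≤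
        ∑ x ∈ X with ∃ z ∈ I, |planeDist x y - z| ≤ exp2 (-(m * T)), μ x) →
      ∑ y ∈ Y, ν y < exp2 (-(T / 4)) := by
  have hden : 0 < 2 * u + 2 - 3 * s := by linarith
  have hα0 : 0 ≤ α := by
    by_contra hcon
    push Not at hcon
    nlinarith
  set A := 16 / (min s 1 + t - 2) + 6 with hA
  have hA0 : 0 ≤ A := by
    have : 0 < min s 1 + t - 2 := by linarith
    positivity
  set K := 10 * (A + 8) + 20 * 2 + 20 with hK
  obtain ⟨m, hm1, hm⟩ := exists_nat_log_lt (2 * α + 7) K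
    (by linarith : 0 < 1 - α * (2 - s) - τ)
  refine ⟨m, hm1, fun C R c₀ hR hc₀ => ?_⟩
  obtain ⟨T₁, hT₁⟩ := sum_not_isGoodPair_le (u := u) (C := C) ht hst hR hc₀ hm1
  obtain ⟨T₂, hT₂⟩ := exists_le_exp2 (max C ((2 * m + 5 : ℝ) ^ (m + 1)))
  obtain ⟨T₃, hT₃⟩ := exists_le_exp2 (m + 1)
  refine ⟨max (max T₁ (8 * T₂)) (max T₃ (max 9 T₂)),
    fun T hT X Y μ ν hμ hν hX hY hsep hcell hI => ?_⟩
  simp only [ge_iff_le, max_le_iff] at hT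
  obtain ⟨⟨hTT₁, hTT₂⟩, hTT₃, hT9, hTT₄⟩ := hT
  by_contra hcon
  push Not at hcon
  have hC8 : C ≤ exp2 (T / 8) := (le_max_left _ _).trans (hT₂ (T / 8) (by linarith))
  have hCT : C ≤ exp2 T := hC8.trans (exp2_le (by linarith))
  choose! I hIc hIm using hI
  obtain ⟨y, hy, hyG⟩ := exists_good_pin (P := fun x y => ∃ z ∈ I y, |planeDist x y - z| ≤
    exp2 (-(m * T))) (Q := fun x y => IsGoodPair X μ T u A m x y) hμ.nonneg hν.nonneg hν.total
    (by linarith) hC8 (hT₁ T hTT₁ X Y μ ν hμ hν hX hY hsep hcell) hIm hcon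
  set G' := X.filter fun x => (∃ z ∈ I y, |planeDist x y - z| ≤ exp2 (-(m * T))) ∧
    IsGoodPair X μ T u A m x y with hG'
  have hG'X : ∀ x ∈ G', x ∈ X := fun x hx => (Finset.mem_filter.1 hx).1
  have hprof : ∀ x ∈ G', IsProfile X μ T s u m x fun j => expFloor T (ballMass X μ T x j) :=
    fun x hx => isProfile_expFloor hμ (by linarith) hCT (hG'X x hx) (Finset.mem_filter.1 hx).2.2
  have hfib := exists_fiber_sum_ge (G := G') (μ := μ)
    (F := fun x (j : Fin (m + 1)) => expFloor T (ballMass X μ T x j))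
    (I := Fintype.piFinset fun _ => Finset.Icc (-2 : ℤ) (2 * m + 2)) (fun x hx => by
      rw [Fintype.mem_piFinset]
      intro j
      have hj : (j : ℕ) ≤ m := Nat.lt_succ_iff.1 j.2
      have hj' : ((j : ℕ) : ℝ) ≤ m := by exact_mod_cast hj
      have hj0 : (0 : ℝ) ≤ (j : ℕ) := Nat.cast_nonneg _
      have e1 := (hprof x hx).lower j hj
      have e2 := (hprof x hx).upper j hj
      rw [Finset.mem_Icc]
      constructor
      · have : ((-2 : ℤ) : ℝ) ≤ expFloor T (ballMass X μ T x j) := by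
          push_cast
          nlinarith
        exact_mod_cast this
      · have : (expFloor T (ballMass X μ T x j) : ℝ) ≤ ((2 * m + 2 : ℤ) : ℝ) := by
          push_cast
          nlinarith
        exact_mod_cast this)
    (a := exp2 (-(2 * T))) (K := exp2 T) (exp2_pos _) (by
      rw [Fintype.card_piFinset_const, Int.card_Icc]
      refine le_trans (le_of_eq ?_) ((le_max_right _ _).trans (hT₂ T hTT₄))
      have : (2 * (m : ℤ) + 2 + 1 - -2).toNat = 2 * m + 5 := by omega
      rw [this]
      push_cast
      ring)
    (by
      rw [← exp2_add]
      refine le_trans (le_of_eq ?_) hyG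
      congr 1
      ring)
    ((exp2_pos _).trans_le hyG)
  obtain ⟨k, hk⟩ := hfib
  set G := G'.filter fun x => (fun (j : Fin (m + 1)) => expFloor T (ballMass X μ T x j)) = k with hG
  have hGG' : ∀ x ∈ G, x ∈ G' := fun x hx => (Finset.mem_filter.1 hx).1
  have hGne : G.Nonempty := by
    by_contra h
    rw [Finset.not_nonempty_iff_eq_empty.1 h, Finset.sum_empty] at hk
    linarith [exp2_pos (-(2 * T))]
  obtain ⟨x₀, hx₀⟩ := hGne
  set f : ℕ → ℤ := fun j => expFloor T (ballMass X μ T x₀ j) with hf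
  have hfeq : ∀ x ∈ G, ∀ j ≤ m, expFloor T (ballMass X μ T x j) = f j := fun x hx j hj => by
    have e1 := congrFun ((Finset.mem_filter.1 hx).2) ⟨j, Nat.lt_succ_iff.2 hj⟩
    have e2 := congrFun ((Finset.mem_filter.1 hx₀).2) ⟨j, Nat.lt_succ_iff.2 hj⟩
    exact e1.trans e2.symm
  have hp₀ : IsProfile X μ T s u m x₀ f := hprof x₀ (hGG' x₀ hx₀)
  have hchain := scaleChain_of_growth (g := fun j => (f j : ℝ) - j) (κ := A + 8) (e := 2)
    (by linarith) (by norm_num) hsu hu hsu' hα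
    (fun i j _ hij hj => by
      have e1 := hp₀.anti i j hij hj
      have e2 := hp₀.growth i j hij hj
      rw [abs_le]
      constructor <;> linarith)
    (fun j _ hj => by linarith [hp₀.lower j hj])
    (fun j _ hj => by linarith [hp₀.upper j hj]) m hm1 le_rfl
  have hfin := le_of_scaleChain hμ.nonneg (by linarith : 2 ≤ T) hm1 (hT₃ T hTT₃)
    (hμ.total.trans hCT) (fun x hx => hG'X x (hGG' x hx))
    (fun x hx j hj => by
      rw [← hfeq x hx j hj]
      exact (hprof x (hGG' x hx)).low j hj)
    (fun x hx j hj => by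
      rw [← hfeq x hx j hj]
      exact (hprof x (hGG' x hx)).up j hj)
    (fun x hx => (Finset.mem_filter.1 (hGG' x hx)).2.2.2.2)
    (fun j hj => by
      have e1 := hp₀.growth j (j + 1) (by omega) hj
      have : (f (j + 1) : ℝ) ≤ ((f j + 5 : ℤ) : ℝ) := by
        push_cast at e1 ⊢
        linarith
      exact_mod_cast this)
    hA0 le_rfl hchain (hIc y hy) (fun x hx => (Finset.mem_filter.1 (hGG' x hx)).2.1) hk
  have hlow := hp₀.lower m le_rfl
  have h3 := mul_le_mul_of_nonneg_left hlow hα0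
  nlinarith

/-- The index of the dyadic square of side `2 ^ (-j)` containing a point. -/
noncomputable def dcell (j : ℕ) (x : ℝ × ℝ) : ℤ × ℤ := cell (exp2 (-j)) x

theorem floor_div_exp2_succ (j : ℕ) (a : ℝ) :
    ⌊a / exp2 (-(j : ℝ))⌋ = ⌊a / exp2 (-((j + 1 : ℕ) : ℝ))⌋ / 2 := by
  have h1 : exp2 (-((j + 1 : ℕ) : ℝ)) = exp2 (-(j : ℝ)) / 2 := by
    rw [exp2_neg, exp2_neg, exp2_natCast, exp2_natCast, pow_succ, mul_inv, div_eq_mul_inv]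
  have h2 : a / (exp2 (-(j : ℝ)) / 2) = 2 * (a / exp2 (-(j : ℝ))) := by
    rw [div_div_eq_mul_div]
    ring
  rw [h1, h2]
  generalize a / exp2 (-(j : ℝ)) = b
  have e1 := Int.floor_le b
  have e2 := Int.lt_floor_add_one b
  have f1 : 2 * ⌊b⌋ ≤ ⌊2 * b⌋ := Int.le_floor.2 (by push_cast; linarith)
  have f2 : ⌊2 * b⌋ < 2 * ⌊b⌋ + 2 := Int.floor_lt.2 (by push_cast; linarith)
  omega

theorem dcell_eq_succ (j : ℕ) (x : ℝ × ℝ) :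
    dcell j x = ((dcell (j + 1) x).1 / 2, (dcell (j + 1) x).2 / 2) := by
  simp only [dcell, cell, floor_div_exp2_succ j]

theorem dcell_eq_of_le {i j : ℕ} (h : i ≤ j) {x y : ℝ × ℝ} (hxy : dcell j x = dcell j y) :
    dcell i x = dcell i y := by
  induction j, h using Nat.le_induction with
  | base => exact hxy
  | succ j _ ih =>
    apply ih
    rw [dcell_eq_succ j x, dcell_eq_succ j y, hxy]

/-- The dyadic square with a given code. -/
def cube (q : ℕ × ℤ × ℤ) : Set (ℝ × ℝ) := {x | dcell q.1 x = q.2}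

theorem mem_cube_self (j : ℕ) (x : ℝ × ℝ) : x ∈ cube (j, dcell j x) := rfl

theorem eq_of_mem_cube {q : ℕ × ℤ × ℤ} {x : ℝ × ℝ} (h : x ∈ cube q) : q = (q.1, dcell q.1 x) :=
  Prod.ext rfl (Eq.symm h)

theorem cube_subset {p q : ℕ × ℤ × ℤ} (h : p.1 ≤ q.1) {x : ℝ × ℝ} (hp : x ∈ cube p)
    (hq : x ∈ cube q) : cube q ⊆ cube p := fun y hy => by
  have hq' : dcell q.1 x = dcell q.1 y := Eq.trans hq (Eq.symm hy)
  exact (dcell_eq_of_le h hq').symm.trans hp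

/-- The four dyadic squares of the next generation. -/
def children (p : ℕ × ℤ × ℤ) : Finset (ℕ × ℤ × ℤ) :=
  (({2 * p.2.1, 2 * p.2.1 + 1} : Finset ℤ) ×ˢ ({2 * p.2.2, 2 * p.2.2 + 1} : Finset ℤ)).image
    fun a => (p.1 + 1, a)

theorem fst_of_mem_children {p q : ℕ × ℤ × ℤ} (h : q ∈ children p) : q.1 = p.1 + 1 := by
  obtain ⟨a, _, rfl⟩ := Finset.mem_image.1 h
  rfl

theorem mem_children_of_mem_cube {p : ℕ × ℤ × ℤ} {x : ℝ × ℝ} :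
    (p.1 + 1, dcell (p.1 + 1) x) ∈ children p ↔ x ∈ cube p := by
  have h : x ∈ cube p ↔ dcell p.1 x = p.2 := Iff.rfl
  rw [h, dcell_eq_succ p.1 x, Prod.ext_iff]
  simp only [children, Finset.mem_image, Finset.mem_product, Finset.mem_insert,
    Finset.mem_singleton, Prod.mk.injEq, true_and, exists_eq_right]
  omega

theorem cube_eq_children (p : ℕ × ℤ × ℤ) : cube p = ⋃ q ∈ children p, cube q := by
  ext x
  simp only [mem_iUnion, exists_prop]
  constructor
  · exact fun h => ⟨_, mem_children_of_mem_cube.2 h, mem_cube_self _ _⟩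
  · rintro ⟨q, hq, hx⟩
    rw [eq_of_mem_cube hx, fst_of_mem_children hq] at hq
    exact mem_children_of_mem_cube.1 hq

theorem cube_subset_of_mem_children {p q : ℕ × ℤ × ℤ} (h : q ∈ children p) :
    cube q ⊆ cube p := by
  rw [cube_eq_children p]
  exact subset_biUnion_of_mem (u := cube) h

/-- The `t`-th power of the side of a dyadic square. -/
noncomputable def side (t : ℝ) (q : ℕ × ℤ × ℤ) : ℝ≥0∞ := ENNReal.ofReal (exp2 (-(q.1 * t)))

theorem side_pos (t : ℝ) (q : ℕ × ℤ × ℤ) : 0 < side t q := ENNReal.ofReal_pos.2 (exp2_pos _)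

theorem side_ne_top (t : ℝ) (q : ℕ × ℤ × ℤ) : side t q ≠ ∞ := ENNReal.ofReal_ne_top

theorem side_le {t : ℝ} (ht : 0 ≤ t) {p q : ℕ × ℤ × ℤ} (h : p.1 ≤ q.1) : side t q ≤ side t p := by
  apply ENNReal.ofReal_le_ofReal
  apply exp2_le
  have : (p.1 : ℝ) ≤ q.1 := by exact_mod_cast h
  nlinarith

/-- Dyadic Hausdorff content. -/
noncomputable def content (t : ℝ) (B : Set (ℝ × ℝ)) : ℝ≥0∞ :=
  ⨅ (D : Set (ℕ × ℤ × ℤ)) (_ : B ⊆ ⋃ q ∈ D, cube q), ∑' q : D, side t q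

theorem content_le {t : ℝ} {B : Set (ℝ × ℝ)} {D : Set (ℕ × ℤ × ℤ)} (h : B ⊆ ⋃ q ∈ D, cube q) :
    content t B ≤ ∑' q : D, side t q := iInf₂_le D h

theorem exists_cover_of_content_lt {t : ℝ} {B : Set (ℝ × ℝ)} {c : ℝ≥0∞} (h : content t B < c) :
    ∃ D : Set (ℕ × ℤ × ℤ), B ⊆ ⋃ q ∈ D, cube q ∧ ∑' q : D, side t q < c := by
  simp only [content, iInf_lt_iff] at h
  obtain ⟨D, h1, h2⟩ := h
  exact ⟨D, h1, h2⟩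

theorem content_mono {t : ℝ} {B B' : Set (ℝ × ℝ)} (h : B ⊆ B') : content t B ≤ content t B' :=
  le_iInf₂ fun _ hD => content_le (h.trans hD)

theorem content_le_side {t : ℝ} {B : Set (ℝ × ℝ)} {q : ℕ × ℤ × ℤ} (h : B ⊆ cube q) :
    content t B ≤ side t q := by
  refine (content_le (D := {q}) (by simpa using h)).trans (le_of_eq ?_)
  rw [tsum_singleton q (side t)]

theorem content_iUnion_le {ι : Type*} [Countable ι] (t : ℝ) (B : ι → Set (ℝ × ℝ)) :
    content t (⋃ i, B i) ≤ ∑' i, content t (B i) := by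
  refine ENNReal.le_of_forall_pos_le_add fun ε hε hfin => ?_
  obtain ⟨δ, hδ, hδε⟩ := ENNReal.exists_pos_sum_of_countable (ENNReal.coe_ne_zero.2 hε.ne') ι
  have hlt : ∀ i, content t (B i) < content t (B i) + δ i := fun i =>
    ENNReal.lt_add_right (ne_top_of_le_ne_top hfin.ne (ENNReal.le_tsum i))
      (ENNReal.coe_ne_zero.2 (hδ i).ne')
  choose D hD1 hD2 using fun i => exists_cover_of_content_lt (hlt i)
  calc content t (⋃ i, B i) ≤ ∑' q : ⋃ i, D i, side t q := by
        refine content_le (iUnion_subset fun i => (hD1 i).trans ?_)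
        exact biUnion_subset_biUnion_left (subset_iUnion D i)
    _ ≤ ∑' i, ∑' q : D i, side t q := ENNReal.tsum_iUnion_le_tsum _ _
    _ ≤ ∑' i, (content t (B i) + δ i) := ENNReal.tsum_le_tsum fun i => (hD2 i).le
    _ ≤ _ := by
        rw [ENNReal.tsum_add]
        exact add_le_add le_rfl hδε.le

theorem content_biUnion_le {ι : Type*} (t : ℝ) (S : Finset ι) (B : ι → Set (ℝ × ℝ)) :
    content t (⋃ i ∈ S, B i) ≤ ∑ i ∈ S, content t (B i) := by
  rw [← Finset.sum_coe_sort S fun i => content t (B i), ← tsum_fintype (L := .unconditional _)]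
  refine le_trans (le_of_eq ?_) (content_iUnion_le t fun i : S => B i)
  congr 1
  ext x
  simp

theorem content_le_tsum {t : ℝ} {B : Set (ℝ × ℝ)} {D : Set (ℕ × ℤ × ℤ)}
    (h : B ⊆ ⋃ q ∈ D, cube q) : content t B ≤ ∑' q : D, content t (B ∩ cube q) := by
  refine le_trans (content_mono fun x hx => ?_) (content_iUnion_le t fun q : D => B ∩ cube q)
  obtain ⟨q, hq, hxq⟩ := mem_iUnion₂.1 (h hx)
  exact mem_iUnion.2 ⟨⟨q, hq⟩, hx, hxq⟩

theorem content_le_children (t : ℝ) (B : Set (ℝ × ℝ)) (p : ℕ × ℤ × ℤ) :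
    content t (B ∩ cube p) ≤ ∑ q ∈ children p, content t (B ∩ cube q) := by
  refine le_trans (content_mono (le_of_eq ?_))
    (content_biUnion_le t (children p) fun q => B ∩ cube q)
  rw [cube_eq_children p, inter_iUnion₂]

/-- The content is additive on children as long as it does not exceed the trivial bound. -/
theorem sum_children_le {t : ℝ} (ht : 0 ≤ t) {B : Set (ℝ × ℝ)} {p : ℕ × ℤ × ℤ}
    (h : content t (B ∩ cube p) < side t p) :
    ∑ q ∈ children p, content t (B ∩ cube q) ≤ content t (B ∩ cube p) := by
  refine le_of_forall_gt fun c hc => ?_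
  obtain ⟨D, hD1, hD2⟩ := exists_cover_of_content_lt (lt_min hc h)
  rw [lt_min_iff] at hD2
  refine lt_of_le_of_lt ?_ hD2.1
  have hlev : ∀ q ∈ D, p.1 < q.1 := fun q hq => by
    by_contra hcon
    push Not at hcon
    exact absurd ((side_le ht hcon).trans (ENNReal.le_tsum (f := fun q : D => side t q) ⟨q, hq⟩))
      (not_le.2 hD2.2)
  let S : ℕ × ℤ × ℤ → Set (ℕ × ℤ × ℤ) := fun q => {r ∈ D | cube r ⊆ cube q ∧ (cube r).Nonempty}
  have hS : ∀ q ∈ children p, content t (B ∩ cube q) ≤ ∑' r : S q, side t r := by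
    intro q hq
    refine content_le fun x hx => ?_
    obtain ⟨r, hr, hxr⟩ := mem_iUnion₂.1 (hD1 ⟨hx.1, cube_subset_of_mem_children hq hx.2⟩)
    refine mem_iUnion₂.2 ⟨r, ⟨hr, cube_subset ?_ hx.2 hxr, ⟨x, hxr⟩⟩, hxr⟩
    rw [fst_of_mem_children hq]
    exact hlev r hr
  have hdisj : (children p : Set (ℕ × ℤ × ℤ)).PairwiseDisjoint S := by
    intro q hq q' hq' hne
    refine disjoint_left.2 fun r hr hr' => hne ?_
    obtain ⟨x, hx⟩ := hr.2.2
    rw [eq_of_mem_cube (hr.2.1 hx), eq_of_mem_cube (hr'.2.1 hx), fst_of_mem_children hq,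
      fst_of_mem_children hq']
  calc ∑ q ∈ children p, content t (B ∩ cube q) ≤ ∑ q ∈ children p, ∑' r : S q, side t r :=
        Finset.sum_le_sum hS
    _ = ∑' r : ⋃ q ∈ children p, S q, side t r :=
        (Summable.tsum_finset_bUnion_disjoint hdisj fun _ _ => ENNReal.summable).symm
    _ ≤ ∑' r : D, side t r :=
        ENNReal.tsum_mono_subtype _ (iUnion₂_subset fun _ _ => sep_subset _ _)

theorem content_eq_zero_of_le {t : ℝ} {θ : ℝ≥0∞} (hθ : θ < 1) {B : Set (ℝ × ℝ)}
    (hB : content t B ≠ ∞) (h : ∀ q, content t (B ∩ cube q) ≤ θ * side t q) :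
    content t B = 0 := by
  by_contra h0
  have hlt : content t B < content t B / θ := by
    rcases eq_or_ne θ 0 with rfl | hθ0
    · rw [ENNReal.div_zero h0]
      exact hB.lt_top
    · rw [ENNReal.lt_div_iff_mul_lt (Or.inl hθ0) (Or.inl (hθ.trans ENNReal.one_lt_top).ne)]
      calc content t B * θ < content t B * 1 := by
            exact ENNReal.mul_lt_mul_right h0 hB hθ
        _ = _ := mul_one _
  obtain ⟨D, hD1, hD2⟩ := exists_cover_of_content_lt hlt
  refine lt_irrefl (content t B) ?_
  calc content t B ≤ ∑' q : D, content t (B ∩ cube q) := content_le_tsum hD1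
    _ ≤ ∑' q : D, θ * side t q := ENNReal.tsum_le_tsum fun q => h q
    _ = θ * ∑' q : D, side t q := ENNReal.tsum_mul_left
    _ < _ := ENNReal.mul_lt_of_lt_div' hD2

open Classical in
/-- The coarsest dyadic squares satisfying a predicate, among `n` generations of descendants. -/
noncomputable def coarsestCover (P : ℕ × ℤ × ℤ → Prop) : ℕ → ℕ × ℤ × ℤ → Set (ℕ × ℤ × ℤ)
  | 0, p => if P p then {p} else ∅
  | n + 1, p => if P p then {p} else ⋃ q ∈ children p, coarsestCover P n q

theorem coarsestCover_subset_succ (P : ℕ × ℤ × ℤ → Prop) (n : ℕ) (p : ℕ × ℤ × ℤ) :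
    coarsestCover P n p ⊆ coarsestCover P (n + 1) p := by
  induction n generalizing p with
  | zero =>
    rw [coarsestCover, coarsestCover]
    split_ifs
    · exact subset_rfl
    · exact empty_subset _
  | succ n ih =>
    rw [coarsestCover, coarsestCover]
    split_ifs
    · exact subset_rfl
    · exact iUnion₂_mono fun q _ => ih q

theorem mem_coarsestCover {P : ℕ × ℤ × ℤ → Prop} {n i : ℕ} {p : ℕ × ℤ × ℤ} {x : ℝ × ℝ}
    (hx : x ∈ cube p) (hi : i ≤ n) (h : P (p.1 + i, dcell (p.1 + i) x)) :
    ∃ q ∈ coarsestCover P n p, x ∈ cube q := by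
  induction n generalizing p i with
  | zero =>
    obtain rfl : i = 0 := by omega
    rw [add_zero, ← eq_of_mem_cube hx] at h
    exact ⟨p, by rw [coarsestCover, if_pos h]; rfl, hx⟩
  | succ n ih =>
    by_cases hp : P p
    · exact ⟨p, by rw [coarsestCover, if_pos hp]; rfl, hx⟩
    · rcases i with - | i
      · rw [add_zero, ← eq_of_mem_cube hx] at h
        exact absurd h hp
      · have e : p.1 + (i + 1) = (p.1 + 1, dcell (p.1 + 1) x).1 + i := by
          simp only
          omega
        rw [e] at h
        obtain ⟨q, hq, hxq⟩ := ih (mem_cube_self (p.1 + 1) x) (by omega) h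
        refine ⟨q, ?_, hxq⟩
        rw [coarsestCover, if_neg hp]
        exact mem_iUnion₂.2 ⟨_, mem_children_of_mem_cube.2 hx, hq⟩

theorem tsum_iUnion_le_of_monotone {α : Type*} {f : α → ℝ≥0∞} {D : ℕ → Set α} (hD : Monotone D)
    {c : ℝ≥0∞} (h : ∀ n, ∑' x : D n, f x ≤ c) : ∑' x : ⋃ n, D n, f x ≤ c := by
  classical
  rw [ENNReal.tsum_eq_iSup_sum]
  refine iSup_le fun F => ?_
  choose N hN using fun x : (⋃ n, D n : Set α) => mem_iUnion.1 x.2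
  refine le_trans ?_ (h (F.sup N))
  rw [tsum_subtype (D (F.sup N)) f]
  calc ∑ x ∈ F, f x = ∑ x ∈ F, (D (F.sup N)).indicator f x :=
        Finset.sum_congr rfl fun x hx =>
          (indicator_of_mem (hD (Finset.le_sup (f := N) hx) (hN x)) f).symm
    _ = ∑ x ∈ F.map (Function.Embedding.subtype _), (D (F.sup N)).indicator f x := by
        rw [Finset.sum_map]
        rfl
    _ ≤ _ := ENNReal.sum_le_tsum _

/-- Dyadic content is continuous along increasing unions. -/
theorem content_iUnion_le_iSup {t : ℝ} (ht : 0 ≤ t) {B : ℕ → Set (ℝ × ℝ)} (hB : Monotone B)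
    (p : ℕ × ℤ × ℤ) :
    content t ((⋃ n, B n) ∩ cube p) ≤ ⨆ n, content t (B n ∩ cube p) := by
  set G : ℕ × ℤ × ℤ → ℝ≥0∞ := fun q => ⨆ n, content t (B n ∩ cube q) with hG
  have hBG : ∀ n q, content t (B n ∩ cube q) ≤ G q := fun n q =>
    le_iSup (fun n => content t (B n ∩ cube q)) n
  refine ENNReal.le_of_forall_lt_one_mul_le fun θ hθ => ?_
  rcases eq_or_ne θ 0 with rfl | h0
  · rw [zero_mul]
    exact zero_le
  set P : ℕ × ℤ × ℤ → Prop := fun q => θ * side t q < G q with hP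
  have hcost : ∀ n q, θ * ∑' r : coarsestCover P n q, side t r ≤ G q := by
    intro n
    induction n with
    | zero =>
      intro q
      by_cases hq : P q
      · rw [show coarsestCover P 0 q = {q} from if_pos hq, tsum_singleton q (side t)]
        exact hq.le
      · rw [show coarsestCover P 0 q = ∅ from if_neg hq]
        simp
    | succ n ih =>
      intro q
      by_cases hq : P q
      · rw [show coarsestCover P (n + 1) q = {q} from if_pos hq, tsum_singleton q (side t)]
        exact hq.le
      · have hlt : G q < side t q := by
          refine (not_lt.1 hq).trans_lt ?_
          rw [mul_comm]
          calc side t q * θ < side t q * 1 :=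
                ENNReal.mul_lt_mul_right (side_pos t q).ne' (side_ne_top t q) hθ
            _ = _ := mul_one _
        rw [show coarsestCover P (n + 1) q = ⋃ q' ∈ children q, coarsestCover P n q' from if_neg hq]
        calc θ * ∑' r : ⋃ q' ∈ children q, coarsestCover P n q', side t r
            ≤ θ * ∑ q' ∈ children q, ∑' r : coarsestCover P n q', side t r :=
              mul_le_mul_right (ENNReal.tsum_biUnion_le (side t) (children q) (coarsestCover P n)) _
          _ = ∑ q' ∈ children q, θ * ∑' r : coarsestCover P n q', side t r := Finset.mul_sum _ _ _
          _ ≤ ∑ q' ∈ children q, G q' := Finset.sum_le_sum fun q' _ => ih q'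
          _ = ⨆ n, ∑ q' ∈ children q, content t (B n ∩ cube q') :=
              ENNReal.finsetSum_iSup_of_monotone fun q' i j hij =>
                content_mono (inter_subset_inter_left _ (hB hij))
          _ ≤ G q := iSup_le fun k =>
              (sum_children_le ht ((hBG k q).trans_lt hlt)).trans (hBG k q)
  have hcost' : ∑' r : ⋃ n, coarsestCover P n p, side t r ≤ G p / θ := by
    refine tsum_iUnion_le_of_monotone (monotone_nat_of_le_succ fun n =>
      coarsestCover_subset_succ P n p) fun n => ?_
    rw [ENNReal.le_div_iff_mul_le (Or.inl h0) (Or.inl (hθ.trans ENNReal.one_lt_top).ne), mul_comm]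
    exact hcost n p
  set R : ℕ → Set (ℝ × ℝ) := fun n =>
    {x ∈ B n ∩ cube p | ∀ i, ¬ P (p.1 + i, dcell (p.1 + i) x)} with hR
  have hR0 : ∀ n, content t (R n) = 0 := by
    intro n
    refine content_eq_zero_of_le hθ (ne_top_of_le_ne_top (side_ne_top t p)
      (content_le_side fun x hx => hx.1.2)) fun q => ?_
    rcases (R n ∩ cube q).eq_empty_or_nonempty with he | ⟨x, hxR, hxq⟩
    · rw [he, nonpos_iff_eq_zero.1 (le_trans (content_le (D := ∅) (empty_subset _)) (by simp))]
      exact zero_le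
    · rcases le_total p.1 q.1 with hpq | hpq
      · have := hxR.2 (q.1 - p.1)
        rw [Nat.add_sub_cancel' hpq, ← eq_of_mem_cube hxq] at this
        refine le_trans ((content_mono ?_).trans (hBG n q)) (not_lt.1 this)
        exact inter_subset_inter_left _ fun z hz => hz.1.1
      · have := hxR.2 0
        rw [add_zero, ← eq_of_mem_cube hxR.1.2] at this
        refine le_trans ((content_mono ?_).trans (hBG n p)) ((not_lt.1 this).trans
          (mul_le_mul_right (side_le ht hpq) θ))
        exact fun z hz => hz.1.1
  have hRU : content t (⋃ n, R n) = 0 :=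
    nonpos_iff_eq_zero.1 ((content_iUnion_le t R).trans (by simp [hR0]))
  have hsub : (⋃ n, B n) ∩ cube p ⊆
      ⋃ b : Bool, cond b (⋃ r ∈ ⋃ n, coarsestCover P n p, cube r) (⋃ n, R n) := by
    rintro x ⟨hx, hxp⟩
    obtain ⟨n, hn⟩ := mem_iUnion.1 hx
    by_cases hst : ∃ i, P (p.1 + i, dcell (p.1 + i) x)
    · obtain ⟨i, hi⟩ := hst
      obtain ⟨q, hq, hxq⟩ := mem_coarsestCover hxp le_rfl hi
      exact mem_iUnion.2 ⟨true, mem_iUnion₂.2 ⟨q, mem_iUnion.2 ⟨i, hq⟩, hxq⟩⟩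
    · push Not at hst
      exact mem_iUnion.2 ⟨false, mem_iUnion.2 ⟨n, ⟨hn, hxp⟩, hst⟩⟩
  calc θ * content t ((⋃ n, B n) ∩ cube p) ≤ θ * (G p / θ) := by
        refine mul_le_mul_right ((content_mono hsub).trans ((content_iUnion_le t _).trans ?_)) θ
        rw [tsum_bool]
        simp only [cond_true, cond_false, hRU, zero_add]
        exact (content_le subset_rfl).trans hcost'
    _ ≤ G p := ENNReal.mul_div_le

theorem content_cube_ne_top (t : ℝ) (B : Set (ℝ × ℝ)) (p : ℕ × ℤ × ℤ) :
    content t (B ∩ cube p) ≠ ∞ :=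
  ne_top_of_le_ne_top (side_ne_top t p) (content_le_side inter_subset_right)

theorem content_empty (t : ℝ) : content t ∅ = 0 :=
  nonpos_iff_eq_zero.1 (le_trans (content_le (D := ∅) (empty_subset _)) (by simp))

theorem content_toReal_le (t : ℝ) (B : Set (ℝ × ℝ)) (p : ℕ × ℤ × ℤ) :
    (content t (B ∩ cube p)).toReal ≤ exp2 (-(p.1 * t)) := by
  refine (ENNReal.toReal_mono (side_ne_top t p) (content_le_side inter_subset_right)).trans ?_
  rw [side, ENNReal.toReal_ofReal (exp2_pos _).le]

/-- A finitely supported nonnegative weight, obeying the Frostman condition on the dyadic squares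
of generations between `a` and `n`. -/
structure IsDyadicFrostman (t : ℝ) (a n : ℕ) (B : Set (ℝ × ℝ)) (X : Finset (ℝ × ℝ))
    (μ : ℝ × ℝ → ℝ) (c : ℝ) : Prop where
  subset : ∀ x ∈ X, x ∈ B
  nonneg : ∀ x, 0 ≤ μ x
  zero : ∀ x, x ∉ X → μ x = 0
  total : ∑ x ∈ X, μ x = c
  cube_le : ∀ q : ℕ × ℤ × ℤ, a ≤ q.1 → q.1 ≤ n → ∀ S ⊆ X, (∀ x ∈ S, x ∈ cube q) →
    ∑ x ∈ S, μ x ≤ exp2 (-(q.1 * t))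

theorem exists_isDyadicFrostman (t : ℝ) (B : Set (ℝ × ℝ)) (d : ℕ) (p : ℕ × ℤ × ℤ) :
    ∃ X μ, IsDyadicFrostman t p.1 (p.1 + d) (B ∩ cube p) X μ
      (content t (B ∩ cube p)).toReal := by
  classical
  induction d generalizing p with
  | zero =>
    rcases (B ∩ cube p).eq_empty_or_nonempty with h | ⟨x₀, hx₀⟩
    · refine ⟨∅, 0, by simp, by simp, by simp, by simp [h, content_empty], ?_⟩
      intro q _ _ S hS _
      rw [Finset.subset_empty.1 hS, Finset.sum_empty]
      exact (exp2_pos _).le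
    · have htot : ∑ x ∈ {x₀}, (fun x => if x = x₀ then (content t (B ∩ cube p)).toReal else 0) x =
          (content t (B ∩ cube p)).toReal := by simp
      have hnn : ∀ x, 0 ≤ (fun x => if x = x₀ then (content t (B ∩ cube p)).toReal else 0) x :=
        fun x => by
          simp only
          split_ifs
          · exact ENNReal.toReal_nonneg
          · exact le_rfl
      refine ⟨{x₀}, fun x => if x = x₀ then (content t (B ∩ cube p)).toReal else 0, ?_, hnn, ?_,
        htot, ?_⟩
      · intro x hx
        rwa [Finset.mem_singleton.1 hx]
      · intro x hx
        exact if_neg fun h => hx (Finset.mem_singleton.2 h)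
      · intro q hq1 hq2 S hS _
        refine (Finset.sum_le_sum_of_subset_of_nonneg hS fun x _ _ => hnn x).trans ?_
        rw [htot, show q.1 = p.1 by omega]
        exact content_toReal_le t B p
  | succ d ih =>
    choose X μ hX using ih
    set c := (content t (B ∩ cube p)).toReal with hc
    set S := ∑ q ∈ children p, (content t (B ∩ cube q)).toReal with hS
    have hcS : c ≤ S := by
      rw [hS, ← ENNReal.toReal_sum fun q _ => content_cube_ne_top t B q]
      exact ENNReal.toReal_mono (ENNReal.sum_ne_top.2 fun q _ => content_cube_ne_top t B q)
        (content_le_children t B p)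
    have hc0 : 0 ≤ c := ENNReal.toReal_nonneg
    have hl0 : 0 ≤ c / S := div_nonneg hc0 (hc0.trans hcS)
    have hl1 : c / S ≤ 1 := div_le_one_of_le₀ hcS (hc0.trans hcS)
    have hlS : c / S * S = c := by
      rcases eq_or_ne S 0 with h | h
      · rw [h, mul_zero]
        linarith
      · exact div_mul_cancel₀ c h
    set Y := (children p).biUnion X with hY
    set ν : ℝ × ℝ → ℝ := fun x => c / S * ∑ q ∈ children p, μ q x with hν
    have hsum : ∀ Z ⊆ Y, ∑ x ∈ Z, ν x = c / S * ∑ q ∈ children p, ∑ x ∈ Z with x ∈ X q, μ q x := by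
      intro Z _
      rw [hν, ← Finset.mul_sum, Finset.sum_comm]
      congr 1
      refine Finset.sum_congr rfl fun q _ => ?_
      rw [Finset.sum_filter]
      refine Finset.sum_congr rfl fun x _ => ?_
      split_ifs with h
      · rfl
      · exact (hX q).zero x h
    have hnn : ∀ x, 0 ≤ ν x := fun x =>
      mul_nonneg hl0 (Finset.sum_nonneg fun q _ => (hX q).nonneg x)
    have htot : ∑ x ∈ Y, ν x = c := by
      rw [hsum Y subset_rfl]
      refine Eq.trans ?_ hlS
      congr 1
      refine Finset.sum_congr rfl fun q hq => ?_
      rw [← (hX q).total]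
      congr 1
      ext x
      simp only [Finset.mem_filter, hY, Finset.mem_biUnion]
      exact ⟨fun h => h.2, fun h => ⟨⟨q, hq, h⟩, h⟩⟩
    refine ⟨Y, ν, ?_, hnn, ?_, htot, ?_⟩
    · intro x hx
      obtain ⟨q, hq, hxq⟩ := Finset.mem_biUnion.1 hx
      have := (hX q).subset x hxq
      exact ⟨this.1, cube_subset_of_mem_children hq this.2⟩
    · intro x hx
      rw [hν]
      simp only
      rw [Finset.sum_eq_zero fun q hq => (hX q).zero x fun h =>
        hx (Finset.mem_biUnion.2 ⟨q, hq, h⟩), mul_zero]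
    · intro r hr1 hr2 Z hZ hZr
      rcases eq_or_lt_of_le hr1 with h | h
      · refine (Finset.sum_le_sum_of_subset_of_nonneg hZ fun x _ _ => hnn x).trans ?_
        rw [htot, ← h]
        exact content_toReal_le t B p
      · rcases Z.eq_empty_or_nonempty with rfl | ⟨x₀, hx₀⟩
        · rw [Finset.sum_empty]
          exact (exp2_pos _).le
        · obtain ⟨q₀, hq₀, hxq₀⟩ := Finset.mem_biUnion.1 (hZ hx₀)
          have hx₀' := ((hX q₀).subset x₀ hxq₀).2
          rw [hsum Z hZ, Finset.sum_eq_single_of_mem q₀ hq₀]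
          · refine (mul_le_of_le_one_left (Finset.sum_nonneg fun x _ => (hX q₀).nonneg x)
              hl1).trans ((hX q₀).cube_le r ?_ ?_ _ (fun x hx => (Finset.mem_filter.1 hx).2)
                fun x hx => hZr x (Finset.mem_filter.1 hx).1)
            · rw [fst_of_mem_children hq₀]
              omega
            · rw [fst_of_mem_children hq₀]
              omega
          · intro q hq hne
            refine Finset.sum_eq_zero fun x hx => absurd ?_ hne
            obtain ⟨hxZ, hxq⟩ := Finset.mem_filter.1 hx
            have hx' := ((hX q).subset x hxq).2
            rw [eq_of_mem_cube hx', eq_of_mem_cube hx₀', fst_of_mem_children hq,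
              fst_of_mem_children hq₀,
              dcell_eq_of_le (by omega : p.1 + 1 ≤ r.1) (Eq.trans (hZr x hxZ) (hZr x₀ hx₀).symm)]

theorem sum_ball_le {t : ℝ} {a n : ℕ} {B : Set (ℝ × ℝ)} {X : Finset (ℝ × ℝ)} {μ : ℝ × ℝ → ℝ}
    {c : ℝ} (h : IsDyadicFrostman t a n B X μ c) {j : ℕ} (haj : a ≤ j) (hj : j ≤ n) (p : ℝ × ℝ) :
    ∑ q ∈ X with dist p q ≤ exp2 (-j), μ q ≤ 16 * exp2 (-(j * t)) := by
  classical
  set I := Finset.Icc ⌊(p.1 - exp2 (-j)) / exp2 (-j)⌋ ⌊(p.1 + exp2 (-j)) / exp2 (-j)⌋ ×ˢ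
    Finset.Icc ⌊(p.2 - exp2 (-j)) / exp2 (-j)⌋ ⌊(p.2 + exp2 (-j)) / exp2 (-j)⌋ with hI
  have hcard : (I.card : ℝ) ≤ 16 := by
    have h1 := card_Icc_floor_le (a := p.1) (exp2_pos (-j)) le_rfl
    have h2 := card_Icc_floor_le (a := p.2) (exp2_pos (-j)) le_rfl
    rw [div_self (exp2_pos _).ne', mul_one] at h1 h2
    rw [hI, Finset.card_product, Nat.cast_mul]
    exact (mul_le_mul h1 h2 (Nat.cast_nonneg _) (by norm_num)).trans (by norm_num)
  calc ∑ q ∈ X with dist p q ≤ exp2 (-j), μ q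
      ≤ ∑ q ∈ I.biUnion fun i => X.filter fun x => x ∈ cube (j, i), μ q := by
        refine Finset.sum_le_sum_of_subset_of_nonneg (fun q hq => ?_) fun x _ _ => h.nonneg x
        obtain ⟨hqX, hqd⟩ := Finset.mem_filter.1 hq
        rw [dist_comm] at hqd
        exact Finset.mem_biUnion.2 ⟨dcell j q, Finset.mem_product.2
          ⟨mem_Icc_floor (exp2_pos _) ((abs_fst_sub_le_dist q p).trans hqd),
            mem_Icc_floor (exp2_pos _) ((abs_snd_sub_le_dist q p).trans hqd)⟩,
          Finset.mem_filter.2 ⟨hqX, mem_cube_self j q⟩⟩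
    _ ≤ ∑ i ∈ I, ∑ q ∈ X with q ∈ cube (j, i), μ q := sum_biUnion_le_of_nonneg _ _ h.nonneg
    _ ≤ ∑ _i ∈ I, exp2 (-(j * t)) := Finset.sum_le_sum fun i _ =>
        h.cube_le (j, i) haj hj _ (Finset.filter_subset _ _) fun x hx => (Finset.mem_filter.1 hx).2
    _ ≤ _ := by
        rw [Finset.sum_const, nsmul_eq_mul]
        exact mul_le_mul_of_nonneg_right hcard (exp2_pos _).le

theorem IsDyadicFrostman.isFrostman {t : ℝ} {n k m : ℕ} {B : Set (ℝ × ℝ)}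
    {X : Finset (ℝ × ℝ)} {μ : ℝ × ℝ → ℝ} {c C : ℝ} (h : IsDyadicFrostman t 0 n B X μ c)
    (hc : c ≤ C) (hC : 16 ≤ C) (hk : m * k ≤ n) : IsFrostman X μ C t k m := by
  refine ⟨h.nonneg, h.total.trans_le hc, fun p _ i hi => ?_⟩
  have := sum_ball_le h (zero_le (a := i * k)) ((Nat.mul_le_mul_right k hi).trans hk) p
  push_cast at this
  exact this.trans (mul_le_mul_of_nonneg_right hC (exp2_pos _).le)

/-- The nine dyadic squares touching a given one. -/
noncomputable def neighbours (q : ℕ × ℤ × ℤ) : Finset (ℕ × ℤ × ℤ) :=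
  (Finset.Icc (q.2.1 - 1) (q.2.1 + 1) ×ˢ Finset.Icc (q.2.2 - 1) (q.2.2 + 1)).image fun a => (q.1, a)

theorem card_neighbours_le (q : ℕ × ℤ × ℤ) : (neighbours q).card ≤ 9 := by
  refine Finset.card_image_le.trans ?_
  rw [Finset.card_product, Int.card_Icc, Int.card_Icc]
  have h : ∀ a : ℤ, (a + 1 + 1 - (a - 1)).toNat = 3 := fun a => by
    rw [show a + 1 + 1 - (a - 1) = 3 by ring]
    rfl
  rw [h, h]

theorem abs_floor_sub_floor_le {a b : ℝ} (h : |a - b| ≤ 1) : |⌊b⌋ - ⌊a⌋| ≤ 1 := by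
  rw [abs_le] at *
  have e1 := Int.floor_le a
  have e2 := Int.lt_floor_add_one a
  have f1 := Int.floor_le b
  have f2 := Int.lt_floor_add_one b
  constructor
  · have : ((⌊a⌋ : ℤ) : ℝ) < ((⌊b⌋ + 2 : ℤ) : ℝ) := by push_cast; linarith [h.1, h.2]
    have := Int.cast_lt.1 this
    omega
  · have : ((⌊b⌋ : ℤ) : ℝ) < ((⌊a⌋ + 2 : ℤ) : ℝ) := by push_cast; linarith [h.1, h.2]
    have := Int.cast_lt.1 this
    omega

theorem exists_mem_neighbours {q : ℕ × ℤ × ℤ} {x y : ℝ × ℝ} (hx : x ∈ cube q)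
    (h : dist x y ≤ exp2 (-q.1)) : ∃ r ∈ neighbours q, y ∈ cube r := by
  refine ⟨(q.1, dcell q.1 y), ?_, mem_cube_self _ _⟩
  have hr := exp2_pos (-(q.1 : ℝ))
  have key : ∀ a b : ℝ, |a - b| ≤ exp2 (-(q.1 : ℝ)) →
      |⌊b / exp2 (-(q.1 : ℝ))⌋ - ⌊a / exp2 (-(q.1 : ℝ))⌋| ≤ 1 := fun a b hab => by
    apply abs_floor_sub_floor_le
    rwa [← sub_div, abs_div, abs_of_pos hr, div_le_one hr]
  have h1 := key x.1 y.1 ((abs_fst_sub_le_dist x y).trans h)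
  have h2 := key x.2 y.2 ((abs_snd_sub_le_dist x y).trans h)
  have hq : q.2 = dcell q.1 x := Eq.symm hx
  rw [abs_le] at h1 h2
  refine Finset.mem_image.2 ⟨_, ?_, rfl⟩
  rw [hq]
  simp only [dcell, cell, Finset.mem_product, Finset.mem_Icc]
  omega

theorem exists_isOpen_content_le {t : ℝ} {D : Set (ℕ × ℤ × ℤ)} :
    ∃ U, IsOpen U ∧ (⋃ q ∈ D, cube q) ⊆ U ∧ content t U ≤ 9 * ∑' q : D, side t q := by
  refine ⟨⋃ q ∈ D, ⋃ x ∈ cube q, Metric.ball x (exp2 (-q.1)),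
    isOpen_biUnion fun q _ => isOpen_biUnion fun x _ => Metric.isOpen_ball,
    iUnion₂_mono fun q _ x hx => mem_iUnion₂.2 ⟨x, hx, Metric.mem_ball_self (exp2_pos _)⟩, ?_⟩
  calc content t (⋃ q ∈ D, ⋃ x ∈ cube q, Metric.ball x (exp2 (-q.1)))
      ≤ content t (⋃ q : D, ⋃ r ∈ neighbours q, cube r) := by
        apply content_mono
        intro y hy
        simp only [mem_iUnion, exists_prop] at hy
        obtain ⟨q, hq, x, hx, hxy⟩ := hy
        obtain ⟨r, hr, hyr⟩ := exists_mem_neighbours hx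
          ((dist_comm x y).trans_le (Metric.mem_ball.1 hxy).le)
        exact mem_iUnion.2 ⟨⟨q, hq⟩, mem_iUnion₂.2 ⟨r, hr, hyr⟩⟩
    _ ≤ ∑' q : D, content t (⋃ r ∈ neighbours q, cube r) := content_iUnion_le _ _
    _ ≤ ∑' q : D, 9 * side t q := by
        refine ENNReal.tsum_le_tsum fun q => (content_biUnion_le t _ _).trans ?_
        calc ∑ r ∈ neighbours q, content t (cube r) ≤ ∑ r ∈ neighbours q, side t q := by
              refine Finset.sum_le_sum fun r hr => ?_
              obtain ⟨a, _, rfl⟩ := Finset.mem_image.1 hr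
              exact content_le_side (q := ((q : ℕ × ℤ × ℤ).1, a)) le_rfl
          _ = ((neighbours q).card : ℝ≥0∞) * side t q := by
              rw [Finset.sum_const, nsmul_eq_mul]
          _ ≤ 9 * side t q := by
              gcongr
              exact_mod_cast card_neighbours_le q
    _ = 9 * ∑' q : D, side t q := ENNReal.tsum_mul_left

theorem isCompact_box (m : ℕ → ℕ) : IsCompact {σ : ℕ → ℕ | ∀ i, σ i ≤ m i} := by
  convert isCompact_univ_pi (s := fun i => Iic (m i)) fun i => (finite_Iic (m i)).isCompact
  ext σ
  simp [Pi.le_def]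

/-- A neighbourhood of a compact box in Baire space contains a finite-level box. -/
theorem exists_box_subset {m : ℕ → ℕ} {V : Set (ℕ → ℕ)} (hV : IsOpen V)
    (h : {σ : ℕ → ℕ | ∀ i, σ i ≤ m i} ⊆ V) : ∃ k, {σ : ℕ → ℕ | ∀ i < k, σ i ≤ m i} ⊆ V := by
  by_contra hcon
  push Not at hcon
  choose σ hσ hσV using fun k => not_subset.1 (hcon k)
  obtain ⟨τ, hτ, φ, hφ, hlim⟩ :=
    (isCompact_box m).tendsto_subseq (x := fun k i => min (σ k i) (m i))
    fun k i => min_le_right _ _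
  have hlim' : Tendsto (fun k => σ (φ k)) atTop (nhds τ) := by
    rw [tendsto_pi_nhds] at hlim ⊢
    intro i
    refine (hlim i).congr' ?_
    filter_upwards [eventually_gt_atTop i] with k hk
    exact min_eq_left (hσ (φ k) i (hk.trans_le hφ.le_apply))
  obtain ⟨k, hk⟩ := (hlim'.eventually_mem (hV.mem_nhds (h hτ))).exists
  exact hσV _ hk

/-- Analytic sets of positive content contain compact sets of positive content. -/
theorem exists_isCompact_content_pos {t : ℝ} (ht : 0 ≤ t) {A : Set (ℝ × ℝ)} {p : ℕ × ℤ × ℤ}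
    (hA : AnalyticSet A) (hAp : A ⊆ cube p) (hpos : 0 < content t A) :
    ∃ K ⊆ A, IsCompact K ∧ 0 < content t K := by
  rw [AnalyticSet] at hA
  rcases hA with rfl | ⟨f, hf, rfl⟩
  · simp [content_empty] at hpos
  obtain ⟨c, hc0, hc⟩ := exists_between hpos
  have step : ∀ (S : Set (ℕ → ℕ)) (k : ℕ), c < content t (f '' S) →
      ∃ M : ℕ, c < content t (f '' (S ∩ {σ | σ k ≤ M})) := by
    intro S k hS
    have hmono : Monotone fun M : ℕ => f '' (S ∩ {σ | σ k ≤ M}) := fun M M' hM =>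
      image_mono (inter_subset_inter_right S fun σ (hσ : σ k ≤ M) => hσ.trans hM)
    have hsub : ∀ B : Set (ℕ → ℕ), f '' B ∩ cube p = f '' B := fun B =>
      inter_eq_left.2 ((image_subset_range f B).trans hAp)
    have hle := content_iUnion_le_iSup ht hmono p
    simp only [← image_iUnion, hsub] at hle
    have hU : ⋃ M : ℕ, S ∩ {σ : ℕ → ℕ | σ k ≤ M} = S := by
      ext σ
      simp only [mem_iUnion, mem_inter_iff, mem_ofPred_eq]
      exact ⟨fun ⟨_, h, _⟩ => h, fun h => ⟨σ k, h, le_rfl⟩⟩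
    rw [hU] at hle
    exact lt_iSup_iff.1 (hS.trans_le hle)
  choose! M hM using step
  let S : ℕ → Set (ℕ → ℕ) := fun k => Nat.rec univ (fun k S => S ∩ {σ | σ k ≤ M S k}) k
  have hS : ∀ k, c < content t (f '' S k) := by
    intro k
    induction k with
    | zero => simpa [S] using hc
    | succ k ih => exact hM _ _ ih
  set m : ℕ → ℕ := fun k => M (S k) k with hm
  have hSm : ∀ k, S k = {σ : ℕ → ℕ | ∀ i < k, σ i ≤ m i} := by
    intro k
    induction k with
    | zero => simp [S]
    | succ k ih =>
      have : S (k + 1) = S k ∩ {σ | σ k ≤ m k} := rfl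
      rw [this, ih]
      ext σ
      simp only [mem_inter_iff, mem_ofPred_eq, Nat.lt_succ_iff_lt_or_eq]
      exact ⟨fun h i hi => hi.elim (h.1 i) fun e => e ▸ h.2,
        fun h => ⟨fun i hi => h i (Or.inl hi), h k (Or.inr rfl)⟩⟩
  refine ⟨f '' {σ | ∀ i, σ i ≤ m i}, image_subset_range _ _, (isCompact_box m).image hf, ?_⟩
  refine lt_of_lt_of_le (ENNReal.div_pos hc0.ne' (by simp : (9 : ℝ≥0∞) ≠ ∞))
    (not_lt.1 fun hlt => ?_)
  obtain ⟨D, hD, hDc⟩ := exists_cover_of_content_lt hlt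
  obtain ⟨U, hU, hDU, hUc⟩ := exists_isOpen_content_le (t := t) (D := D)
  obtain ⟨k, hk⟩ := exists_box_subset (hU.preimage hf) (image_subset_iff.1 (hD.trans hDU))
  have h1 := (hS k).trans_le (content_mono (image_subset_iff.2 ((hSm k).subset.trans hk)))
  refine absurd (h1.trans_le hUc) (not_lt.2 ?_)
  calc 9 * ∑' q : D, side t q ≤ 9 * (c / 9) := by gcongr
    _ = c := ENNReal.mul_div_cancel (by simp) (by simp)

theorem ediam_cube_le (q : ℕ × ℤ × ℤ) : Metric.ediam (cube q) ≤ ENNReal.ofReal (exp2 (-q.1)) := by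
  refine Metric.ediam_le fun x hx y hy => ?_
  rw [edist_dist]
  exact ENNReal.ofReal_le_ofReal (dist_le_of_cell_eq (exp2_pos _) (Eq.trans hx (Eq.symm hy)))

theorem dimH_le_of_content_eq_zero {t : ℝ} (ht : 0 < t) {A : Set (ℝ × ℝ)}
    (hA : content t A = 0) : dimH A ≤ ENNReal.ofReal t := by
  have hlt : ∀ n : ℕ, content t A < ENNReal.ofReal (exp2 (-(n * t))) := fun n => by
    rw [hA]
    exact ENNReal.ofReal_pos.2 (exp2_pos _)
  choose D hD hDc using fun n => exists_cover_of_content_lt (hlt n)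
  have hlev : ∀ n, ∀ q ∈ D n, n ≤ q.1 := fun n q hq => by
    have h := ((ENNReal.le_tsum (f := fun q : D n => side t q) ⟨q, hq⟩).trans_lt (hDc n)).le
    have h1 := (ENNReal.ofReal_le_ofReal_iff (exp2_pos _).le).1 h
    rw [exp2_le_iff] at h1
    have h2 : (n : ℝ) ≤ q.1 := le_of_mul_le_mul_right (by linarith) ht
    exact_mod_cast h2
  have hlim : Tendsto (fun n : ℕ => ENNReal.ofReal (exp2 (-n))) atTop (nhds 0) := by
    have h0 : Tendsto (fun n : ℕ => ((1 / 2 : ℝ)) ^ n) atTop (nhds 0) :=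
      tendsto_pow_atTop_nhds_zero_of_lt_one (by norm_num) (by norm_num)
    have h1 := ENNReal.tendsto_ofReal h0
    rw [ENNReal.ofReal_zero] at h1
    refine h1.congr fun n => ?_
    rw [exp2_neg, exp2_natCast, one_div, inv_pow]
  have hμ := Measure.hausdorffMeasure_le_liminf_tsum t A (l := atTop) _ hlim
    (fun n (q : D n) => cube q)
    (Eventually.of_forall fun n q => (ediam_cube_le _).trans
      (ENNReal.ofReal_le_ofReal (exp2_le (neg_le_neg (by exact_mod_cast hlev n q q.2)))))
    (Eventually.of_forall fun n => by simpa only [biUnion_eq_iUnion] using hD n)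
  have hle : μH[t] A ≤ 1 := by
    refine hμ.trans ?_
    refine liminf_le_of_le (by isBoundedDefault) fun b hb => ?_
    obtain ⟨n, hn⟩ := hb.exists
    refine hn.trans ?_
    calc ∑' q : D n, Metric.ediam (cube q) ^ t ≤ ∑' q : D n, side t q := by
          refine ENNReal.tsum_le_tsum fun q => ?_
          refine (ENNReal.rpow_le_rpow (ediam_cube_le _) ht.le).trans (le_of_eq ?_)
          rw [ENNReal.ofReal_rpow_of_pos (exp2_pos _), side, exp2, exp2,
            ← Real.rpow_mul (by norm_num), neg_mul]
      _ ≤ ENNReal.ofReal (exp2 (-(n * t))) := (hDc n).le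
      _ ≤ 1 := by
          rw [← ENNReal.ofReal_one]
          exact ENNReal.ofReal_le_ofReal (exp2_le_one (neg_nonpos.2 (by positivity)))
  have := dimH_le_of_hausdorffMeasure_ne_top (d := t.toNNReal) (s := A)
    (by rw [Real.coe_toNNReal t ht.le]; exact (hle.trans_lt ENNReal.one_lt_top).ne)
  exact this

theorem exists_cover_of_hausdorffMeasure_eq_zero {τ : ℝ} (hτ : 0 < τ) {S : Set ℝ}
    (hS : μH[τ] S = 0) {m : ℕ} (hm : 1 ≤ m) (n₀ : ℕ) :
    ∃ (z : ℕ → ℝ) (κ : ℕ → ℕ), (∀ i, n₀ ≤ κ i) ∧ S ⊆ ⋃ i, Metric.ball (z i) (exp2 (-(m * κ i))) ∧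
      ∀ F : Finset ℕ, ∑ i ∈ F, exp2 (-(τ * m * κ i)) ≤ 1 := by
  have hm' : (1 : ℝ) ≤ m := by exact_mod_cast hm
  set y := exp2 (-(τ * m)) with hy
  have hy0 : 0 < y := exp2_pos _
  have hy1 : y < 1 := by
    have := exp2_lt (x := -(τ * m)) (y := 0) (by nlinarith)
    rwa [exp2_zero] at this
  have hyp : ∀ k : ℕ, y ^ k = exp2 (-(τ * m * k)) := fun k => by
    rw [hy, ← exp2_mul_natCast]
    congr 1
    ring
  set δ : ℝ := y ^ (n₀ + 1) / 2 with hδ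
  have hδ0 : 0 < δ := by positivity
  rw [Measure.hausdorffMeasure_apply] at hS
  have h1 := (iSup₂_le_iff.1 hS.le 1 one_pos).trans_lt (ENNReal.ofReal_pos.2 hδ0)
  simp only [iInf_lt_iff] at h1
  obtain ⟨s, hcov, -, hsum⟩ := h1
  have hsup : ∀ n, (⨆ _ : (s n).Nonempty, Metric.ediam (s n) ^ τ) = Metric.ediam (s n) ^ τ := by
    intro n
    rcases (s n).eq_empty_or_nonempty with h | h
    · simp [h, ENNReal.zero_rpow_of_pos hτ]
    · simp [h]
  simp only [hsup] at hsum
  obtain ⟨ε, hε, hεs⟩ := ENNReal.exists_pos_sum_of_countable (ENNReal.ofReal_pos.2 hδ0).ne' ℕ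
  set W : ℕ → ℝ≥0∞ := fun i => Metric.ediam (s i) ^ τ + ε i with hW
  have hWs : ∑' i, W i ≤ ENNReal.ofReal (y ^ (n₀ + 1)) := by
    rw [hW, ENNReal.tsum_add]
    refine (add_le_add hsum.le hεs.le).trans (le_of_eq ?_)
    rw [← ENNReal.ofReal_add hδ0.le hδ0.le, hδ]
    congr 1
    ring
  have hWtop : ∀ i, W i ≠ ∞ := fun i =>
    ne_top_of_le_ne_top ENNReal.ofReal_ne_top ((ENNReal.le_tsum i).trans hWs)
  have hWlt : ∀ i, Metric.ediam (s i) ^ τ < W i := fun i =>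
    ENNReal.lt_add_right (ne_top_of_le_ne_top (hWtop i) le_self_add)
      (ENNReal.coe_ne_zero.2 (hε i).ne')
  have hW0 : ∀ i, 0 < (W i).toReal := fun i =>
    ENNReal.toReal_pos ((zero_le).trans_lt (hWlt i)).ne' (hWtop i)
  have hWF : ∀ F : Finset ℕ, ∑ i ∈ F, (W i).toReal ≤ y ^ (n₀ + 1) := fun F => by
    rw [← ENNReal.toReal_sum fun i _ => hWtop i]
    exact ENNReal.toReal_le_of_le_ofReal (by positivity) ((ENNReal.sum_le_tsum F).trans hWs)
  have hWle : ∀ i, (W i).toReal ≤ y ^ (n₀ + 1) := fun i => by simpa using hWF {i}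
  choose κ hκ1 hκ2 using fun i => exists_nat_pow_near_of_lt_one (hW0 i)
    ((hWle i).trans (pow_le_one₀ hy0.le hy1.le)) hy0 hy1
  have hz : ∀ i, ∃ z, ∀ x ∈ s i, edist x z ≤ Metric.ediam (s i) := fun i => by
    rcases (s i).eq_empty_or_nonempty with h | ⟨z, hz⟩
    · exact ⟨0, by simp [h]⟩
    · exact ⟨z, fun x hx => Metric.edist_le_ediam_of_mem hx hz⟩
  choose z hz using hz
  refine ⟨z, κ, fun i => ?_, fun x hx => ?_, fun F => ?_⟩
  · have := (pow_lt_pow_iff_right_of_lt_one₀ hy0 hy1).1 ((hκ1 i).trans_le (hWle i))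
    omega
  · obtain ⟨i, hi⟩ := mem_iUnion.1 (hcov hx)
    refine mem_iUnion.2 ⟨i, ?_⟩
    have h2 : Metric.ediam (s i) < ENNReal.ofReal (exp2 (-(m * κ i))) := by
      rw [← ENNReal.rpow_lt_rpow_iff hτ, ENNReal.ofReal_rpow_of_pos (exp2_pos _)]
      refine (hWlt i).trans_le ?_
      rw [← ENNReal.ofReal_toReal (hWtop i)]
      apply ENNReal.ofReal_le_ofReal
      refine (hκ2 i).trans (le_of_eq ?_)
      rw [hyp, exp2, exp2, ← Real.rpow_mul (by norm_num)]
      congr 1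
      ring
    have h3 := (hz i x hi).trans_lt h2
    rw [edist_dist, ENNReal.ofReal_lt_ofReal_iff (exp2_pos _)] at h3
    exact h3
  · have h4 : (∑ i ∈ F, exp2 (-(τ * m * κ i))) * y ≤ y ^ (n₀ + 1) := by
      rw [Finset.sum_mul]
      refine (Finset.sum_le_sum fun i _ => ?_).trans (hWF F)
      rw [← hyp, ← pow_succ]
      exact (hκ1 i).le
    refine le_of_mul_le_mul_right (h4.trans ?_) hy0
    rw [one_mul, pow_succ]
    exact mul_le_of_le_one_left hy0.le (pow_le_one₀ hy0.le hy1.le)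

/-- Compact pinned distance sets of small dimension have efficient covers at scales between
`2 ^ (-m * n₀)` and `2 ^ (-m * N)`. -/
theorem exists_pinned_cover {τ : ℝ} {A K : Set (ℝ × ℝ)} {y : ℝ × ℝ} (hK : IsCompact K)
    (hKA : K ⊆ A) (hdim : dimH ((fun x => planeDist x y) '' A) < ENNReal.ofReal τ) {m : ℕ}
    (hm : 1 ≤ m) (n₀ : ℕ) :
    ∃ (N : ℕ) (I : ℕ → Finset ℝ), (∀ k, ((I k).card : ℝ) ≤ exp2 (τ * m * k)) ∧
      ∀ x ∈ K, ∃ k, n₀ ≤ k ∧ k ≤ N ∧ ∃ z ∈ I k, |planeDist x y - z| ≤ exp2 (-(m * k)) := by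
  classical
  have hτ : 0 < τ := ENNReal.ofReal_pos.1 ((zero_le).trans_lt hdim)
  have hμ := hausdorffMeasure_of_dimH_lt (d := τ.toNNReal) hdim
  rw [Real.coe_toNNReal τ hτ.le] at hμ
  obtain ⟨z, κ, hκ, hcov, hsum⟩ := exists_cover_of_hausdorffMeasure_eq_zero hτ hμ hm n₀
  have hcont : Continuous fun x : ℝ × ℝ => planeDist x y := by
    unfold planeDist
    fun_prop
  obtain ⟨F, hF⟩ := (hK.image hcont).elim_finite_subcover _ (fun i => Metric.isOpen_ball)
    ((image_mono hKA).trans hcov)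
  refine ⟨F.sup κ, fun k => {i ∈ F | κ i = k}.image z, fun k => ?_, fun x hx => ?_⟩
  · have h1 : ((F.filter fun i => κ i = k).card : ℝ) * exp2 (-(τ * m * k)) ≤ 1 := by
      refine le_trans (le_of_eq ?_) (hsum (F.filter fun i => κ i = k))
      rw [Finset.sum_congr rfl (g := fun _ => exp2 (-(τ * m * k))), Finset.sum_const, nsmul_eq_mul]
      intro i hi
      rw [(Finset.mem_filter.1 hi).2]
    rw [exp2_neg, ← div_eq_mul_inv, div_le_one (exp2_pos _)] at h1
    exact (Nat.cast_le.2 Finset.card_image_le).trans h1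
  · obtain ⟨i, hi, hxi⟩ := mem_iUnion₂.1 (hF (mem_image_of_mem _ hx))
    exact ⟨κ i, hκ i, Finset.le_sup hi, z i,
      Finset.mem_image_of_mem _ (Finset.mem_filter.2 ⟨hi, rfl⟩), (Metric.mem_ball.1 hxi).le⟩

theorem sum_exp2_quarter_le (n N : ℕ) :
    ∑ k ∈ Finset.Icc n N, exp2 (-((k : ℝ) / 4)) ≤ 8 * exp2 (-((n : ℝ) / 4)) := by
  have hr : exp2 (-(1 / 4)) ≤ 7 / 8 := by
    have h4 : exp2 (-(1 / 4)) ^ 4 = 1 / 2 := by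
      rw [← exp2_mul_natCast, show -(1 / 4 : ℝ) * (4 : ℕ) = -(1 : ℕ) by norm_num, exp2_neg,
        exp2_natCast]
      norm_num
    refine le_of_pow_le_pow_left₀ (n := 4) (by norm_num) (by norm_num) ?_
    rw [h4]
    norm_num
  have key : ∀ d : ℕ, ∑ k ∈ Finset.Ico n (n + d), exp2 (-((k : ℝ) / 4)) +
      8 * exp2 (-(((n + d : ℕ) : ℝ) / 4)) ≤ 8 * exp2 (-((n : ℝ) / 4)) := by
    intro d
    induction d with
    | zero => simp
    | succ d ih =>
      rw [← add_assoc, Finset.sum_Ico_succ_top (by omega)]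
      have h1 : exp2 (-(((n + d + 1 : ℕ) : ℝ) / 4)) =
          exp2 (-(((n + d : ℕ) : ℝ) / 4)) * exp2 (-(1 / 4)) := by
        rw [← exp2_add]
        congr 1
        push_cast
        ring
      have h2 := mul_le_mul_of_nonneg_left hr (exp2_pos (-(((n + d : ℕ) : ℝ) / 4))).le
      rw [h1]
      linarith
  have hsub : Finset.Icc n N ⊆ Finset.Ico n (n + (N + 1)) := fun k hk => by
    simp only [Finset.mem_Icc, Finset.mem_Ico] at *
    omega
  refine (Finset.sum_le_sum_of_subset_of_nonneg hsub fun k _ _ => (exp2_pos _).le).trans ?_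
  have := key (N + 1)
  have h0 := exp2_pos (-(((n + (N + 1) : ℕ) : ℝ) / 4))
  linarith

theorem exists_exp2_quarter_lt {c : ℝ} (hc : 0 < c) :
    ∃ n₀ : ℕ, ∀ n ≥ n₀, 8 * exp2 (-((n : ℝ) / 4)) < c := by
  obtain ⟨T, hT⟩ := exists_le_exp2 (8 / c + 1)
  refine ⟨⌈4 * T⌉₊, fun n hn => ?_⟩
  have h1 := (Nat.le_ceil (4 * T)).trans (Nat.cast_le.2 hn)
  have h2 := hT ((n : ℝ) / 4) (by linarith)
  have h3 : 8 / c < exp2 ((n : ℝ) / 4) := by linarith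
  rw [div_lt_iff₀ hc] at h3
  rwa [exp2_neg, ← div_eq_mul_inv, div_lt_iff₀ (exp2_pos _), mul_comm c]

theorem exists_abs_le_of_mem_cube (q : ℕ × ℤ × ℤ) :
    ∃ R, ∀ x ∈ cube q, |x.1| ≤ R ∧ |x.2| ≤ R := by
  rcases (cube q).eq_empty_or_nonempty with h | ⟨z, hz⟩
  · exact ⟨0, by simp [h]⟩
  have hd : ∀ x ∈ cube q, dist x z ≤ exp2 (-q.1) := fun x hx =>
    dist_le_of_cell_eq (exp2_pos _) (Eq.trans hx (Eq.symm hz))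
  refine ⟨exp2 (-q.1) + max |z.1| |z.2|, fun x hx => ⟨?_, ?_⟩⟩
  · have h1 := (abs_fst_sub_le_dist x z).trans (hd x hx)
    have h2 := abs_sub_abs_le_abs_sub x.1 z.1
    linarith [le_max_left |z.1| |z.2|]
  · have h1 := (abs_snd_sub_le_dist x z).trans (hd x hx)
    have h2 := abs_sub_abs_le_abs_sub x.2 z.2
    linarith [le_max_right |z.1| |z.2|]

open Classical in
/-- The exceptional set estimate for a localized analytic set and separated pins. -/
theorem dimH_pins_le {s u t τ α C c₀ : ℝ} (hs : 0 < s) (hsu : s ≤ u) (hu : u ≤ 2)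
    (hsu' : 2 * s ≤ u + 1) (ht : t ≤ 2) (hst : 2 < min s 1 + t)
    (hα : α * (2 * u + 2 - 3 * s) = u + 1 - 2 * s) (hτ : τ < 1 - α * (2 - s))
    {A E : Set (ℝ × ℝ)} {p q : ℕ × ℤ × ℤ} (hA : AnalyticSet A) (hp : p.1 = 0) (hAp : A ⊆ cube p)
    (hq : q.1 = 0) (hEq : E ⊆ cube q) (hdim : ENNReal.ofReal s < dimH A)
    (hcell : ∀ W : Finset (ℝ × ℝ), ↑W ⊆ A → ∀ n : ℕ,
      ((W.image (dcell n)).card : ℝ) ≤ C * exp2 (u * n))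
    (hc₀ : 0 < c₀) (hsep : ∀ x ∈ A, ∀ y ∈ E, c₀ ≤ |x.1 - y.1|)
    (hE : ∀ y ∈ E, dimH ((fun x => planeDist x y) '' A) < ENNReal.ofReal τ) :
    dimH E ≤ ENNReal.ofReal t := by
  have ht0 : 0 < t := by linarith [min_le_right s 1]
  have hApos : 0 < content s A := by
    by_contra h
    exact absurd hdim (not_lt.2 (dimH_le_of_content_eq_zero hs (nonpos_iff_eq_zero.1 (not_lt.1 h))))
  obtain ⟨K, hKA, hK, hKpos⟩ := exists_isCompact_content_pos hs.le hA hAp hApos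
  have hKp : K ∩ cube p = K := inter_eq_left.2 (hKA.trans hAp)
  have hEq' : E ∩ cube q = E := inter_eq_left.2 hEq
  have hKtop : content s K ≠ ∞ := by
    have := content_cube_ne_top s K p
    rwa [hKp] at this
  have hEtop : content t E ≠ ∞ := by
    have := content_cube_ne_top t E q
    rwa [hEq'] at this
  have hc1 : 0 < (content s K).toReal := ENNReal.toReal_pos hKpos.ne' hKtop
  refine dimH_le_of_content_eq_zero ht0 ?_
  by_contra hne
  have hc2 : 0 < (content t E).toReal := ENNReal.toReal_pos hne hEtop
  obtain ⟨m, hm, hcore⟩ := sum_pins_lt hs hsu hu hsu' ht hst hα hτ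
  obtain ⟨R₁, hR₁⟩ := exists_abs_le_of_mem_cube p
  obtain ⟨R₂, hR₂⟩ := exists_abs_le_of_mem_cube q
  set R := max 0 (max R₁ R₂) with hR
  have hR1 : R₁ ≤ R := (le_max_left _ _).trans (le_max_right _ _)
  have hR2 : R₂ ≤ R := (le_max_right _ _).trans (le_max_right _ _)
  set C' := max C 16 with hC'
  obtain ⟨T₀, hT₀⟩ := hcore C' R c₀ (le_max_left _ _) hc₀
  obtain ⟨n₁, hn₁⟩ := exists_exp2_quarter_lt hc1
  obtain ⟨n₂, hn₂⟩ := exists_exp2_quarter_lt hc2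
  set n₀ := max ⌈T₀⌉₊ (max n₁ n₂) with hn₀
  have hnT : ∀ k ≥ n₀, T₀ ≤ (k : ℝ) := fun k hk =>
    (Nat.le_ceil T₀).trans (Nat.cast_le.2 ((le_max_left _ _).trans hk))
  have hlt1 := hn₁ n₀ ((le_max_left _ _).trans (le_max_right _ _))
  have hlt2 := hn₂ n₀ ((le_max_right _ _).trans (le_max_right _ _))
  let Cov : ℕ → Set (ℝ × ℝ) := fun N => {y ∈ E | ∃ I : ℕ → Finset ℝ,
    (∀ k, ((I k).card : ℝ) ≤ exp2 (τ * m * k)) ∧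
      ∀ x ∈ K, ∃ k, n₀ ≤ k ∧ k ≤ N ∧ ∃ z ∈ I k, |planeDist x y - z| ≤ exp2 (-(m * k))}
  have hmono : Monotone Cov := fun N N' hN y hy => by
    obtain ⟨hy1, I, hI, h⟩ := hy
    refine ⟨hy1, I, hI, fun x hx => ?_⟩
    obtain ⟨k, h1, h2, h3⟩ := h x hx
    exact ⟨k, h1, h2.trans hN, h3⟩
  have hECov : E ⊆ (⋃ N, Cov N) ∩ cube q := fun y hy => by
    obtain ⟨N, I, hI, h⟩ := exists_pinned_cover hK hKA (hE y hy) hm n₀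
    exact ⟨mem_iUnion.2 ⟨N, hy, I, hI, h⟩, hEq hy⟩
  have hbound : ∀ N, content t (Cov N ∩ cube q) ≤ ENNReal.ofReal (8 * exp2 (-((n₀ : ℝ) / 4))) := by
    intro N
    obtain ⟨X, μ, hX⟩ := exists_isDyadicFrostman s K (m * N) p
    rw [hKp, hp, zero_add] at hX
    have hXp : ∀ x ∈ X, x ∈ cube p := fun x hx => hAp (hKA (hX.subset x hx))
    let Bad : ℕ → Set (ℝ × ℝ) := fun k => {y ∈ E | ∃ I : Finset ℝ,
      (I.card : ℝ) ≤ exp2 (τ * m * k) ∧ exp2 (-((k : ℝ) / 4)) ≤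
        ∑ x ∈ X with ∃ z ∈ I, |planeDist x y - z| ≤ exp2 (-(m * k)), μ x}
    have hsub : Cov N ∩ cube q ⊆ ⋃ k ∈ Finset.Icc n₀ N, Bad k ∩ cube q := by
      rintro y ⟨⟨hyE, I, hI, hcov⟩, hyq⟩
      by_contra hcon
      simp only [mem_iUnion, exists_prop, not_exists, not_and] at hcon
      have hsmall : ∀ k ∈ Finset.Icc n₀ N,
          ∑ x ∈ X with ∃ z ∈ I k, |planeDist x y - z| ≤ exp2 (-(m * k)), μ x ≤
            exp2 (-((k : ℝ) / 4)) := fun k hk => by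
        by_contra hlt
        exact hcon k hk ⟨⟨hyE, I k, hI k, (not_le.1 hlt).le⟩, hyq⟩
      have hle : ∑ x ∈ X, μ x ≤ ∑ k ∈ Finset.Icc n₀ N,
          ∑ x ∈ X with ∃ z ∈ I k, |planeDist x y - z| ≤ exp2 (-(m * k)), μ x := by
        refine le_trans ?_ (sum_biUnion_le_of_nonneg _ _ hX.nonneg)
        refine Finset.sum_le_sum_of_subset_of_nonneg (fun x hx => ?_) fun x _ _ => hX.nonneg x
        obtain ⟨k, h1, h2, h3⟩ := hcov x (hX.subset x hx)
        exact Finset.mem_biUnion.2 ⟨k, Finset.mem_Icc.2 ⟨h1, h2⟩, Finset.mem_filter.2 ⟨hx, h3⟩⟩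
      rw [hX.total] at hle
      linarith [hle.trans (Finset.sum_le_sum hsmall), sum_exp2_quarter_le n₀ N]
    have hBad : ∀ k ∈ Finset.Icc n₀ N,
        content t (Bad k ∩ cube q) ≤ ENNReal.ofReal (exp2 (-((k : ℝ) / 4))) := by
      intro k hk
      obtain ⟨hk1, hk2⟩ := Finset.mem_Icc.1 hk
      obtain ⟨Y, ν, hY⟩ := exists_isDyadicFrostman t (Bad k) (m * k) q
      rw [hq, zero_add] at hY
      have hcX : (content s K).toReal ≤ C' := by
        have := content_toReal_le s K p
        rw [hKp] at this
        refine this.trans ((exp2_le_one ?_).trans ((by norm_num : (1 : ℝ) ≤ 16).trans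
          (le_max_right _ _)))
        simp [hp]
      have hcY : (content t (Bad k ∩ cube q)).toReal ≤ C' := by
        refine (content_toReal_le t (Bad k) q).trans ((exp2_le_one ?_).trans
          ((by norm_num : (1 : ℝ) ≤ 16).trans (le_max_right _ _)))
        simp [hq]
      have h := hT₀ k (hnT k hk1) X Y μ ν
        (hX.isFrostman hcX (le_max_right _ _) (Nat.mul_le_mul_left m hk2))
        (hY.isFrostman hcY (le_max_right _ _) le_rfl)
        (fun x hx => ⟨((hR₁ x (hXp x hx)).1).trans hR1, ((hR₁ x (hXp x hx)).2).trans hR1⟩)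
        (fun y hy => ⟨((hR₂ y (hY.subset y hy).2).1).trans hR2,
          ((hR₂ y (hY.subset y hy).2).2).trans hR2⟩)
        (fun x hx y hy => hsep x (hKA (hX.subset x hx)) y (hY.subset y hy).1.1)
        (fun j _ => by
          have h1 := hcell X (fun x hx => hKA (hX.subset x hx)) (j * k)
          unfold dcell at h1
          push_cast at h1
          rw [← mul_assoc] at h1
          exact h1.trans (mul_le_mul_of_nonneg_right (le_max_left _ _) (exp2_pos _).le))
        (fun y hy => (hY.subset y hy).1.2)
      rw [hY.total] at h
      rw [← ENNReal.ofReal_toReal (content_cube_ne_top t (Bad k) q)]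
      exact ENNReal.ofReal_le_ofReal h.le
    refine (content_mono hsub).trans ((content_biUnion_le t _ _).trans
      ((Finset.sum_le_sum hBad).trans ?_))
    rw [← ENNReal.ofReal_sum_of_nonneg fun k _ => (exp2_pos _).le]
    exact ENNReal.ofReal_le_ofReal (sum_exp2_quarter_le n₀ N)
  have hfin : content t E ≤ ENNReal.ofReal (8 * exp2 (-((n₀ : ℝ) / 4))) :=
    (content_mono hECov).trans ((content_iUnion_le_iSup ht0.le hmono q).trans (iSup_le hbound))
  have := ENNReal.toReal_le_of_le_ofReal (mul_nonneg (by norm_num) (exp2_pos _).le) hfin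
  linarith

theorem exp2_le_abs_fst_sub {j : ℕ} {x y : ℝ × ℝ} (h : 2 ≤ |(dcell j x).1 - (dcell j y).1|) :
    exp2 (-j) ≤ |x.1 - y.1| := by
  by_contra hlt
  push Not at hlt
  have hr := exp2_pos (-(j : ℝ))
  have h1 : |y.1 / exp2 (-(j : ℝ)) - x.1 / exp2 (-(j : ℝ))| ≤ 1 := by
    rw [← sub_div, abs_div, abs_of_pos hr, div_le_one hr, abs_sub_comm]
    exact hlt.le
  have h2 := abs_floor_sub_floor_le h1
  simp only [dcell, cell] at h
  omega

theorem exists_cube_subset {p : ℕ × ℤ × ℤ} {x : ℝ × ℝ} (hx : x ∈ cube p) :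
    ∃ p' : ℕ × ℤ × ℤ, p'.1 = 0 ∧ cube p ⊆ cube p' :=
  ⟨(0, dcell 0 x), rfl, cube_subset (Nat.zero_le _) (mem_cube_self 0 x) hx⟩

theorem dimH_pins_le_of_cubes {s u t τ α C : ℝ} (hs : 0 < s) (hsu : s ≤ u) (hu : u ≤ 2)
    (hsu' : 2 * s ≤ u + 1) (ht : t ≤ 2) (hst : 2 < min s 1 + t)
    (hα : α * (2 * u + 2 - 3 * s) = u + 1 - 2 * s) (hτ : τ < 1 - α * (2 - s))
    {A E : Set (ℝ × ℝ)} {J : ℕ} {a b : ℤ × ℤ} (hA : AnalyticSet A) (hAp : A ⊆ cube (J, a))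
    (hEq : E ⊆ cube (J, b)) (hab : 2 ≤ |a.1 - b.1|) (hdim : ENNReal.ofReal s < dimH A)
    (hcell : ∀ W : Finset (ℝ × ℝ), ↑W ⊆ A → ∀ n : ℕ,
      ((W.image (dcell n)).card : ℝ) ≤ C * exp2 (u * n))
    (hE : ∀ y ∈ E, dimH ((fun x => planeDist x y) '' A) < ENNReal.ofReal τ) :
    dimH E ≤ ENNReal.ofReal t := by
  rcases A.eq_empty_or_nonempty with rfl | ⟨x₀, hx₀⟩
  · simp at hdim
  rcases E.eq_empty_or_nonempty with rfl | ⟨y₀, hy₀⟩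
  · simp
  obtain ⟨p, hp, hap⟩ := exists_cube_subset (hAp hx₀)
  obtain ⟨q, hq, hbq⟩ := exists_cube_subset (hEq hy₀)
  refine dimH_pins_le hs hsu hu hsu' ht hst hα hτ hA hp (hAp.trans hap) hq (hEq.trans hbq) hdim
    hcell (exp2_pos (-J)) (fun x hx y hy => exp2_le_abs_fst_sub ?_) hE
  have h1 : dcell J x = a := hAp hx
  have h2 : dcell J y = b := hEq hy
  rwa [h1, h2]

/-- Perturbation of the exponents. -/
theorem exists_perturbed_exponents {s u t τ : ℝ} (hs : 0 < s) (hsu : s ≤ u) (hu : u ≤ 2)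
    (ht : max 1 (2 - s) < t)
    (hτ : τ < if u ≤ 2 * s - 1 then 1 else s * (2 + u - 2 * s) / (2 + 2 * u - 3 * s)) :
    ∃ s' u' α : ℝ, 0 < s' ∧ s' < s ∧ s' ≤ u' ∧ u' ≤ 2 ∧ (u < u' ∨ u' = 2) ∧ 2 * s' ≤ u' + 1 ∧
      2 < min s' 1 + t ∧ α * (2 * u' + 2 - 3 * s') = u' + 1 - 2 * s' ∧ τ < 1 - α * (2 - s') := by
  have ht1 : 1 < t := (le_max_left _ _).trans_lt ht
  have ht2 : 2 - s < t := (le_max_right _ _).trans_lt ht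
  obtain ⟨σ, hσ0, hσs, hσu, hσu', hσt, hστ⟩ : ∃ σ : ℝ, 0 < σ ∧ σ ≤ s ∧ σ ≤ u ∧ 2 * σ ≤ u + 1 ∧
      2 < min σ 1 + t ∧ τ < 1 - (u + 1 - 2 * σ) / (2 * u + 2 - 3 * σ) * (2 - σ) := by
    by_cases h : u ≤ 2 * s - 1
    · rw [if_pos h] at hτ
      refine ⟨(u + 1) / 2, by linarith, by linarith, by linarith, by linarith, ?_, ?_⟩
      · rw [min_eq_right (by linarith)]
        linarith
      · rw [show u + 1 - 2 * ((u + 1) / 2) = 0 by ring]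
        simpa using hτ
    · rw [if_neg h] at hτ
      refine ⟨s, hs, le_rfl, hsu, by linarith, ?_, ?_⟩
      · rcases min_cases s 1 with h1 | h1 <;> linarith [h1.1]
      · have hD : (0 : ℝ) < 2 + 2 * u - 3 * s := by
          rcases le_total s 1 with h1 | h1 <;> linarith
        refine hτ.trans_le (le_of_eq ?_)
        rw [show 2 * u + 2 - 3 * s = 2 + 2 * u - 3 * s by ring, eq_sub_iff_add_eq,
          div_mul_eq_mul_div, ← add_div, div_eq_one_iff_eq hD.ne']
        ring
  have hD : 0 < 2 * u + 2 - 3 * σ := by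
    rcases le_total σ 1 with h1 | h1 <;> linarith
  have hm : min (u + 0) 2 = u := by rw [add_zero, min_eq_left hu]
  have hc1 : ContinuousAt (fun ε : ℝ => 2 * min (u + ε) 2 + 2 - 3 * (σ - ε)) 0 := by fun_prop
  have hc2 : ContinuousAt (fun ε : ℝ => min (σ - ε) 1 + t) 0 := by fun_prop
  have hc3 : ContinuousAt (fun ε : ℝ => 1 - (min (u + ε) 2 + 1 - 2 * (σ - ε)) /
      (2 * min (u + ε) 2 + 2 - 3 * (σ - ε)) * (2 - (σ - ε))) 0 := by
    have h0 : 2 * min (u + 0) 2 + 2 - 3 * (σ - 0) ≠ 0 := by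
      rw [hm, sub_zero]
      exact hD.ne'
    have hn : ContinuousAt (fun ε : ℝ => min (u + ε) 2 + 1 - 2 * (σ - ε)) 0 := by fun_prop
    have hl : ContinuousAt (fun ε : ℝ => 2 - (σ - ε)) 0 := by fun_prop
    exact continuousAt_const.sub ((hn.div hc1 h0).mul hl)
  have e1 : ∀ᶠ ε : ℝ in nhds 0, 0 < 2 * min (u + ε) 2 + 2 - 3 * (σ - ε) :=
    continuousAt_const.eventually_lt hc1 (by rw [hm, sub_zero]; exact hD)
  have e2 : ∀ᶠ ε : ℝ in nhds 0, 2 < min (σ - ε) 1 + t :=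
    continuousAt_const.eventually_lt hc2 (by rw [sub_zero]; exact hσt)
  have e3 := continuousAt_const.eventually_lt hc3 (show τ < _ by rw [hm, sub_zero]; exact hστ)
  have e4 : ∀ᶠ ε : ℝ in nhds 0, ε < σ := eventually_lt_nhds hσ0
  obtain ⟨ε, ⟨h1, h2, h3, h4⟩, hε⟩ := ((((e1.and (e2.and (e3.and e4))).filter_mono
    (nhdsWithin_le_nhds (s := Ioi 0))).and self_mem_nhdsWithin)).exists
  have hε' : 0 < ε := hε
  have humin : u ≤ min (u + ε) 2 := le_min (by linarith) hu
  refine ⟨σ - ε, min (u + ε) 2, _, by linarith, by linarith, by linarith, min_le_right _ _, ?_,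
    by linarith, h2, div_mul_cancel₀ _ h1.ne', h3⟩
  rcases min_cases (u + ε) 2 with h | h
  · left
    linarith [h.1]
  · exact Or.inr h.1

theorem card_image_dcell_le (n : ℕ) (x' : ℝ × ℝ) {ρ : ℝ} (hρ : exp2 (-n) ≤ ρ)
    {W : Finset (ℝ × ℝ)} (hd : ∀ w ∈ W, dist w x' ≤ ρ) :
    ((W.image (dcell n)).card : ℝ) ≤ 16 * (ρ / exp2 (-n)) ^ 2 :=
  card_image_cell_le (exp2_pos _) hρ x' hd

theorem card_image_dcell_le_of_subset_cube {p : ℕ × ℤ × ℤ} {W : Finset (ℝ × ℝ)}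
    (hW : ∀ w ∈ W, w ∈ cube p) (n : ℕ) :
    ((W.image (dcell n)).card : ℝ) ≤ 16 * exp2 (2 * n) := by
  rcases W.eq_empty_or_nonempty with rfl | ⟨w₀, hw₀⟩
  · simpa using (exp2_pos _).le
  refine (card_image_dcell_le n w₀ (ρ := 1)
    (exp2_le_one (neg_nonpos.2 (Nat.cast_nonneg _))) fun w hw => ?_).trans (le_of_eq ?_)
  · exact (dist_le_of_cell_eq (exp2_pos _) (Eq.trans (hW w hw) (Eq.symm (hW w₀ hw₀)))).trans
      (exp2_le_one (neg_nonpos.2 (Nat.cast_nonneg _)))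
  · rw [exp2_neg, one_div, inv_inv, ← exp2_mul_natCast, Nat.cast_ofNat, mul_comm (n : ℝ)]

section

variable {X : Type*} [PseudoMetricSpace X]

/-- Sets of upper box dimension less than `v` have covers by at most `C * 2 ^ (v * n)` closed balls
of radius `2 ^ (-n)`. -/
theorem exists_cover_of_ubDim_lt {F : Set X} {v : ℝ} (h : ubDim F < ENNReal.ofReal v) :
    ∃ C : ℝ, ∀ n : ℕ, ∃ t : Finset X, closure F ⊆ ⋃ x ∈ t, Metric.closedBall x (exp2 (-n)) ∧
      (t.card : ℝ) ≤ C * exp2 (v * n) := by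
  have hv : 0 < v := ENNReal.ofReal_pos.1 ((zero_le).trans_lt h)
  rw [ubDim] at h
  split_ifs at h with hfin
  · simp at h
  push Not at hfin
  have hev := eventually_lt_of_limsup_lt h
  obtain ⟨n₁, hn₁⟩ := eventually_atTop.1 hev
  set N : ℕ → ℝ := fun n => (coverNum F (1 / 2 ^ n)).toReal with hN
  have hN0 : ∀ n, 0 ≤ N n := fun n => ENNReal.toReal_nonneg
  have hlarge : ∀ n ≥ n₁ + 1, N n ≤ exp2 (v * n) := by
    intro n hn
    rcases (hN0 n).eq_or_lt with h0 | h0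
    · rw [← h0]
      exact (exp2_pos _).le
    have h1 := (ENNReal.ofReal_lt_ofReal_iff hv).1 (hn₁ n (by omega))
    have hn0 : (0 : ℝ) < n := by
      have : 0 < n := by omega
      exact_mod_cast this
    rw [div_lt_iff₀ hn0] at h1
    rw [← exp2_logb h0]
    exact exp2_le h1.le
  set C := 2 + ∑ i ∈ Finset.range (n₁ + 1), N i with hC
  have hS0 : 0 ≤ ∑ i ∈ Finset.range (n₁ + 1), N i := Finset.sum_nonneg fun i _ => hN0 i
  have hvn : ∀ n : ℕ, 1 ≤ exp2 (v * n) := fun n => one_le_exp2 (by positivity)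
  have hall : ∀ n, N n + 1 ≤ C * exp2 (v * n) := by
    intro n
    have h1 := hvn n
    rcases Nat.lt_or_ge n (n₁ + 1) with hn | hn
    · have h2 := Finset.single_le_sum (f := N) (fun i _ => hN0 i) (Finset.mem_range.2 hn)
      nlinarith
    · have h2 := hlarge n hn
      nlinarith
  refine ⟨C, fun n => ?_⟩
  have hlt : coverNum F (1 / 2 ^ n) < coverNum F (1 / 2 ^ n) + 1 :=
    ENNReal.lt_add_right (hfin n) one_ne_zero
  conv_lhs at hlt => rw [coverNum]
  simp only [iInf_lt_iff] at hlt
  obtain ⟨t, ht, hcard⟩ := hlt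
  refine ⟨t, ?_, ?_⟩
  · refine closure_minimal (ht.trans (iUnion₂_mono fun x _ => ?_))
      (isClosed_biUnion_finset fun x _ => Metric.isClosed_closedBall)
    rw [exp2_neg, exp2_natCast, ← one_div]
    exact Metric.ball_subset_closedBall
  · refine le_trans ?_ (hall n)
    have h1 := ENNReal.toReal_mono (ENNReal.add_ne_top.2 ⟨hfin n, ENNReal.one_ne_top⟩) hcard.le
    rwa [ENNReal.toReal_natCast, ENNReal.toReal_add (hfin n) ENNReal.one_ne_top,
      ENNReal.toReal_one] at h1

theorem exists_card_image_dcell_le {φ : X → ℝ × ℝ} (hφ : LipschitzWith 1 φ) {F : Set X} {v : ℝ}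
    (h : ubDim F < ENNReal.ofReal v) :
    ∃ C : ℝ, ∀ W : Finset (ℝ × ℝ), ↑W ⊆ φ '' closure F → ∀ n : ℕ,
      ((W.image (dcell n)).card : ℝ) ≤ C * exp2 (v * n) := by
  classical
  obtain ⟨C, hC⟩ := exists_cover_of_ubDim_lt h
  refine ⟨16 * C, fun W hW n => ?_⟩
  obtain ⟨t, ht, hcard⟩ := hC n
  have hsub : W.image (dcell n) ⊆
      t.biUnion fun z => (W.filter fun w => dist w (φ z) ≤ exp2 (-n)).image (dcell n) := by
    intro q hq
    obtain ⟨w, hw, rfl⟩ := Finset.mem_image.1 hq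
    obtain ⟨x, hx, rfl⟩ := hW hw
    obtain ⟨z, hz, hxz⟩ := mem_iUnion₂.1 (ht hx)
    refine Finset.mem_biUnion.2 ⟨z, hz, Finset.mem_image_of_mem _ (Finset.mem_filter.2 ⟨hw, ?_⟩)⟩
    have := hφ.dist_le_mul x z
    rw [NNReal.coe_one, one_mul] at this
    exact this.trans (Metric.mem_closedBall.1 hxz)
  have h1 : ((W.image (dcell n)).card : ℝ) ≤ ∑ z ∈ t,
      (((W.filter fun w => dist w (φ z) ≤ exp2 (-n)).image (dcell n)).card : ℝ) := by
    exact_mod_cast (Finset.card_le_card hsub).trans Finset.card_biUnion_le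
  have h2 : ∀ z ∈ t,
      (((W.filter fun w => dist w (φ z) ≤ exp2 (-n)).image (dcell n)).card : ℝ) ≤ 16 := by
    intro z _
    refine (card_image_dcell_le n (φ z) le_rfl fun w hw => (Finset.mem_filter.1 hw).2).trans ?_
    rw [div_self (exp2_pos _).ne']
    norm_num
  refine h1.trans ((Finset.sum_le_sum h2).trans ?_)
  rw [Finset.sum_const, nsmul_eq_mul]
  linarith

end

section

variable {X : Type*} [PseudoMetricSpace X] {φ : X → ℝ × ℝ}

theorem lipschitzWith_of_planeDist (hφ : ∀ x y, planeDist (φ x) (φ y) = dist x y) :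
    LipschitzWith 1 φ := by
  refine LipschitzWith.of_dist_le_mul fun x y => ?_
  rw [NNReal.coe_one, one_mul, ← hφ, Prod.dist_eq, Real.dist_eq, Real.dist_eq, planeDist]
  exact max_le (Real.abs_le_sqrt (by linarith [sq_nonneg ((φ x).2 - (φ y).2)]))
    (Real.abs_le_sqrt (by linarith [sq_nonneg ((φ x).1 - (φ y).1)]))

theorem antilipschitzWith_of_planeDist (hφ : ∀ x y, planeDist (φ x) (φ y) = dist x y) :
    AntilipschitzWith 2 φ := by
  refine AntilipschitzWith.of_le_mul_dist fun x y => ?_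
  rw [← hφ, planeDist_eq_norm]
  refine (Complex.norm_le_abs_re_add_abs_im _).trans ?_
  have h1 := abs_fst_sub_le_dist (φ x) (φ y)
  have h2 := abs_snd_sub_le_dist (φ x) (φ y)
  rw [NNReal.coe_ofNat]
  linarith

end

theorem measurableSet_cube (q : ℕ × ℤ × ℤ) : MeasurableSet (cube q) := by
  have h : Measurable (dcell q.1) := by
    unfold dcell cell
    exact (Int.measurable_floor.comp (measurable_fst.div_const _)).prodMk
      (Int.measurable_floor.comp (measurable_snd.div_const _))
  exact h (measurableSet_singleton q.2)

theorem exists_dcell_separated {x y : ℝ × ℝ} (h : x.1 ≠ y.1) :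
    ∃ j : ℕ, 2 ≤ |(dcell j x).1 - (dcell j y).1| := by
  obtain ⟨j, hj⟩ := pow_unbounded_of_one_lt (3 / |x.1 - y.1|) one_lt_two
  refine ⟨j, ?_⟩
  rw [div_lt_iff₀ (abs_pos.2 (sub_ne_zero.2 h))] at hj
  have h1 : 3 ≤ |x.1 / exp2 (-(j : ℝ)) - y.1 / exp2 (-(j : ℝ))| := by
    rw [← sub_div, abs_div, abs_of_pos (exp2_pos _), exp2_neg, exp2_natCast, div_inv_eq_mul,
      mul_comm]
    exact hj.le
  simp only [dcell, cell]
  generalize x.1 / exp2 (-(j : ℝ)) = a at *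
  generalize y.1 / exp2 (-(j : ℝ)) = b at *
  by_contra hlt
  have h2 : |⌊a⌋ - ⌊b⌋| ≤ 1 := by omega
  rw [abs_le] at h2
  have h3 : (-1 : ℝ) ≤ ⌊a⌋ - ⌊b⌋ := by exact_mod_cast h2.1
  have h4 : ((⌊a⌋ : ℝ) - ⌊b⌋) ≤ 1 := by exact_mod_cast h2.2
  rcases le_abs.1 h1 with h5 | h5 <;>
    linarith [Int.floor_le a, Int.floor_le b, Int.lt_floor_add_one a, Int.lt_floor_add_one b]

/-- The two coordinate charts of the plane. -/
def chart (c : Bool) (x : EuclideanSpace ℝ (Fin 2)) : ℝ × ℝ :=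
  if c then (x 0, x 1) else (x 1, x 0)

theorem planeDist_chart (c : Bool) (x y : EuclideanSpace ℝ (Fin 2)) :
    planeDist (chart c x) (chart c y) = dist x y := by
  rw [EuclideanSpace.dist_eq, Fin.sum_univ_two, Real.dist_eq, Real.dist_eq, sq_abs, sq_abs]
  cases c
  · rw [add_comm]
    rfl
  · rfl

theorem exists_chart_fst_ne {x y : EuclideanSpace ℝ (Fin 2)} (h : x ≠ y) :
    ∃ c, (chart c x).1 ≠ (chart c y).1 := by
  by_contra hcon
  push Not at hcon
  apply h
  ext i
  fin_cases i
  · exact hcon true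
  · exact hcon false

theorem continuous_chart (c : Bool) : Continuous (chart c) :=
  (lipschitzWith_of_planeDist (planeDist_chart c)).continuous

/-- A countable cover by closed sets with good covering numbers at all scales. -/
theorem exists_closed_cover {u v : ℝ} {A : Set (EuclideanSpace ℝ (Fin 2))}
    (hA : pDim A ≤ ENNReal.ofReal u) (hu : 0 < u) (huv : u < v ∨ v = 2) :
    ∃ F : ℕ → Set (EuclideanSpace ℝ (Fin 2)), (∀ i, IsClosed (F i)) ∧ A ⊆ ⋃ i, F i ∧
      ∀ i c p, ∃ C : ℝ, ∀ W : Finset (ℝ × ℝ), ↑W ⊆ chart c '' (F i ∩ chart c ⁻¹' cube p) →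
        ∀ n : ℕ, ((W.image (dcell n)).card : ℝ) ≤ C * exp2 (v * n) := by
  rcases huv with h | rfl
  · have h1 := hA.trans_lt ((ENNReal.ofReal_lt_ofReal_iff (hu.trans h)).2 h)
    simp only [pDim, iInf_lt_iff] at h1
    obtain ⟨F, hF, hlt⟩ := h1
    refine ⟨fun i => closure (F i), fun i => isClosed_closure,
      hF.trans (iUnion_mono fun i => subset_closure), fun i c p => ?_⟩
    obtain ⟨C, hC⟩ := exists_card_image_dcell_le
      (lipschitzWith_of_planeDist (planeDist_chart c)) ((le_iSup _ i).trans_lt hlt)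
    exact ⟨C, fun W hW => hC W (hW.trans (image_mono inter_subset_left))⟩
  · refine ⟨fun _ => univ, fun _ => isClosed_univ, fun x _ => mem_iUnion.2 ⟨0, trivial⟩,
      fun i c p => ⟨16, fun W hW => card_image_dcell_le_of_subset_cube (p := p) fun w hw => ?_⟩⟩
    obtain ⟨x, hx, rfl⟩ := hW hw
    exact hx.2

theorem dimH_exceptional_le {s u t τ : ℝ} (hs : 0 < s) (hsu : s ≤ u) (hu : u ≤ 2)
    (ht : max 1 (2 - s) < t) (ht2 : t ≤ 2)
    (hτ : τ < if u ≤ 2 * s - 1 then 1 else s * (2 + u - 2 * s) / (2 + 2 * u - 3 * s))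
    {A : Set (EuclideanSpace ℝ (Fin 2))} (hA : MeasurableSet A)
    (hdimH : ENNReal.ofReal s ≤ dimH A) (hpdim : pDim A ≤ ENNReal.ofReal u) :
    dimH {y | dimH ((fun x => dist x y) '' A) < ENNReal.ofReal τ} ≤ ENNReal.ofReal t := by
  obtain ⟨s', u', α, hs'0, hs's, hsu', hu'2, huu', h2s, hst, hα, hτ'⟩ :=
    exists_perturbed_exponents hs hsu hu ht hτ
  obtain ⟨F, hF, hAF, hcell⟩ := exists_closed_cover hpdim (hs.trans_le hsu) huu'
  set E := {y | dimH ((fun x => dist x y) '' A) < ENNReal.ofReal τ} with hE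
  let P : ℕ × Bool × (ℕ × ℤ × ℤ) → Set (EuclideanSpace ℝ (Fin 2)) :=
    fun k => A ∩ (F k.1 ∩ chart k.2.1 ⁻¹' cube k.2.2)
  let Good : Set ((ℕ × Bool × (ℕ × ℤ × ℤ)) × ℤ × ℤ) :=
    {k | 2 ≤ |k.1.2.2.2.1 - k.2.1| ∧ ENNReal.ofReal s' < dimH (P k.1)}
  have hcov : E ⊆ ⋃ k : Good, E ∩ chart k.1.1.2.1 ⁻¹' cube (k.1.1.2.2.1, k.1.2) := by
    intro y hy
    by_contra hcon
    have hsmall : ∀ k : ℕ × Bool × (ℕ × ℤ × ℤ),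
        2 ≤ |k.2.2.2.1 - (dcell k.2.2.1 (chart k.2.1 y)).1| →
          dimH (P k) ≤ ENNReal.ofReal s' := by
      intro k hk
      by_contra hlt
      exact hcon (mem_iUnion.2 ⟨⟨(k, dcell k.2.2.1 (chart k.2.1 y)), hk, not_le.1 hlt⟩, hy, rfl⟩)
    have hAsub : A ⊆ {y} ∪ ⋃ k : {k : ℕ × Bool × (ℕ × ℤ × ℤ) //
        2 ≤ |k.2.2.2.1 - (dcell k.2.2.1 (chart k.2.1 y)).1|}, P k := by
      intro x hx
      by_cases hxy : x = y
      · exact Or.inl hxy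
      obtain ⟨c, hc⟩ := exists_chart_fst_ne hxy
      obtain ⟨j, hj⟩ := exists_dcell_separated hc
      obtain ⟨i, hi⟩ := mem_iUnion.1 (hAF hx)
      exact Or.inr (mem_iUnion.2 ⟨⟨(i, c, j, dcell j (chart c x)), hj⟩, hx, hi, rfl⟩)
    have h1 := dimH_mono hAsub
    rw [dimH_union, dimH_singleton, dimH_iUnion] at h1
    have h2 : dimH A ≤ ENNReal.ofReal s' :=
      h1.trans (max_le zero_le (iSup_le fun k => hsmall k k.2))
    exact absurd ((ENNReal.ofReal_lt_ofReal_iff hs).2 hs's) (not_lt.2 (hdimH.trans h2))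
  refine (dimH_mono hcov).trans ?_
  rw [dimH_iUnion]
  refine iSup_le ?_
  rintro ⟨⟨⟨i, c, j, a⟩, b⟩, hab, hdim⟩
  have hlip := lipschitzWith_of_planeDist (planeDist_chart c)
  have hanti := antilipschitzWith_of_planeDist (planeDist_chart c)
  obtain ⟨C, hC⟩ := hcell i c (j, a)
  have hmeas : MeasurableSet (P (i, c, j, a)) := hA.inter ((hF i).measurableSet.inter
    ((continuous_chart c).measurable (measurableSet_cube (j, a))))
  refine (hanti.le_dimH_image _).trans (dimH_pins_le_of_cubes (J := j) (a := a) (b := b)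
    (A := chart c '' P (i, c, j, a)) hs'0 hsu' hu'2 h2s ht2 hst hα hτ'
    (hmeas.analyticSet.image_of_continuous (continuous_chart c))
    (image_subset_iff.2 fun x hx => hx.2.2) (image_subset_iff.2 fun x hx => hx.2) hab
    (hdim.trans_le (hanti.le_dimH_image _))
    (fun W hW => hC W (hW.trans (image_mono inter_subset_right))) ?_)
  rintro _ ⟨y, hy, rfl⟩
  refine lt_of_le_of_lt (dimH_mono ?_) hy.1
  rintro _ ⟨_, ⟨x, hx, rfl⟩, rfl⟩
  exact ⟨x, hx.1, (planeDist_chart c x y).symm⟩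

open Classical in
/-- **Theorem.** Let `0 < s ≤ u ≤ 2` and let `χ(s,u) = s(2+u-2s)/(2+2u-3s)` if `u > 2s-1`,
`χ(s,u) = 1` if `u ≤ 2s-1`. If `A ⊆ ℝ²` is Borel with `dimH A ≥ s` and `pdim A ≤ u`, then
the set of `y` with `dimH Δ_y(A) < χ(s,u)` has Hausdorff dimension at most `max(1, 2-s)`. -/
theorem statement1 (s u : ℝ) (hs : 0 < s) (hsu : s ≤ u) (hu : u ≤ 2)
    (A : Set (EuclideanSpace ℝ (Fin 2))) (hA : MeasurableSet A)
    (hdimH : ENNReal.ofReal s ≤ dimH A) (hpdim : pDim A ≤ ENNReal.ofReal u) :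
    dimH {y : EuclideanSpace ℝ (Fin 2) |
        dimH ((fun x => dist x y) '' A) <
          ENNReal.ofReal
            (if u ≤ 2 * s - 1 then 1 else s * (2 + u - 2 * s) / (2 + 2 * u - 3 * s))} ≤
      ENNReal.ofReal (max 1 (2 - s)) := by
  set χ : ℝ := if u ≤ 2 * s - 1 then 1 else s * (2 + u - 2 * s) / (2 + 2 * u - 3 * s) with hχ
  by_contra hlt
  rw [not_le, ENNReal.lt_iff_exists_nnreal_btwn] at hlt
  obtain ⟨r, hr1, hr2⟩ := hlt
  rw [← ENNReal.ofReal_coe_nnreal] at hr1 hr2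
  have hr : max 1 (2 - s) < r :=
    (ENNReal.ofReal_lt_ofReal_iff'.1 hr1).1
  refine absurd hr2 (not_lt.2 ?_)
  have hcov : {y : EuclideanSpace ℝ (Fin 2) |
      dimH ((fun x => dist x y) '' A) < ENNReal.ofReal χ} ⊆
      ⋃ τ : {τ : ℚ // (τ : ℝ) < χ},
        {y | dimH ((fun x => dist x y) '' A) < ENNReal.ofReal (τ : ℚ)} := by
    intro y hy
    obtain ⟨τ, _, h1, h2⟩ := ENNReal.lt_iff_exists_rat_btwn.1 hy
    exact mem_iUnion.2 ⟨⟨τ, (ENNReal.ofReal_lt_ofReal_iff'.1 h2).1⟩, h1⟩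
  refine (dimH_mono hcov).trans ?_
  rw [dimH_iUnion]
  refine iSup_le fun τ => ?_
  have h2 : max 1 (2 - s) < 2 := max_lt (by norm_num) (by linarith)
  refine (dimH_exceptional_le hs hsu hu (lt_min hr h2) (min_le_right _ _) ?_ hA hdimH hpdim).trans
    (ENNReal.ofReal_le_ofReal (min_le_left _ _))
  exact τ.2.trans_le (le_of_eq (by rw [hχ]))
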